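/- arXiv:2412.17220 — 7 statements merged into one kernel-verified Lean document; each statement's English description precedes it below -/
import Mathlib

section
/- Let D be a self-adjoint operator on a Hilbert space H, μ a bounded invertible operator on H, and J any two-sided ideal of B(H) (not necessarily closed). Then (1 + (μDμ*)²)⁻¹ ∈ J if and only if (1 + D²)⁻¹ ∈ J. -/
open ContinuousLinearMap in
/-- Douglas factorization. -/
theorem douglas_factor {H : Type*} [NormedAddCommGroup H] [InnerProductSpace ℂ H]
    [CompleteSpace H] (A B : H →L[ℂ] H) (c : ℝ) (h : ∀ x, ‖A x‖ ≤ c * ‖B x‖) :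
    ∃ W : H →L[ℂ] H, A = W * B := by
  let K : Submodule ℂ H := (LinearMap.range B.toLinearMap).topologicalClosure
  have : CompleteSpace K :=
    (Submodule.isClosed_topologicalClosure _).completeSpace_coe
  have hmem : ∀ x, B.toLinearMap x ∈ K := fun x =>
    Submodule.le_topologicalClosure _ (LinearMap.mem_range_self _ x)
  let e : H →ₗ[ℂ] K := B.toLinearMap.codRestrict K hmem
  have hd : DenseRange e := by
    intro y
    rw [Metric.mem_closure_iff]
    intro ε hε
    have hy : (y : H) ∈ closure (Set.range B) := y.2
    obtain ⟨_, ⟨x, rfl⟩, hx⟩ := Metric.mem_closure_iff.1 hy ε hε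
    exact ⟨e x, ⟨x, rfl⟩, hx⟩
  have hn : ∃ C, ∀ x, ‖A.toLinearMap x‖ ≤ C * ‖e x‖ := ⟨c, fun x => h x⟩
  refine ⟨(A.toLinearMap.extendOfNorm e) ∘L K.orthogonalProjectionOnto, ?_⟩
  ext x
  have h1 : K.orthogonalProjectionOnto (B x) = e x :=
    Submodule.orthogonalProjectionOnto_mem_subspace_eq_self (K := K) (e x)
  have h2 := LinearMap.extendOfNorm_eq hd hn x
  change A x = (A.toLinearMap.extendOfNorm e) (K.orthogonalProjectionOnto (B x))
  rw [h1, h2]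
  rfl

/-- Square root of a positive operator. -/
theorem exists_sqrt_op {H : Type*} [NormedAddCommGroup H] [InnerProductSpace ℂ H]
    [CompleteSpace H] (P : H →L[ℂ] H) (hP : P.IsPositive) :
    ∃ S : H →L[ℂ] H, star S = S ∧ S * S = P ∧
      ∀ x, ‖S x‖ ^ 2 = (inner ℂ (P x) x).re := by
  have hP0 : 0 ≤ P := (ContinuousLinearMap.nonneg_iff_isPositive P).2 hP
  have hs : IsSelfAdjoint (CFC.sqrt P) := (CFC.sqrt_nonneg P).isSelfAdjoint
  have hm := CFC.sqrt_mul_sqrt_self P hP0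
  refine ⟨CFC.sqrt P, hs, hm, fun x => ?_⟩
  have h1 : inner ℂ (P x) x = inner ℂ (CFC.sqrt P x) (CFC.sqrt P x) := by
    conv_lhs => rw [← hm]
    exact hs.isSymmetric (CFC.sqrt P x) x
  rw [h1, inner_self_eq_norm_sq_to_K]
  norm_cast

theorem mem_of_le {H : Type*} [NormedAddCommGroup H] [InnerProductSpace ℂ H]
    [CompleteSpace H] (J : TwoSidedIdeal (H →L[ℂ] H)) (P X : H →L[ℂ] H) (hP : P.IsPositive)
    (c : ℝ) (h : ∀ x, (inner ℂ (P x) x).re ≤ c ^ 2 * ‖X x‖ ^ 2) (hX : X * star X ∈ J) :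
    P ∈ J := by
  obtain ⟨S, hs, hm, hn⟩ := exists_sqrt_op P hP
  obtain ⟨W, hW⟩ := douglas_factor S X |c| (fun x => by
    have h1 := h x
    rw [← hn x, ← mul_pow] at h1
    have h2 := sq_le_sq.1 h1
    rwa [abs_mul, abs_norm, abs_norm] at h2)
  have : P = W * (X * star X) * star W := by
    rw [← hm]
    nth_rw 2 [← hs]
    rw [hW, star_mul]
    simp only [mul_assoc]
  rw [this]
  exact J.mul_mem_right _ _ (J.mul_mem_left _ _ hX)

theorem inner_star_mul_self {H : Type*} [NormedAddCommGroup H] [InnerProductSpace ℂ H]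
    [CompleteSpace H] (X : H →L[ℂ] H) (x : H) :
    (inner ℂ ((star X * X) x) x).re = ‖X x‖ ^ 2 := by
  have : inner ℂ ((star X * X) x) x = inner ℂ (X x) (X x) :=
    ContinuousLinearMap.adjoint_inner_left X x (X x)
  rw [this, inner_self_eq_norm_sq_to_K]
  norm_cast

theorem mem_swap {H : Type*} [NormedAddCommGroup H] [InnerProductSpace ℂ H]
    [CompleteSpace H] (J : TwoSidedIdeal (H →L[ℂ] H)) (X : H →L[ℂ] H)
    (hX : X * star X ∈ J) : star X * X ∈ J :=
  mem_of_le J (star X * X) X (ContinuousLinearMap.isPositive_adjoint_comp_self X) 1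
    (fun x => by rw [inner_star_mul_self]; simp) hX


open ContinuousLinearMap in
/-- Let `D` be a self-adjoint operator on a Hilbert space `H`, encoded by its bounded
transform pair `(F, Q)` (`F = D(1+D²)^{-1/2}`, `Q = (1+D²)^{-1/2}`: `Q` positive injective,
`F` self-adjoint, `FQ = QF`, `F² + Q² = 1`; `dom D = ran Q`, `D(Qξ) = Fξ`).  Let `μ` be a
bounded invertible operator with inverse `ν`, and `R' = (1 + (μDμ*)²)⁻¹`, characterized as
in the resolvent identity hypothesis `hR'`.  Let `J` be any two-sided (not necessarily
closed) ideal of `B(H)`.  Then `(1 + (μDμ*)²)⁻¹ ∈ J ↔ (1 + D²)⁻¹ ∈ J`, where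
`(1+D²)⁻¹ = Q²`. -/
theorem stmt3 {H : Type*} [NormedAddCommGroup H] [InnerProductSpace ℂ H] [CompleteSpace H]
    (F Q : H →L[ℂ] H) (hQpos : Q.IsPositive) (hQinj : Function.Injective Q)
    (hF : IsSelfAdjoint F) (hFQ : F * Q = Q * F) (hpyth : F * F + Q * Q = 1)
    (μ ν : H →L[ℂ] H) (hμν : μ * ν = 1) (hνμ : ν * μ = 1)
    (R' : H →L[ℂ] H)
    (hR' : ∀ ξ : H, ∃ ξ₁ ξ₂ : H, adjoint μ (R' ξ) = Q ξ₁ ∧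
      adjoint μ (μ (F ξ₁)) = Q ξ₂ ∧ R' ξ + μ (F ξ₂) = ξ)
    (J : TwoSidedIdeal (H →L[ℂ] H)) :
    R' ∈ J ↔ Q * Q ∈ J := by
  have hμa : ∀ x, adjoint ν (adjoint μ x) = x := fun x => by
    have : star ν * star μ = 1 := by rw [← star_mul, hμν, star_one]
    exact congrArg (fun T : H →L[ℂ] H => T x) this
  have hν : ∀ x, ν (μ x) = x := fun x => congrArg (fun T : H →L[ℂ] H => T x) hνμ
  have hν' : ∀ x, μ (ν x) = x := fun x => congrArg (fun T : H →L[ℂ] H => T x) hμν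
  have hQs : star Q = Q := hQpos.isSelfAdjoint
  have hFsym : ∀ x y, inner ℂ (F x) y = inner ℂ x (F y) := fun x y => hF.isSymmetric x y
  have hQsym : ∀ x y, inner ℂ (Q x) y = inner ℂ x (Q y) := fun x y =>
    hQpos.isSelfAdjoint.isSymmetric x y
  have hFQ' : ∀ x, F (Q x) = Q (F x) := fun x => congrArg (fun T : H →L[ℂ] H => T x) hFQ
  -- the basic identity
  have key : ∀ ξ, ∃ ξ₁ : H, adjoint μ (R' ξ) = Q ξ₁ ∧
      inner ℂ (R' ξ) ξ = ((‖R' ξ‖ ^ 2 + ‖μ (F ξ₁)‖ ^ 2 : ℝ) : ℂ) ∧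
      Q (ν ξ) = Q (ν (R' ξ)) + F (adjoint μ (μ (F ξ₁))) := by
    intro ξ
    obtain ⟨ξ₁, ξ₂, h1, h2, h3⟩ := hR' ξ
    refine ⟨ξ₁, h1, ?_, ?_⟩
    · conv_lhs => rw [← h3]
      have e0 : inner ℂ (R' ξ) (μ (F ξ₂)) = inner ℂ (μ (F ξ₁)) (μ (F ξ₁)) := by
        rw [← adjoint_inner_left, h1, hQsym, ← hFQ', ← hFsym, ← h2, adjoint_inner_right]
      have e1 : inner ℂ (R' ξ) (R' ξ + μ (F ξ₂)) =
          inner ℂ (R' ξ) (R' ξ) + inner ℂ (μ (F ξ₁)) (μ (F ξ₁)) := by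
        rw [inner_add_right, e0]
      rw [h3] at e1 ⊢
      rw [e1, inner_self_eq_norm_sq_to_K, inner_self_eq_norm_sq_to_K]
      push_cast
      rfl
    · conv_lhs => rw [← h3]
      rw [map_add, map_add, hν, h2, hFQ']
  have hpos : R'.IsPositive := by
    rw [isPositive_iff_complex]
    intro ξ
    obtain ⟨ξ₁, -, h, -⟩ := key ξ
    rw [h]
    refine ⟨by rw [RCLike.re_to_complex, Complex.ofReal_re], ?_⟩
    simp only [RCLike.re_to_complex, Complex.ofReal_re]
    positivity
  have hnorm : ∀ x, ‖x‖ ^ 2 = ‖F x‖ ^ 2 + ‖Q x‖ ^ 2 := by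
    intro x
    have h0 : F (F x) + Q (Q x) = x := congrArg (fun T : H →L[ℂ] H => T x) hpyth
    have h1 : inner ℂ x x = inner ℂ (F x) (F x) + inner ℂ (Q x) (Q x) := by
      rw [hFsym, hQsym, ← inner_add_right, h0]
    rw [inner_self_eq_norm_sq_to_K, inner_self_eq_norm_sq_to_K, inner_self_eq_norm_sq_to_K] at h1
    exact_mod_cast h1
  -- upper bound
  have upper : ∀ ξ, (inner ℂ (R' ξ) ξ).re ≤ (‖ν‖ + ‖μ‖) ^ 2 * ‖(Q * ν) ξ‖ ^ 2 := by
    intro ξ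
    obtain ⟨ξ₁, h1, h2, -⟩ := key ξ
    have hp : (inner ℂ (R' ξ) ξ).re = ‖R' ξ‖ ^ 2 + ‖μ (F ξ₁)‖ ^ 2 := by
      rw [h2, Complex.ofReal_re]
    have a1 : (inner ℂ (R' ξ) ξ).re ≤ ‖ξ₁‖ * ‖(Q * ν) ξ‖ := by
      have : inner ℂ (R' ξ) ξ = inner ℂ ξ₁ (Q (ν ξ)) := by
        rw [← hQsym, ← h1, adjoint_inner_left, hν']
      rw [this]
      exact (Complex.re_le_norm _).trans (norm_inner_le_norm _ _)
    have a2 : ‖F ξ₁‖ ≤ ‖ν‖ * ‖μ (F ξ₁)‖ := by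
      have := ν.le_opNorm (μ (F ξ₁))
      rwa [hν] at this
    have a3 : ‖Q ξ₁‖ ≤ ‖μ‖ * ‖R' ξ‖ := by
      have := (adjoint μ).le_opNorm (R' ξ)
      rwa [h1, LinearIsometryEquiv.norm_map] at this
    have a4 : ‖ξ₁‖ ^ 2 ≤ (‖ν‖ + ‖μ‖) ^ 2 * (inner ℂ (R' ξ) ξ).re := by
      have b1 : ‖F ξ₁‖ ≤ (‖ν‖ + ‖μ‖) * ‖μ (F ξ₁)‖ := a2.trans (by gcongr; simp)
      have b2 : ‖Q ξ₁‖ ≤ (‖ν‖ + ‖μ‖) * ‖R' ξ‖ := a3.trans (by gcongr; simp)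
      have c1 := pow_le_pow_left₀ (norm_nonneg _) b1 2
      have c2 := pow_le_pow_left₀ (norm_nonneg _) b2 2
      rw [hp, hnorm ξ₁]
      nlinarith
    have p0 : 0 ≤ (inner ℂ (R' ξ) ξ).re := by rw [hp]; positivity
    generalize (inner ℂ (R' ξ) ξ).re = p at *
    rcases p0.eq_or_lt with h0 | h0
    · rw [← h0]; positivity
    · have c1 := pow_le_pow_left₀ p0 a1 2
      have c2 : p * p ≤ p * ((‖ν‖ + ‖μ‖) ^ 2 * ‖(Q * ν) ξ‖ ^ 2) := by
        have := mul_le_mul_of_nonneg_right a4 (sq_nonneg ‖(Q * ν) ξ‖)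
        nlinarith
      exact le_of_mul_le_mul_left c2 h0
  -- lower bound
  have lower : ∃ c : ℝ, ∀ ξ, ‖(Q * ν) ξ‖ ^ 2 ≤ c ^ 2 * (inner ℂ (R' ξ) ξ).re := by
    refine ⟨2 * (‖Q * ν‖ + ‖F * adjoint μ‖), fun ξ => ?_⟩
    obtain ⟨ξ₁, h1, h2, h3⟩ := key ξ
    rw [h2, Complex.ofReal_re]
    have b1 : ‖(Q * ν) (R' ξ)‖ ≤ (‖Q * ν‖ + ‖F * adjoint μ‖) * ‖R' ξ‖ :=
      ((Q * ν).le_opNorm _).trans (by gcongr; simp)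
    have b2 : ‖(F * adjoint μ) (μ (F ξ₁))‖ ≤ (‖Q * ν‖ + ‖F * adjoint μ‖) * ‖μ (F ξ₁)‖ :=
      ((F * adjoint μ).le_opNorm _).trans (by gcongr; simp)
    have b3 : ‖(Q * ν) ξ‖ ≤ (‖Q * ν‖ + ‖F * adjoint μ‖) * (‖R' ξ‖ + ‖μ (F ξ₁)‖) := by
      have h3' : (Q * ν) ξ = (Q * ν) (R' ξ) + (F * adjoint μ) (μ (F ξ₁)) := h3
      rw [h3', mul_add]
      exact (norm_add_le _ _).trans (add_le_add b1 b2)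
    have c1 := pow_le_pow_left₀ (norm_nonneg _) b3 2
    refine c1.trans ?_
    rw [mul_pow, mul_pow, mul_comm ((2 : ℝ) ^ 2), mul_assoc]
    gcongr
    nlinarith [sq_nonneg (‖R' ξ‖ - ‖μ (F ξ₁)‖), sq_nonneg ‖R' ξ‖, sq_nonneg ‖μ (F ξ₁)‖]
  have hstar : star (Q * ν) = star ν * Q := by rw [star_mul, hQs]
  constructor
  · intro hR
    obtain ⟨S, hs, hm, hn⟩ := exists_sqrt_op R' hpos
    obtain ⟨c, hc⟩ := lower
    have h1 : star (Q * ν) * (Q * ν) ∈ J := by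
      refine mem_of_le J _ S (isPositive_adjoint_comp_self (Q * ν)) c (fun x => ?_)
        (by rw [hs, hm]; exact hR)
      rw [inner_star_mul_self, hn]
      exact hc x
    have h2 : Q * Q = star μ * (star (Q * ν) * (Q * ν)) * μ := by
      have h3 : star μ * star ν = 1 := by rw [← star_mul, hνμ, star_one]
      rw [hstar]
      calc Q * Q = 1 * Q * Q * 1 := by simp
        _ = (star μ * star ν) * Q * Q * (ν * μ) := by rw [h3, hνμ]
        _ = _ := by simp only [mul_assoc]
    rw [h2]
    exact J.mul_mem_right _ _ (J.mul_mem_left _ _ h1)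
  · intro hQ
    refine mem_of_le J R' (Q * ν) hpos _ upper ?_
    have h1 : star (Q * ν) * star (star (Q * ν)) ∈ J := by
      rw [star_star, hstar]
      have : star ν * Q * (Q * ν) = star ν * (Q * Q) * ν := by simp only [mul_assoc]
      rw [this]
      exact J.mul_mem_right _ _ (J.mul_mem_left _ _ hQ)
    simpa only [star_star] using mem_swap J _ h1
end

section
/- Let A and B be positive self-adjoint operators on Hilbert spaces H₁ and H₂, and let T : H₂ → H₁ be bounded with T(dom B) ⊆ dom A. Suppose there exists M ≥ 0 such that ‖A T ξ‖ ≤ M ‖B ξ‖ for all ξ ∈ dom B. Then for every 0 < α ≤ 1, T(dom B^α) ⊆ dom A^α and ‖A^α T ξ‖ ≤ M^α ‖T‖^{1-α} ‖B^α ξ‖ for all ξ ∈ dom B^α. -/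
open Complex in
lemma aux_exp_norm {H : Type*} [NormedAddCommGroup H] [InnerProductSpace ℂ H] [CompleteSpace H]
    (L : H →L[ℂ] H) (hL : IsSelfAdjoint L) (y : ℝ) :
    ‖NormedSpace.exp ((I * (y:ℂ)) • L)‖ ≤ 1 := by
  have hy : IsSelfAdjoint ((y:ℂ) • L) := by
    apply IsSelfAdjoint.smul _ hL
    simp [IsSelfAdjoint]
  rcases subsingleton_or_nontrivial (H →L[ℂ] H) with hs | hs
  · rw [Subsingleton.elim (NormedSpace.exp ((I * (y:ℂ)) • L)) 0, norm_zero]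
    exact zero_le_one
  have h2 := CStarRing.norm_of_mem_unitary (E := H →L[ℂ] H)
    (selfAdjoint.expUnitary (⟨(y:ℂ) • L, hy⟩ : selfAdjoint (H →L[ℂ] H))).2
  rw [selfAdjoint.expUnitary_coe, smul_smul] at h2
  exact h2.le

lemma aux_exp_add {H : Type*} [NormedAddCommGroup H] [InnerProductSpace ℂ H] [CompleteSpace H]
    (L : H →L[ℂ] H) (z w : ℂ) :
    NormedSpace.exp ((z + w) • L) = NormedSpace.exp (z • L) * NormedSpace.exp (w • L) := by
  let _ : NormedAlgebra ℚ (H →L[ℂ] H) := NormedAlgebra.restrictScalars ℚ ℂ (H →L[ℂ] H)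
  rw [add_smul, NormedSpace.exp_add_of_commute]
  exact ((Commute.refl L).smul_left z).smul_right w

open Complex in
lemma aux_three {H₁ H₂ : Type*}
    [NormedAddCommGroup H₁] [InnerProductSpace ℂ H₁] [CompleteSpace H₁]
    [NormedAddCommGroup H₂] [InnerProductSpace ℂ H₂] [CompleteSpace H₂]
    (α : ℝ) (hα0 : 0 < α) (hα1 : α ≤ 1)
    (L : H₁ →L[ℂ] H₁) (N : H₂ →L[ℂ] H₂) (hL : IsSelfAdjoint L) (hN : IsSelfAdjoint N)
    (T : H₂ →L[ℂ] H₁) :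
    ‖NormedSpace.exp ((α:ℂ) • L) ∘L T ∘L NormedSpace.exp ((α:ℂ) • N)‖ ≤
      ‖T‖ ^ (1 - α) * ‖NormedSpace.exp L ∘L T ∘L NormedSpace.exp N‖ ^ α := by
  set F : ℂ → (H₂ →L[ℂ] H₁) := fun z =>
    NormedSpace.exp (z • L) ∘L T ∘L NormedSpace.exp (z • N) with hF
  have hd : Differentiable ℂ F := by
    intro z
    have h1 := (hasDerivAt_exp_smul_const (𝕂 := ℂ) L z).differentiableAt
    have h2 := (hasDerivAt_exp_smul_const (𝕂 := ℂ) N z).differentiableAt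
    exact h1.clm_comp ((differentiableAt_const T).clm_comp h2)
  have hre : ∀ z : ℂ, ‖F z‖ ≤ ‖F (z.re : ℂ)‖ := by
    intro z
    have e1 : F z = NormedSpace.exp ((I * (z.im:ℂ)) • L) ∘L F (z.re : ℂ) ∘L
        NormedSpace.exp ((I * (z.im:ℂ)) • N) := by
      have hz : z = I * (z.im:ℂ) + z.re := by
        rw [mul_comm, add_comm]; exact (re_add_im z).symm
      have hz' : z = z.re + I * (z.im:ℂ) := by
        rw [mul_comm]; exact (re_add_im z).symm
      have a1 := aux_exp_add L (I * (z.im:ℂ)) (z.re:ℂ)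
      have a2 := aux_exp_add N (z.re:ℂ) (I * (z.im:ℂ))
      rw [← hz] at a1
      rw [← hz'] at a2
      simp only [hF]
      rw [a1, a2]
      rfl
    rw [e1]
    refine (ContinuousLinearMap.opNorm_comp_le _ _).trans ?_
    refine (mul_le_of_le_one_left (norm_nonneg _) (aux_exp_norm L hL _)).trans ?_
    refine (ContinuousLinearMap.opNorm_comp_le _ _).trans ?_
    exact mul_le_of_le_one_right (norm_nonneg _) (aux_exp_norm N hN _)
  have hB : BddAbove ((norm ∘ F) '' HadamardThreeLines.verticalClosedStrip 0 1) := by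
    have hc : Continuous fun x : ℝ => ‖F (x:ℂ)‖ := (hd.continuous.comp continuous_ofReal).norm
    obtain ⟨C, hC⟩ := (isCompact_Icc (a := (0:ℝ)) (b := 1)).bddAbove_image hc.continuousOn
    refine ⟨C, ?_⟩
    rintro _ ⟨z, hz, rfl⟩
    exact (hre z).trans (hC ⟨z.re, hz, rfl⟩)
  have := HadamardThreeLines.norm_le_interp_of_mem_verticalClosedStrip₀₁' F (z := (α:ℂ))
    (a := ‖T‖) (b := ‖NormedSpace.exp L ∘L T ∘L NormedSpace.exp N‖)
    (by simp [HadamardThreeLines.verticalClosedStrip, hα0.le, hα1]) hd.diffContOnCl hB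
    (by
      intro z hz
      have hz : z.re = 0 := hz
      refine (hre z).trans ?_
      rw [hz]
      simp only [hF, ofReal_zero, zero_smul, NormedSpace.exp_zero]
      exact le_of_eq (by congr 1))
    (by
      intro z hz
      have hz : z.re = 1 := hz
      refine (hre z).trans ?_
      rw [hz]
      simp [hF])
  rw [ofReal_re] at this
  exact this

lemma aux_riesz {H : Type*} [NormedAddCommGroup H] [InnerProductSpace ℂ H] [CompleteSpace H]
    (G : H →L[ℂ] H) (hG : IsSelfAdjoint G) (v : H) (K : ℝ) (hK : 0 ≤ K)
    (h : ∀ w, ‖inner ℂ v w‖ ≤ K * ‖G w‖) : ∃ θ, ‖θ‖ ≤ K ∧ G θ = v := by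
  classical
  choose s hs using fun x : LinearMap.range (G : H →ₗ[ℂ] H) => x.2
  have key : ∀ w w', G w = G w' → inner ℂ v w = inner ℂ v w' := by
    intro w w' e
    have := h (w - w')
    rw [map_sub, e, sub_self, norm_zero, mul_zero, inner_sub_right] at this
    exact sub_eq_zero.1 (norm_le_zero_iff.1 this)
  have hs' : ∀ x, G (s x) = x := hs
  let f : LinearMap.range (G : H →ₗ[ℂ] H) →ₗ[ℂ] ℂ :=
    { toFun := fun x => inner ℂ v (s x)
      map_add' := fun x y => by
        rw [← inner_add_right]; apply key; simp [hs']
      map_smul' := fun c x => by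
        rw [RingHom.id_apply, smul_eq_mul, ← inner_smul_right]; apply key; simp [hs'] }
  let f' := f.mkContinuous K (fun x => by
    have := h (s x); rw [hs'] at this; exact this)
  have hf' : ‖f'‖ ≤ K := LinearMap.mkContinuous_norm_le _ hK _
  obtain ⟨g, hg, hn⟩ := exists_extension_norm_eq _ f'
  refine ⟨(InnerProductSpace.toDual ℂ H).symm g, ?_, ?_⟩
  · simpa [hn] using hf'
  · refine ext_inner_right ℂ fun w => ?_
    have : inner ℂ (G ((InnerProductSpace.toDual ℂ H).symm g)) w =
        inner ℂ ((InnerProductSpace.toDual ℂ H).symm g) (G w) := 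
      (ContinuousLinearMap.isSelfAdjoint_iff_isSymmetric.1 hG) _ _
    rw [this, InnerProductSpace.toDual_symm_apply]
    have := hg ⟨G w, w, rfl⟩
    rw [this]
    apply key
    exact hs' _

lemma aux_dense {H : Type*} [NormedAddCommGroup H] [InnerProductSpace ℂ H] [CompleteSpace H]
    (G : H →L[ℂ] H) (hG : IsSelfAdjoint G) (hi : Function.Injective G) : DenseRange G := by
  have h : (LinearMap.range (G : H →ₗ[ℂ] H))ᗮ = ⊥ := by
    rw [Submodule.eq_bot_iff]
    intro x hx
    apply hi
    rw [map_zero]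
    refine ext_inner_right ℂ fun w => ?_
    have := (ContinuousLinearMap.isSelfAdjoint_iff_isSymmetric.1 hG) x w
    refine this.trans ?_
    rw [inner_zero_left]
    exact (Submodule.mem_orthogonal' _ _).1 hx _ ⟨w, rfl⟩
  have := (Submodule.topologicalClosure_eq_top_iff).2 h
  rw [← Submodule.dense_iff_topologicalClosure_eq_top] at this
  exact this

lemma aux_exp_cfc {H : Type*} [NormedAddCommGroup H] [InnerProductSpace ℂ H] [CompleteSpace H]
    (a : H →L[ℂ] H) (ha : IsSelfAdjoint a) (f : ℝ → ℝ) (hf : ContinuousOn f (spectrum ℝ a))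
    (hpos : ∀ x ∈ spectrum ℝ a, 0 < f x) (α : ℝ) :
    NormedSpace.exp ((α:ℂ) • cfc (fun x => Real.log (f x)) a) = cfc (fun x => f x ^ α) a := by
  have hl : ContinuousOn (fun x => Real.log (f x)) (spectrum ℝ a) :=
    hf.log fun x hx => (hpos x hx).ne'
  have e : (α:ℂ) • cfc (fun x => Real.log (f x)) a = cfc (fun x => α * Real.log (f x)) a := by
    rw [cfc_const_mul α _ a hl]
    exact Complex.coe_smul α _
  rw [e, ← CFC.real_exp_eq_normedSpace_exp (cfc_predicate _ a),
    ← cfc_comp' Real.exp (fun x => α * Real.log (f x)) a (by fun_prop) (continuousOn_const.mul hl) ha]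
  refine cfc_congr fun x hx => ?_
  rw [Real.rpow_def_of_pos (hpos x hx), mul_comm]

lemma aux_interp_pos {H₁ H₂ : Type*}
    [NormedAddCommGroup H₁] [InnerProductSpace ℂ H₁] [CompleteSpace H₁]
    [NormedAddCommGroup H₂] [InnerProductSpace ℂ H₂] [CompleteSpace H₂]
    (α : ℝ) (hα0 : 0 < α) (hα1 : α ≤ 1)
    (a : H₁ →L[ℂ] H₁) (b : H₂ →L[ℂ] H₂) (ha : IsSelfAdjoint a) (hb : IsSelfAdjoint b)
    (T : H₂ →L[ℂ] H₁) (f r : ℝ → ℝ) (hf : ContinuousOn f (spectrum ℝ a))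
    (hr : ContinuousOn r (spectrum ℝ b)) (hf0 : ∀ x ∈ spectrum ℝ a, 0 < f x)
    (hr0 : ∀ x ∈ spectrum ℝ b, 0 < r x) :
    ‖cfc (fun x => f x ^ α) a ∘L T ∘L cfc (fun x => r x ^ α) b‖ ≤
      ‖T‖ ^ (1 - α) * ‖cfc f a ∘L T ∘L cfc r b‖ ^ α := by
  have h := aux_three α hα0 hα1 (cfc (fun x => Real.log (f x)) a)
    (cfc (fun x => Real.log (r x)) b) (cfc_predicate _ a) (cfc_predicate _ b) T
  have h1 := aux_exp_cfc a ha f hf hf0 1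
  have h2 := aux_exp_cfc b hb r hr hr0 1
  simp only [Complex.ofReal_one, one_smul, Real.rpow_one] at h1 h2
  rwa [aux_exp_cfc a ha f hf hf0, aux_exp_cfc b hb r hr hr0, h1, h2] at h

lemma aux_quot {H : Type*} [NormedAddCommGroup H] [InnerProductSpace ℂ H] [CompleteSpace H]
    (a : H →L[ℂ] H) (f g : ℝ → ℝ) (hf : ContinuousOn f (spectrum ℝ a))
    (hg : ContinuousOn g (spectrum ℝ a)) (hf0 : ∀ x ∈ spectrum ℝ a, 0 ≤ f x)
    (hfg : ∀ x ∈ spectrum ℝ a, f x ≤ g x) (hg0 : ∀ x ∈ spectrum ℝ a, 0 < g x) :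
    ∃ m : H →L[ℂ] H, ‖m‖ ≤ 1 ∧ cfc f a = m * cfc g a ∧ cfc f a = cfc g a * m := by
  have hc : ContinuousOn (fun x => f x / g x) (spectrum ℝ a) :=
    hf.div hg fun x hx => (hg0 x hx).ne'
  refine ⟨cfc (fun x => f x / g x) a, norm_cfc_le zero_le_one fun x hx => ?_, ?_, ?_⟩
  · rw [Real.norm_of_nonneg (div_nonneg (hf0 x hx) (hg0 x hx).le)]
    exact div_le_one_of_le₀ (hfg x hx) (hg0 x hx).le
  · rw [← cfc_mul _ _ a hc hg]
    exact cfc_congr fun x hx => (div_mul_cancel₀ _ (hg0 x hx).ne').symm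
  · rw [← cfc_mul _ _ a hg hc]
    exact cfc_congr fun x hx => (mul_div_cancel₀ _ (hg0 x hx).ne').symm

lemma aux_interp {H₁ H₂ : Type*}
    [NormedAddCommGroup H₁] [InnerProductSpace ℂ H₁] [CompleteSpace H₁]
    [NormedAddCommGroup H₂] [InnerProductSpace ℂ H₂] [CompleteSpace H₂]
    (α : ℝ) (hα0 : 0 < α) (hα1 : α ≤ 1)
    (a : H₁ →L[ℂ] H₁) (b : H₂ →L[ℂ] H₂) (ha : IsSelfAdjoint a) (hb : IsSelfAdjoint b)
    (T : H₂ →L[ℂ] H₁) (f r : ℝ → ℝ) (hf : ContinuousOn f (spectrum ℝ a))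
    (hr : ContinuousOn r (spectrum ℝ b)) (hf0 : ∀ x ∈ spectrum ℝ a, 0 ≤ f x)
    (hr0 : ∀ x ∈ spectrum ℝ b, 0 ≤ r x) :
    ‖cfc (fun x => f x ^ α) a ∘L T ∘L cfc (fun x => r x ^ α) b‖ ≤
      ‖T‖ ^ (1 - α) * ‖cfc f a ∘L T ∘L cfc r b‖ ^ α := by
  set φ : ℝ → ℝ := fun s => ‖T‖ ^ (1 - α) *
    ‖(algebraMap ℝ (H₁ →L[ℂ] H₁) s + cfc f a) ∘L T ∘L
      (algebraMap ℝ (H₂ →L[ℂ] H₂) s + cfc r b)‖ ^ α with hφ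
  have hφc : Continuous φ := by
    refine continuous_const.mul (Continuous.rpow_const ?_ fun _ => Or.inr hα0.le)
    have c1 : Continuous fun s : ℝ => algebraMap ℝ (H₁ →L[ℂ] H₁) s + cfc f a :=
      (continuous_algebraMap ℝ _).add continuous_const
    have c2 : Continuous fun s : ℝ => algebraMap ℝ (H₂ →L[ℂ] H₂) s + cfc r b :=
      (continuous_algebraMap ℝ _).add continuous_const
    exact (c1.clm_comp (continuous_const.clm_comp c2)).norm
  have h0 : φ 0 = ‖T‖ ^ (1 - α) * ‖cfc f a ∘L T ∘L cfc r b‖ ^ α := by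
    simp [hφ]
  rw [← h0]
  have ht : Filter.Tendsto φ (nhdsWithin 0 (Set.Ioi 0)) (nhds (φ 0)) :=
    (hφc.tendsto 0).mono_left nhdsWithin_le_nhds
  refine ge_of_tendsto ht ?_
  filter_upwards [self_mem_nhdsWithin] with s hs
  have hs : 0 < s := hs
  have hfs : ContinuousOn (fun x => s + f x) (spectrum ℝ a) := continuousOn_const.add hf
  have hrs : ContinuousOn (fun x => s + r x) (spectrum ℝ b) := continuousOn_const.add hr
  have h := aux_interp_pos α hα0 hα1 a b ha hb T (fun x => s + f x) (fun x => s + r x) hfs hrs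
    (fun x hx => by have := hf0 x hx; positivity) (fun x hx => by have := hr0 x hx; positivity)
  rw [cfc_const_add s f a hf ha, cfc_const_add s r b hr hb] at h
  refine le_trans ?_ h
  obtain ⟨m, hm, e, -⟩ := aux_quot a (fun x => f x ^ α) (fun x => (s + f x) ^ α)
    (hf.rpow_const fun _ _ => Or.inr hα0.le) (hfs.rpow_const fun _ _ => Or.inr hα0.le)
    (fun x hx => Real.rpow_nonneg (hf0 x hx) _)
    (fun x hx => Real.rpow_le_rpow (hf0 x hx) (by linarith) hα0.le)
    (fun x hx => Real.rpow_pos_of_pos (by have := hf0 x hx; positivity) _)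
  obtain ⟨n, hn, -, e'⟩ := aux_quot b (fun x => r x ^ α) (fun x => (s + r x) ^ α)
    (hr.rpow_const fun _ _ => Or.inr hα0.le) (hrs.rpow_const fun _ _ => Or.inr hα0.le)
    (fun x hx => Real.rpow_nonneg (hr0 x hx) _)
    (fun x hx => Real.rpow_le_rpow (hr0 x hx) (by linarith) hα0.le)
    (fun x hx => Real.rpow_pos_of_pos (by have := hr0 x hx; positivity) _)
  rw [e, e']
  change ‖m ∘L ((cfc (fun x => (s + f x) ^ α) a ∘L T ∘L cfc (fun x => (s + r x) ^ α) b) ∘L n)‖ ≤ _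
  refine (ContinuousLinearMap.opNorm_comp_le _ _).trans ?_
  refine (mul_le_of_le_one_left (norm_nonneg _) hm).trans ?_
  refine (ContinuousLinearMap.opNorm_comp_le _ _).trans ?_
  exact mul_le_of_le_one_right (norm_nonneg _) hn

lemma aux_spec {H : Type*} [NormedAddCommGroup H] [InnerProductSpace ℂ H] [CompleteSpace H]
    (Q : H →L[ℂ] H) (h0 : Q.IsPositive) (h1 : (1 - Q).IsPositive) :
    spectrum ℝ Q ⊆ Set.Icc 0 1 := by
  have hsa : IsSelfAdjoint Q := h0.isSelfAdjoint
  intro x hx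
  refine ⟨spectrum_nonneg_of_nonneg ((ContinuousLinearMap.nonneg_iff_isPositive Q).2 h0) hx, ?_⟩
  have h2 : Q ≤ 1 := sub_nonneg.1 ((ContinuousLinearMap.nonneg_iff_isPositive (1 - Q)).2 h1)
  have := (cfc_le_one_iff (id : ℝ → ℝ) Q (by fun_prop) hsa).1 (by rwa [cfc_id ℝ Q hsa])
  exact this x hx

lemma aux_mul {H : Type*} [NormedAddCommGroup H] [InnerProductSpace ℂ H] [CompleteSpace H]
    (Q : H →L[ℂ] H) (hQ : spectrum ℝ Q ⊆ Set.Icc 0 1) (f g h : ℝ → ℝ)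
    (hf : ContinuousOn f (Set.Icc 0 1)) (hg : ContinuousOn g (Set.Icc 0 1))
    (e : ∀ q ∈ Set.Icc (0:ℝ) 1, h q = f q * g q) (x : H) :
    cfc h Q x = cfc f Q (cfc g Q x) := by
  rw [cfc_congr (g := fun q => f q * g q) fun q hq => e q (hQ hq),
    cfc_mul f g Q (hf.mono hQ) (hg.mono hQ)]
  rfl

lemma aux_one_sub {H : Type*} [NormedAddCommGroup H] [InnerProductSpace ℂ H] [CompleteSpace H]
    (Q : H →L[ℂ] H) (hsa : IsSelfAdjoint Q) (hQ : spectrum ℝ Q ⊆ Set.Icc 0 1) (f : ℝ → ℝ)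
    (hf : ContinuousOn f (Set.Icc 0 1)) (x : H) :
    cfc (fun q => 1 - f q) Q x = x - cfc f Q x := by
  rw [cfc_sub (fun _ => (1:ℝ)) f Q continuousOn_const (hf.mono hQ), cfc_const_one ℝ Q hsa]
  rfl

lemma aux_bd {H : Type*} [NormedAddCommGroup H] [InnerProductSpace ℂ H] [CompleteSpace H]
    (Q : H →L[ℂ] H) (hQ : spectrum ℝ Q ⊆ Set.Icc 0 1) (f : ℝ → ℝ) (c : ℝ) (hc : 0 ≤ c)
    (e : ∀ q ∈ Set.Icc (0:ℝ) 1, |f q| ≤ c) (x : H) :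
    ‖cfc f Q x‖ ≤ c * ‖x‖ :=
  (cfc f Q).le_of_opNorm_le (norm_cfc_le hc fun q hq => e q (hQ hq)) x

lemma aux_D {α : ℝ} (hα0 : 0 < α) (hα1 : α ≤ 1) {q : ℝ} (hq : q ∈ Set.Icc (0:ℝ) 1) :
    1 ≤ q ^ α + (1 - q) ^ α := by
  have h1 := Real.rpow_le_rpow_of_exponent_ge_of_imp hq.1 hq.2 hα1 (fun _ h => by linarith)
  have h2 := Real.rpow_le_rpow_of_exponent_ge_of_imp (sub_nonneg.2 hq.2)
    (sub_le_self 1 hq.1) hα1 (fun _ h => by linarith)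
  rw [Real.rpow_one] at h1 h2
  linarith

lemma aux_g {α : ℝ} (hα0 : 0 < α) {q : ℝ} (hq : q ∈ Set.Icc (0:ℝ) 1) :
    (if q ≤ 0 then 0 else (1 + ((1 - q) / q) ^ α)⁻¹) = q ^ α / (q ^ α + (1 - q) ^ α) := by
  obtain ⟨h0, h1⟩ := hq
  split_ifs with h
  · have : q = 0 := le_antisymm h h0
    rw [this, Real.zero_rpow hα0.ne', zero_div]
  · push Not at h
    have hp : 0 < q ^ α := Real.rpow_pos_of_pos h _
    have h2 : 0 ≤ (1 - q) ^ α := Real.rpow_nonneg (by linarith) _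
    rw [Real.div_rpow (by linarith) h0]
    field_simp

lemma aux_den {ε q : ℝ} (hε : 0 < ε) (hq : q ∈ Set.Icc (0:ℝ) 1) : 0 < q + ε * (1 - q) := by
  obtain ⟨h0, h1⟩ := hq
  rcases h0.eq_or_lt with h | h
  · rw [← h]; linarith
  · have : 0 ≤ ε * (1 - q) := mul_nonneg hε.le (by linarith)
    linarith

lemma aux_den' {ε q : ℝ} (hε : 0 < ε) (hq : q ∈ Set.Icc (0:ℝ) 1) : 0 < (1 - q) + ε * q := by
  have := aux_den hε (q := 1 - q) ⟨by linarith [hq.2], by linarith [hq.1]⟩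
  simpa using this

lemma aux_kdiff {α : ℝ} (hα0 : 0 < α) (hα1 : α ≤ 1) {δ q : ℝ} (hδ : 0 < δ)
    (hq : q ∈ Set.Icc (0:ℝ) 1) :
    |((1 - q) + δ * q) ^ α / (q ^ α + (1 - q) ^ α)
      - (1 - q ^ α / (q ^ α + (1 - q) ^ α))| ≤ δ ^ α := by
  have hD := aux_D hα0 hα1 hq
  obtain ⟨h0, h1⟩ := hq
  have h1' : 0 ≤ 1 - q := by linarith
  have hDp : 0 < q ^ α + (1 - q) ^ α := by linarith
  have e : ((1 - q) + δ * q) ^ α / (q ^ α + (1 - q) ^ α)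
      - (1 - q ^ α / (q ^ α + (1 - q) ^ α)) =
      (((1 - q) + δ * q) ^ α - (1 - q) ^ α) / (q ^ α + (1 - q) ^ α) := by
    field_simp; ring
  have hδq : 0 ≤ δ * q := by positivity
  have m : (1 - q) ^ α ≤ ((1 - q) + δ * q) ^ α :=
    Real.rpow_le_rpow h1' (by linarith) hα0.le
  have sub : ((1 - q) + δ * q) ^ α ≤ (1 - q) ^ α + (δ * q) ^ α :=
    Real.rpow_add_le_add_rpow h1' hδq hα0.le hα1
  have b : (δ * q) ^ α ≤ δ ^ α :=
    Real.rpow_le_rpow hδq (mul_le_of_le_one_right hδ.le h1) hα0.le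
  rw [e, abs_of_nonneg (div_nonneg (by linarith) hDp.le)]
  refine (div_le_self (by linarith) hD).trans (by linarith)

lemma aux_hdiff {α : ℝ} (hα0 : 0 < α) (hα1 : α ≤ 1) {ε q : ℝ} (hε : 0 < ε)
    (hq : q ∈ Set.Icc (0:ℝ) 1) :
    |q * (1 - q ^ α / (q ^ α + (1 - q) ^ α)) -
      q * (q ^ α / (q ^ α + (1 - q) ^ α)) * ((1 - q) / (q + ε * (1 - q))) ^ α| ≤ ε := by
  have hD := aux_D hα0 hα1 hq
  have hd := aux_den hε hq
  obtain ⟨h0, h1⟩ := hq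
  have h1' : 0 ≤ 1 - q := by linarith
  have hDp : 0 < q ^ α + (1 - q) ^ α := by linarith
  have hqa : 0 ≤ q ^ α := Real.rpow_nonneg h0 _
  have hqb : 0 ≤ (1 - q) ^ α := Real.rpow_nonneg h1' _
  set r := q / (q + ε * (1 - q)) with hr
  have hεq : 0 ≤ ε * (1 - q) := by positivity
  have hr0 : 0 ≤ r := by positivity
  have hr1 : r ≤ 1 := div_le_one_of_le₀ (by linarith) hd.le
  have hra : r ≤ r ^ α := by
    have := Real.rpow_le_rpow_of_exponent_ge_of_imp hr0 hr1 hα1 (fun _ h => by linarith)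
    rwa [Real.rpow_one] at this
  have hra1 : r ^ α ≤ 1 := Real.rpow_le_one hr0 hr1 hα0.le
  have e : q * (1 - q ^ α / (q ^ α + (1 - q) ^ α)) -
      q * (q ^ α / (q ^ α + (1 - q) ^ α)) * ((1 - q) / (q + ε * (1 - q))) ^ α
      = ((1 - q) ^ α / (q ^ α + (1 - q) ^ α)) * (q * (1 - r ^ α)) := by
    have hda : 0 < (q + ε * (1 - q)) ^ α := Real.rpow_pos_of_pos hd _
    rw [hr, Real.div_rpow h1' hd.le, Real.div_rpow h0 hd.le]
    field_simp
    ring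
  have hx : (1 - q) ^ α / (q ^ α + (1 - q) ^ α) ≤ 1 := div_le_one_of_le₀ (by linarith) hDp.le
  have hx0 : 0 ≤ (1 - q) ^ α / (q ^ α + (1 - q) ^ α) := by positivity
  have hy0 : 0 ≤ q * (1 - r ^ α) := mul_nonneg h0 (by linarith)
  have hy : q * (1 - r ^ α) ≤ ε := by
    have h3 : q * (1 - r ^ α) ≤ q * (1 - r) := mul_le_mul_of_nonneg_left (by linarith) h0
    have h4 : q * (1 - r) = r * (ε * (1 - q)) := by
      rw [hr]; field_simp; ring
    have h5 : r * (ε * (1 - q)) ≤ 1 * (ε * 1) := by gcongr; linarith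
    linarith
  rw [e, abs_of_nonneg (mul_nonneg hx0 hy0)]
  exact (mul_le_of_le_one_left hy0 hx).trans hy

/-- **Fractional powers and relative bounds.**  Let `A` and `B` be positive self-adjoint
operators on Hilbert spaces `H₁` and `H₂`, encoded by the bounded operators
`QA = (1+A)⁻¹` and `QB = (1+B)⁻¹`, which are positive injective contractions; thus
`dom A = ran QA` and `A (QA ξ) = ξ - QA ξ`, and likewise for `B`.  For `0 < α ≤ 1` the
fractional power `A^α` is encoded by `(1+A^α)⁻¹ = g_α(QA)` (continuous functional calculus),
where `g_α(q) = (1 + ((1-q)/q)^α)⁻¹` for `q ∈ (0,1]` and `g_α(q) = 0` for `q ≤ 0`, so that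
`dom A^α = ran g_α(QA)` and `A^α (g_α(QA) η) = η - g_α(QA) η`.  Suppose `T : H₂ → H₁` is
bounded with `T (dom B) ⊆ dom A` and `‖A T ξ‖ ≤ M ‖B ξ‖` for all `ξ ∈ dom B`.  Then
`T (dom B^α) ⊆ dom A^α` and `‖A^α T ξ‖ ≤ M^α ‖T‖^{1-α} ‖B^α ξ‖` for all `ξ ∈ dom B^α`. -/
theorem stmt6 {H₁ H₂ : Type*}
    [NormedAddCommGroup H₁] [InnerProductSpace ℂ H₁] [CompleteSpace H₁]
    [NormedAddCommGroup H₂] [InnerProductSpace ℂ H₂] [CompleteSpace H₂]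
    (α : ℝ) (hα0 : 0 < α) (hα1 : α ≤ 1)
    (QA : H₁ →L[ℂ] H₁) (QB : H₂ →L[ℂ] H₂)
    (hQApos : QA.IsPositive) (hQAinj : Function.Injective QA)
    (hQAcontr : (1 - QA).IsPositive)
    (hQBpos : QB.IsPositive) (hQBinj : Function.Injective QB)
    (hQBcontr : (1 - QB).IsPositive)
    (T : H₂ →L[ℂ] H₁) (M : ℝ) (hM : 0 ≤ M)
    (hTdom : ∀ ξ : H₂, ∃ η : H₁, T (QB ξ) = QA η)
    (hbound : ∀ (ξ : H₂) (η : H₁), T (QB ξ) = QA η → ‖η - QA η‖ ≤ M * ‖ξ - QB ξ‖) :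
    ∀ ξ : H₂, ∃ η : H₁,
      T (cfc (fun q : ℝ => if q ≤ 0 then 0 else (1 + ((1 - q) / q) ^ α)⁻¹) QB ξ) =
        cfc (fun q : ℝ => if q ≤ 0 then 0 else (1 + ((1 - q) / q) ^ α)⁻¹) QA η ∧
      ‖η - cfc (fun q : ℝ => if q ≤ 0 then 0 else (1 + ((1 - q) / q) ^ α)⁻¹) QA η‖ ≤
        M ^ α * ‖T‖ ^ (1 - α) *
          ‖ξ - cfc (fun q : ℝ => if q ≤ 0 then 0 else (1 + ((1 - q) / q) ^ α)⁻¹) QB ξ‖ := by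
  have hspA := aux_spec QA hQApos hQAcontr
  have hspB := aux_spec QB hQBpos hQBcontr
  have hsaA : IsSelfAdjoint QA := hQApos.isSelfAdjoint
  have hsaB : IsSelfAdjoint QB := hQBpos.isSelfAdjoint
  rw [cfc_congr (a := QA) (g := fun q : ℝ => q ^ α / (q ^ α + (1 - q) ^ α))
      (fun q hq => aux_g hα0 (hspA hq)),
    cfc_congr (a := QB) (g := fun q : ℝ => q ^ α / (q ^ α + (1 - q) ^ α))
      (fun q hq => aux_g hα0 (hspB hq))]
  have hDne : ∀ q ∈ Set.Icc (0:ℝ) 1, q ^ α + (1 - q) ^ α ≠ 0 := fun q hq => by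
    have := aux_D hα0 hα1 hq
    linarith
  have cD : ContinuousOn (fun q : ℝ => q ^ α + (1 - q) ^ α) (Set.Icc 0 1) :=
    (continuousOn_id.rpow_const fun _ _ => Or.inr hα0.le).add
      ((continuousOn_const.sub continuousOn_id).rpow_const fun _ _ => Or.inr hα0.le)
  set g : ℝ → ℝ := fun q : ℝ => q ^ α / (q ^ α + (1 - q) ^ α) with hg
  have cg : ContinuousOn g (Set.Icc 0 1) :=
    (continuousOn_id.rpow_const fun _ _ => Or.inr hα0.le).div cD hDne
  have cid : ContinuousOn (fun q : ℝ => q) (Set.Icc 0 1) := continuousOn_id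
  set h : ℝ → ℝ → ℝ := fun ε q => (1 - q) / (q + ε * (1 - q)) with hh
  set r : ℝ → ℝ → ℝ := fun δ q => q / ((1 - q) + δ * q) with hr
  set k : ℝ → ℝ → ℝ := fun δ q => ((1 - q) + δ * q) ^ α / (q ^ α + (1 - q) ^ α) with hk
  have ch : ∀ ε, 0 < ε → ContinuousOn (h ε) (Set.Icc 0 1) := fun ε hε =>
    ContinuousOn.div (by fun_prop) (by fun_prop) fun q hq => (aux_den hε hq).ne'
  have cr : ∀ δ, 0 < δ → ContinuousOn (r δ) (Set.Icc 0 1) := fun δ hδ =>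
    ContinuousOn.div (by fun_prop) (by fun_prop) fun q hq => (aux_den' hδ hq).ne'
  have cha : ∀ ε, 0 < ε → ContinuousOn (fun q => h ε q ^ α) (Set.Icc 0 1) := fun ε hε =>
    (ch ε hε).rpow_const fun _ _ => Or.inr hα0.le
  have cra : ∀ ε, 0 < ε → ContinuousOn (fun q => r ε q ^ α) (Set.Icc 0 1) := fun ε hε =>
    (cr ε hε).rpow_const fun _ _ => Or.inr hα0.le
  have ck : ∀ δ, ContinuousOn (k δ) (Set.Icc 0 1) := fun δ =>
    ContinuousOn.div (ContinuousOn.rpow_const (by fun_prop) fun _ _ => Or.inr hα0.le) cD hDne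
  have idA : cfc (fun q : ℝ => q) QA = QA := cfc_id' ℝ QA hsaA
  have idB : cfc (fun q : ℝ => q) QB = QB := cfc_id' ℝ QB hsaB
  have stepA : ∀ ε δ, 0 < ε → 0 < δ → ‖cfc (h ε) QA ∘L T ∘L cfc (r δ) QB‖ ≤ M := by
    intro ε δ hε hδ
    refine ContinuousLinearMap.opNorm_le_bound _ hM fun x => ?_
    have cinv : ContinuousOn (fun q : ℝ => ((1 - q) + δ * q)⁻¹) (Set.Icc 0 1) :=
      ContinuousOn.inv₀ (by fun_prop) fun q hq => (aux_den' hδ hq).ne'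
    have cinv' : ContinuousOn (fun q : ℝ => q / (q + ε * (1 - q))) (Set.Icc 0 1) :=
      ContinuousOn.div (by fun_prop) (by fun_prop) fun q hq => (aux_den hε hq).ne'
    set ξ := cfc (fun q : ℝ => ((1 - q) + δ * q)⁻¹) QB x with hξ
    have e1 : cfc (r δ) QB x = QB ξ := by
      rw [aux_mul QB hspB (fun q => q) _ (r δ) cid cinv (fun q _ => div_eq_mul_inv _ _), idB]
    obtain ⟨η, hη⟩ := hTdom ξ
    have hb := hbound ξ η hη
    have e2 : cfc (h ε) QA (QA η) = cfc (fun q : ℝ => q / (q + ε * (1 - q))) QA (η - QA η) := by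
      have a1 := aux_mul QA hspA (h ε) (fun q => q) (fun q => h ε q * q) (ch ε hε) cid
        (fun q _ => rfl) η
      have a2 := aux_mul QA hspA (fun q : ℝ => q / (q + ε * (1 - q))) (fun q => 1 - q)
        (fun q => h ε q * q) cinv' (by fun_prop) (fun q _ => by simp only [hh]; ring) η
      rw [aux_one_sub QA hsaA hspA _ cid, idA] at a2
      rw [idA] at a1
      rw [← a1, a2]
    have e3 : ξ - QB ξ = cfc (fun q : ℝ => (1 - q) * ((1 - q) + δ * q)⁻¹) QB x := by
      rw [aux_mul QB hspB (fun q => 1 - q) _ _ (by fun_prop) cinv (fun q _ => rfl),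
        aux_one_sub QB hsaB hspB _ cid, idB]
    have e4 : ‖ξ - QB ξ‖ ≤ 1 * ‖x‖ := by
      rw [e3]
      refine aux_bd QB hspB _ 1 zero_le_one (fun q hq => ?_) x
      have hd := aux_den' hδ hq
      have h1' : 0 ≤ 1 - q := by linarith [hq.2]
      have : 0 ≤ δ * q := mul_nonneg hδ.le hq.1
      rw [← div_eq_mul_inv, abs_of_nonneg (div_nonneg h1' hd.le)]
      exact div_le_one_of_le₀ (by linarith) hd.le
    change ‖cfc (h ε) QA (T (cfc (r δ) QB x))‖ ≤ _
    rw [e1, hη, e2]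
    have e5 := aux_bd QA hspA (fun q : ℝ => q / (q + ε * (1 - q))) 1 zero_le_one (fun q hq => by
      have hd := aux_den hε hq
      have h1' : 0 ≤ 1 - q := by linarith [hq.2]
      have : 0 ≤ ε * (1 - q) := mul_nonneg hε.le h1'
      rw [abs_of_nonneg (div_nonneg hq.1 hd.le)]
      exact div_le_one_of_le₀ (by linarith) hd.le) (η - QA η)
    have e6 : M * ‖ξ - QB ξ‖ ≤ M * ‖x‖ := mul_le_mul_of_nonneg_left (by linarith) hM
    linarith
  set C := M ^ α * ‖T‖ ^ (1 - α) with hC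
  have hC0 : 0 ≤ C := by positivity
  have stepB : ∀ ε δ, 0 < ε → 0 < δ →
      ‖cfc (fun q => h ε q ^ α) QA ∘L T ∘L cfc (fun q => r δ q ^ α) QB‖ ≤ C := by
    intro ε δ hε hδ
    have := aux_interp α hα0 hα1 QA QB hsaA hsaB T (h ε) (r δ) ((ch ε hε).mono hspA)
      ((cr δ hδ).mono hspB)
      (fun q hq => div_nonneg (by linarith [(hspA hq).2]) (aux_den hε (hspA hq)).le)
      (fun q hq => div_nonneg (hspB hq).1 (aux_den' hδ (hspB hq)).le)
    refine this.trans ?_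
    rw [hC, mul_comm]
    have := stepA ε δ hε hδ
    gcongr
  intro ξ
  set u := T (cfc g QB ξ) with hu
  set K := C * ‖ξ - cfc g QB ξ‖ with hK
  have hK0 : 0 ≤ K := by positivity
  have stepD : ∀ ε, 0 < ε → ‖cfc (fun q => h ε q ^ α) QA u‖ ≤ K := by
    intro ε hε
    have hb : ∀ δ, 0 < δ → ‖cfc (fun q => h ε q ^ α) QA u‖ ≤
        C * (‖ξ - cfc g QB ξ‖ + δ ^ α * ‖ξ‖) := by
      intro δ hδ
      have e1 : cfc g QB ξ = cfc (fun q => r δ q ^ α) QB (cfc (k δ) QB ξ) := by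
        refine aux_mul QB hspB _ _ _ (cra δ hδ) (ck δ) (fun q hq => ?_) ξ
        have hd := aux_den' hδ hq
        have hda : 0 < ((1 - q) + δ * q) ^ α := Real.rpow_pos_of_pos hd _
        simp only [hg, hr, hk]
        rw [Real.div_rpow hq.1 hd.le, div_mul_div_cancel₀ hda.ne']
      have e2 : ‖cfc (fun q => h ε q ^ α) QA u‖ ≤ C * ‖cfc (k δ) QB ξ‖ := by
        rw [hu, e1]
        exact ContinuousLinearMap.le_of_opNorm_le _ (stepB ε δ hε hδ) (cfc (k δ) QB ξ)
      have e3 : ‖cfc (k δ) QB ξ - (ξ - cfc g QB ξ)‖ ≤ δ ^ α * ‖ξ‖ := by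
        have cg1 : ContinuousOn (fun q => 1 - g q) (Set.Icc 0 1) := continuousOn_const.sub cg
        have a := aux_bd QB hspB (fun q => k δ q - (1 - g q)) (δ ^ α) (by positivity)
          (fun q hq => aux_kdiff hα0 hα1 hδ hq) ξ
        rw [cfc_sub (k δ) (fun q => 1 - g q) QB ((ck δ).mono hspB) (cg1.mono hspB)] at a
        rw [← aux_one_sub QB hsaB hspB g cg]
        exact a
      have e4 : ‖cfc (k δ) QB ξ‖ ≤ ‖ξ - cfc g QB ξ‖ + δ ^ α * ‖ξ‖ := by
        have := norm_le_norm_add_norm_sub' (cfc (k δ) QB ξ) (ξ - cfc g QB ξ)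
        linarith
      exact e2.trans (mul_le_mul_of_nonneg_left e4 hC0)
    have hcont : Continuous fun δ : ℝ => C * (‖ξ - cfc g QB ξ‖ + δ ^ α * ‖ξ‖) :=
      continuous_const.mul (continuous_const.add
        ((continuous_id.rpow_const fun _ => Or.inr hα0.le).mul continuous_const))
    have ht := (hcont.tendsto 0).mono_left (nhdsWithin_le_nhds (s := Set.Ioi 0))
    rw [Real.zero_rpow hα0.ne', zero_mul, add_zero] at ht
    refine ge_of_tendsto ht ?_
    filter_upwards [self_mem_nhdsWithin] with δ hδ
    exact hb δ hδ
  set G := cfc g QA with hG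
  have hGsa : IsSelfAdjoint G := cfc_predicate g QA
  have symm : ∀ f : ℝ → ℝ, ∀ x y, inner ℂ (cfc f QA x) y = inner ℂ x (cfc f QA y) :=
    fun f x y => (ContinuousLinearMap.isSelfAdjoint_iff_isSymmetric.1
      (cfc_predicate f QA : IsSelfAdjoint (cfc f QA))) x y
  have stepE : ∀ z, ‖inner ℂ (u - G u) (QA z)‖ ≤ K * ‖G (QA z)‖ := by
    intro z
    have hb : ∀ ε, 0 < ε → ‖inner ℂ (u - G u) (QA z)‖ ≤ K * ‖G (QA z)‖ + ε * ‖u‖ * ‖z‖ := by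
      intro ε hε
      have cg1 : ContinuousOn (fun q => 1 - g q) (Set.Icc 0 1) := continuousOn_const.sub cg
      have i1 : inner ℂ (u - G u) (QA z) = inner ℂ (cfc (fun q => q * (1 - g q)) QA u) z := by
        rw [aux_mul QA hspA (fun q => q) (fun q => 1 - g q) _ cid cg1 (fun q _ => rfl),
          symm, aux_one_sub QA hsaA hspA g cg, idA]
      have i2 : inner ℂ (cfc (fun q => h ε q ^ α) QA u) (G (QA z)) =
          inner ℂ (cfc (fun q => q * g q * h ε q ^ α) QA u) z := by
        rw [aux_mul QA hspA (fun q => q * g q) (fun q => h ε q ^ α) _ (cid.mul cg) (cha ε hε)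
          (fun q _ => rfl), aux_mul QA hspA (fun q => q) g _ cid cg (fun q _ => rfl),
          symm (fun q => q) _ z, symm g, idA]
      have b1 : ‖inner ℂ (cfc (fun q => h ε q ^ α) QA u) (G (QA z))‖ ≤ K * ‖G (QA z)‖ :=
        (norm_inner_le_norm _ _).trans
          (mul_le_mul_of_nonneg_right (stepD ε hε) (norm_nonneg _))
      have b2 := aux_bd QA hspA (fun q => q * (1 - g q) - q * g q * h ε q ^ α) ε hε.le
        (fun q hq => aux_hdiff hα0 hα1 hε hq) u
      rw [cfc_sub (fun q => q * (1 - g q)) (fun q => q * g q * h ε q ^ α) QA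
        ((cid.mul cg1).mono hspA) (((cid.mul cg).mul (cha ε hε)).mono hspA)] at b2
      have b3 : ‖inner ℂ (u - G u) (QA z) - inner ℂ (cfc (fun q => h ε q ^ α) QA u) (G (QA z))‖
          ≤ ε * ‖u‖ * ‖z‖ := by
        rw [i1, i2, ← inner_sub_left]
        exact (norm_inner_le_norm _ _).trans
          (mul_le_mul_of_nonneg_right b2 (norm_nonneg _))
      have := norm_le_norm_add_norm_sub' (inner ℂ (u - G u) (QA z))
        (inner ℂ (cfc (fun q => h ε q ^ α) QA u) (G (QA z)))
      linarith
    have hcont : Continuous fun ε : ℝ => K * ‖G (QA z)‖ + ε * ‖u‖ * ‖z‖ := by fun_prop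
    have ht := (hcont.tendsto 0).mono_left (nhdsWithin_le_nhds (s := Set.Ioi 0))
    rw [zero_mul, zero_mul, add_zero] at ht
    refine ge_of_tendsto ht ?_
    filter_upwards [self_mem_nhdsWithin] with δ hδ
    exact hb δ hδ
  have stepF : ∀ w, ‖inner ℂ (u - G u) w‖ ≤ K * ‖G w‖ := by
    have hdense := aux_dense QA hsaA hQAinj
    refine fun w => hdense.induction_on (p := fun w => ‖inner ℂ (u - G u) w‖ ≤ K * ‖G w‖) w
      (isClosed_le ?_ ?_) stepE
    · exact (continuous_const.inner continuous_id).norm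
    · exact continuous_const.mul G.continuous.norm
  obtain ⟨θ, hθ, e⟩ := aux_riesz G hGsa (u - G u) K hK0 stepF
  have e' : G (u + θ) = u := by rw [map_add, e]; abel
  refine ⟨u + θ, e'.symm, ?_⟩
  rw [e', add_sub_cancel_left]
  exact hθ
end

section
/- Let A and B be positive invertible self-adjoint operators on Hilbert spaces H₁, H₂ (with bounded inverses) and T : H₂ → H₁ bounded with T(dom B) ⊆ dom A. Then for 0 ≤ α ≤ 1, the everywhere-defined operator A^α T B^{-α} is bounded with ‖A^α T B^{-α}‖ ≤ ‖A T B^{-1}‖^α ‖T‖^{1-α}. -/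
section helpers
variable {H H' : Type*}
    [NormedAddCommGroup H] [InnerProductSpace ℂ H] [CompleteSpace H]
    [NormedAddCommGroup H'] [InnerProductSpace ℂ H'] [CompleteSpace H']

lemma aux_unitary_norm (K : H →L[ℂ] H) (hK : IsSelfAdjoint K) (y : ℝ) :
    ‖NormedSpace.exp (((y : ℂ) * Complex.I) • K)‖ ≤ 1 := by
  have hyK : IsSelfAdjoint ((y : ℂ) • K) := by
    apply IsSelfAdjoint.smul _ hK
    simp [IsSelfAdjoint]
  have h := (selfAdjoint.expUnitary (⟨(y : ℂ) • K, hyK⟩ : selfAdjoint (H →L[ℂ] H))).2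
  rw [selfAdjoint.expUnitary_coe] at h
  simp only [smul_smul, mul_comm Complex.I] at h
  have h1 := CStarRing.norm_star_mul_self (x := NormedSpace.exp (((y : ℂ) * Complex.I) • K))
  rw [(Unitary.mem_iff.1 h).1] at h1
  have h2 : ‖(1 : H →L[ℂ] H)‖ ≤ 1 := ContinuousLinearMap.norm_id_le
  nlinarith [norm_nonneg (NormedSpace.exp (((y : ℂ) * Complex.I) • K))]

lemma aux_exp_split (K : H →L[ℂ] H) (z w : ℂ) :
    NormedSpace.exp ((z + w) • K) = NormedSpace.exp (z • K) * NormedSpace.exp (w • K) := by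
  let +nondep : NormedAlgebra ℚ (H →L[ℂ] H) := .restrictScalars ℚ ℂ _
  rw [add_smul]
  exact NormedSpace.exp_add_of_commute ((Commute.refl K).smul_left z |>.smul_right w)

lemma aux_diff (K : H →L[ℂ] H) : Differentiable ℂ (fun z : ℂ => NormedSpace.exp (z • K)) :=
  fun z => (hasDerivAt_exp_smul_const K z).differentiableAt

lemma aux_core (K : H →L[ℂ] H) (L : H' →L[ℂ] H') (hK : IsSelfAdjoint K) (hL : IsSelfAdjoint L)
    (T : H →L[ℂ] H') (α : ℝ) (h0 : 0 ≤ α) (h1 : α ≤ 1) :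
    ‖(NormedSpace.exp ((-α : ℂ) • L)).comp (T.comp (NormedSpace.exp ((α : ℂ) • K)))‖ ≤
      ‖(NormedSpace.exp ((-1 : ℂ) • L)).comp (T.comp (NormedSpace.exp ((1 : ℂ) • K)))‖ ^ α
        * ‖T‖ ^ (1 - α) := by
  let f : ℂ → (H →L[ℂ] H') := fun z =>
    (NormedSpace.exp ((-z) • L)).comp (T.comp (NormedSpace.exp (z • K)))
  have hd : Differentiable ℂ f := by
    have e1 : Differentiable ℂ (fun z : ℂ => NormedSpace.exp ((-z) • L)) :=
      (aux_diff L).comp differentiable_neg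
    exact e1.clm_comp ((differentiable_const T).clm_comp (aux_diff K))
  have hre : ∀ z, ‖f z‖ ≤ ‖f (z.re : ℂ)‖ := by
    intro z
    have e : f z = (NormedSpace.exp ((((-z.im : ℝ) : ℂ) * Complex.I) • L)).comp
        ((f (z.re : ℂ)).comp (NormedSpace.exp (((z.im : ℂ) * Complex.I) • K))) := by
      have a1 : -z = (((-z.im : ℝ) : ℂ) * Complex.I) + (-(z.re : ℂ)) := by
        conv_lhs => rw [← Complex.re_add_im z]
        push_cast; ring
      have a2 : z = (z.re : ℂ) + (z.im : ℂ) * Complex.I := (Complex.re_add_im z).symm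
      have b1 := aux_exp_split L (((-z.im : ℝ) : ℂ) * Complex.I) (-(z.re : ℂ))
      have b2 := aux_exp_split K (z.re : ℂ) ((z.im : ℂ) * Complex.I)
      rw [← a1] at b1
      rw [← a2] at b2
      simp only [f]
      rw [b1, b2]
      rfl
    rw [e]
    refine (ContinuousLinearMap.opNorm_comp_le _ _).trans ?_
    refine (mul_le_of_le_one_left (norm_nonneg _) (aux_unitary_norm L hL _)).trans ?_
    refine (ContinuousLinearMap.opNorm_comp_le _ _).trans ?_
    exact mul_le_of_le_one_right (norm_nonneg _) (aux_unitary_norm K hK _)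
  have hf0 : f 0 = T := by
    simp only [f, neg_zero, zero_smul, NormedSpace.exp_zero]
    rfl
  have := Complex.HadamardThreeLines.norm_le_interp_of_mem_verticalClosedStrip' (f := f)
    (z := (α : ℂ)) (a := ‖T‖) (b := ‖f 1‖) (l := 0) (u := 1) one_pos
    (by simp [Complex.HadamardThreeLines.verticalClosedStrip, h0, h1])
    hd.diffContOnCl ?_ ?_ ?_
  · simp only [Complex.ofReal_re, sub_zero, div_one] at this
    rw [mul_comm]
    exact this
  · have hc : Continuous (fun x : ℝ => ‖f (x : ℂ)‖) :=
      (hd.continuous.comp Complex.continuous_ofReal).norm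
    obtain ⟨C, hC⟩ := (isCompact_Icc (a := (0 : ℝ)) (b := 1)).bddAbove_image hc.continuousOn
    refine ⟨C, ?_⟩
    rintro _ ⟨z, hz, rfl⟩
    exact (hre z).trans (hC ⟨z.re, hz, rfl⟩)
  · intro z hz
    have hz : z.re = 0 := hz
    simpa [hz, hf0] using hre z
  · intro z hz
    have hz : z.re = 1 := hz
    simpa [hz] using hre z

lemma aux_spec_s7 {a : H →L[ℂ] H} (ha : a.IsPositive) {t : ℝ} (ht : t ∈ spectrum ℝ a) : 0 ≤ t :=
  spectrum_nonneg_of_nonneg ((ContinuousLinearMap.nonneg_iff_isPositive a).2 ha) ht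

lemma aux_cont {a : H →L[ℂ] H} (ha : a.IsPositive) {ε : ℝ} (hε : 0 < ε) (s : ℝ) :
    ContinuousOn (fun t : ℝ => (t + ε) ^ s) (spectrum ℝ a) := by
  apply ContinuousOn.rpow_const (by fun_prop)
  intro t ht
  left
  have := aux_spec_s7 ha ht
  positivity

lemma aux_contlog {a : H →L[ℂ] H} (ha : a.IsPositive) {ε : ℝ} (hε : 0 < ε) :
    ContinuousOn (fun t : ℝ => Real.log (t + ε)) (spectrum ℝ a) := by
  apply ContinuousOn.log (by fun_prop)
  intro t ht
  have := aux_spec_s7 ha ht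
  positivity

lemma aux_exp {a : H →L[ℂ] H} (ha : a.IsPositive) {ε : ℝ} (hε : 0 < ε) (s : ℝ) :
    NormedSpace.exp ((s : ℂ) • cfc (fun t : ℝ => Real.log (t + ε)) a) =
      cfc (fun t : ℝ => (t + ε) ^ s) a := by
  have hsa : IsSelfAdjoint a := ha.isSelfAdjoint
  have hl := aux_contlog ha hε
  rw [Complex.coe_smul, ← cfc_smul s _ a hl, ← CFC.real_exp_eq_normedSpace_exp (cfc_predicate _ _),
    ← cfc_comp' Real.exp _ a (by fun_prop) (by fun_prop)]
  apply cfc_congr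
  intro t ht
  have := aux_spec_s7 ha ht
  simp only [smul_eq_mul]
  rw [Real.rpow_def_of_pos (by positivity), mul_comm]

lemma aux_tendsto {a : H →L[ℂ] H} (ha : a.IsPositive) {s : ℝ} (hs : 0 < s) (hs1 : s ≤ 1) :
    Filter.Tendsto (fun ε : ℝ => cfc (fun t : ℝ => (t + ε) ^ s) a) (nhdsWithin 0 (Set.Ioi 0))
      (nhds (cfc (fun t : ℝ => t ^ s) a)) := by
  have hsa : IsSelfAdjoint a := ha.isSelfAdjoint
  rw [tendsto_iff_norm_sub_tendsto_zero]
  have hlim : Filter.Tendsto (fun ε : ℝ => ε ^ s) (nhdsWithin 0 (Set.Ioi 0)) (nhds 0) := by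
    have : Filter.Tendsto (fun ε : ℝ => ε ^ s) (nhds 0) (nhds (0 ^ s)) :=
      (Real.continuousAt_rpow_const 0 s (Or.inr hs.le)).tendsto
    rw [Real.zero_rpow hs.ne'] at this
    exact this.mono_left nhdsWithin_le_nhds
  refine squeeze_zero' (Filter.Eventually.of_forall fun _ => norm_nonneg _) ?_ hlim
  filter_upwards [self_mem_nhdsWithin] with ε hε
  have hε : 0 < ε := hε
  rw [← cfc_sub _ _ a (aux_cont ha hε s)
    (Real.continuous_rpow_const hs.le).continuousOn]
  apply norm_cfc_le (by positivity)
  intro t ht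
  have h0 := aux_spec_s7 ha ht
  have h1 := Real.rpow_add_le_add_rpow h0 hε.le hs.le hs1
  have h2 : t ^ s ≤ (t + ε) ^ s := Real.rpow_le_rpow h0 (by linarith) hs.le
  rw [Real.norm_eq_abs, abs_le]
  constructor <;> linarith [Real.rpow_nonneg hε.le s]

/-- The estimate with both operators shifted. -/
lemma aux_shift {a : H' →L[ℂ] H'} {b : H →L[ℂ] H} (ha : a.IsPositive) (hb : b.IsPositive)
    (T G : H →L[ℂ] H') (hG : a.comp G = T.comp b) {α : ℝ} (h0 : 0 ≤ α) (h1 : α ≤ 1)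
    {δ ε : ℝ} (hδ : 0 < δ) (hε : 0 < ε) :
    ‖(cfc (fun t : ℝ => (t + δ) ^ (-α)) a).comp (T.comp (cfc (fun t : ℝ => (t + ε) ^ α) b))‖ ≤
      (‖G‖ + ε * (δ⁻¹ * ‖T‖)) ^ α * ‖T‖ ^ (1 - α) := by
  have hsa : IsSelfAdjoint a := ha.isSelfAdjoint
  have hsb : IsSelfAdjoint b := hb.isSelfAdjoint
  have key := aux_core (cfc (fun t : ℝ => Real.log (t + ε)) b)
    (cfc (fun t : ℝ => Real.log (t + δ)) a) (cfc_predicate _ _) (cfc_predicate _ _) T α h0 h1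
  have c1 := aux_exp ha hδ (-α)
  have c2 := aux_exp ha hδ (-1)
  have c3 := aux_exp hb hε 1
  push_cast at c1 c2 c3
  rw [c1, c2, c3, aux_exp hb hε α] at key
  refine key.trans ?_
  gcongr
  have hb1 : cfc (fun t : ℝ => (t + ε) ^ (1 : ℝ)) b = b + ε • (1 : H →L[ℂ] H) := by
    simp only [Real.rpow_one]
    rw [cfc_add_const ε (fun t => t) b, cfc_id' ℝ b, Algebra.algebraMap_eq_smul_one]
  have hP : ‖cfc (fun t : ℝ => (t + δ) ^ (-1 : ℝ)) a‖ ≤ δ⁻¹ := by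
    apply norm_cfc_le (by positivity)
    intro t ht
    have := aux_spec_s7 ha ht
    rw [Real.rpow_neg_one, Real.norm_of_nonneg (by positivity)]
    exact inv_anti₀ hδ (by linarith)
  have hPa : ‖cfc (fun t : ℝ => (t + δ) ^ (-1 : ℝ)) a * a‖ ≤ 1 := by
    have : cfc (fun t : ℝ => (t + δ) ^ (-1 : ℝ)) a * a
        = cfc (fun t : ℝ => (t + δ) ^ (-1 : ℝ) * t) a := by
      rw [cfc_mul _ (fun t : ℝ => t) a (aux_cont ha hδ _) (by fun_prop), cfc_id' ℝ a]
    rw [this]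
    apply norm_cfc_le (by positivity)
    intro t ht
    have := aux_spec_s7 ha ht
    rw [Real.rpow_neg_one, Real.norm_of_nonneg (by positivity), inv_mul_le_iff₀ (by positivity)]
    linarith
  have e : (cfc (fun t : ℝ => (t + δ) ^ (-1 : ℝ)) a).comp
        (T.comp (cfc (fun t : ℝ => (t + ε) ^ (1 : ℝ)) b)) =
      (cfc (fun t : ℝ => (t + δ) ^ (-1 : ℝ)) a * a).comp G +
        ε • ((cfc (fun t : ℝ => (t + δ) ^ (-1 : ℝ)) a).comp T) := by
    rw [hb1]
    ext x
    have := DFunLike.congr_fun hG x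
    simp only [ContinuousLinearMap.comp_apply] at this
    simp [this]
  rw [e]
  refine (norm_add_le _ _).trans ?_
  rw [norm_smul, Real.norm_of_nonneg hε.le]
  gcongr
  · refine (ContinuousLinearMap.opNorm_comp_le _ _).trans ?_
    exact mul_le_of_le_one_left (norm_nonneg _) hPa
  · refine (ContinuousLinearMap.opNorm_comp_le _ _).trans ?_
    gcongr

lemma aux_shift' {a : H' →L[ℂ] H'} {b : H →L[ℂ] H} (ha : a.IsPositive) (hb : b.IsPositive)
    (T G : H →L[ℂ] H') (hG : a.comp G = T.comp b) {α : ℝ} (h0 : 0 < α) (h1 : α ≤ 1)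
    {δ : ℝ} (hδ : 0 < δ) :
    ‖(cfc (fun t : ℝ => (t + δ) ^ (-α)) a).comp (T.comp (cfc (fun t : ℝ => t ^ α) b))‖ ≤
      ‖G‖ ^ α * ‖T‖ ^ (1 - α) := by
  have l1 : Filter.Tendsto (fun ε : ℝ => ‖(cfc (fun t : ℝ => (t + δ) ^ (-α)) a).comp
      (T.comp (cfc (fun t : ℝ => (t + ε) ^ α) b))‖) (nhdsWithin 0 (Set.Ioi 0))
      (nhds ‖(cfc (fun t : ℝ => (t + δ) ^ (-α)) a).comp
        (T.comp (cfc (fun t : ℝ => t ^ α) b))‖) := by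
    have hc : Continuous (fun X : H →L[ℂ] H =>
      ‖(cfc (fun t : ℝ => (t + δ) ^ (-α)) a).comp (T.comp X)‖) := by fun_prop
    exact (hc.tendsto _).comp (aux_tendsto hb h0 h1)
  have l2 : Filter.Tendsto (fun ε : ℝ => (‖G‖ + ε * (δ⁻¹ * ‖T‖)) ^ α * ‖T‖ ^ (1 - α))
      (nhdsWithin 0 (Set.Ioi 0)) (nhds (‖G‖ ^ α * ‖T‖ ^ (1 - α))) := by
    have hc : Continuous (fun ε : ℝ => (‖G‖ + ε * (δ⁻¹ * ‖T‖)) ^ α * ‖T‖ ^ (1 - α)) := by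
      refine Continuous.mul ?_ continuous_const
      exact Continuous.rpow_const (by fun_prop) (fun _ => Or.inr h0.le)
    have := hc.tendsto 0
    simp only [zero_mul, add_zero] at this
    exact this.mono_left nhdsWithin_le_nhds
  refine le_of_tendsto_of_tendsto l1 l2 ?_
  filter_upwards [self_mem_nhdsWithin] with ε hε
  exact aux_shift ha hb T G hG h0.le h1 hδ hε

lemma aux_adj {a : H' →L[ℂ] H'} {b : H →L[ℂ] H} (ha : a.IsPositive) (hb : b.IsPositive)
    (T G : H →L[ℂ] H') (hG : a.comp G = T.comp b) {α : ℝ} (h0 : 0 < α) (h1 : α ≤ 1) (x : H') :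
    ‖(T.comp (cfc (fun t : ℝ => t ^ α) b)).adjoint x‖ ≤
      ‖G‖ ^ α * ‖T‖ ^ (1 - α) * ‖cfc (fun t : ℝ => t ^ α) a x‖ := by
  have hsa : IsSelfAdjoint a := ha.isSelfAdjoint
  have l1 : Filter.Tendsto (fun δ : ℝ => ‖G‖ ^ α * ‖T‖ ^ (1 - α) *
      ‖cfc (fun t : ℝ => (t + δ) ^ α) a x‖) (nhdsWithin 0 (Set.Ioi 0))
      (nhds (‖G‖ ^ α * ‖T‖ ^ (1 - α) * ‖cfc (fun t : ℝ => t ^ α) a x‖)) := by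
    have hc : Continuous (fun X : H' →L[ℂ] H' => ‖G‖ ^ α * ‖T‖ ^ (1 - α) * ‖X x‖) := by fun_prop
    exact (hc.tendsto _).comp (aux_tendsto ha h0 h1)
  refine ge_of_tendsto l1 ?_
  filter_upwards [self_mem_nhdsWithin] with δ hδ
  have hδ : 0 < δ := hδ
  set P := cfc (fun t : ℝ => (t + δ) ^ α) a with hP
  set Q := cfc (fun t : ℝ => (t + δ) ^ (-α)) a with hQ
  have hPQ : P * Q = 1 := by
    rw [hP, hQ, ← cfc_mul _ _ a (aux_cont ha hδ _) (aux_cont ha hδ _), ← cfc_one ℝ a]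
    apply cfc_congr
    intro t ht
    have := aux_spec_s7 ha ht
    have hp : 0 < t + δ := by positivity
    simp [← Real.rpow_add hp]
  have hPs : P.adjoint = P := (cfc_predicate (fun t : ℝ => (t + δ) ^ α) a : IsSelfAdjoint _)
  set Y := T.comp (cfc (fun t : ℝ => t ^ α) b) with hY
  have e : Y.adjoint x = (Q.comp Y).adjoint (P x) := by
    have : Y = P.comp (Q.comp Y) := by
      rw [← ContinuousLinearMap.comp_assoc]
      change Y = (P * Q).comp Y
      rw [hPQ]; rfl
    conv_lhs => rw [this, ContinuousLinearMap.adjoint_comp, hPs]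
    rfl
  rw [e]
  refine (ContinuousLinearMap.le_opNorm _ _).trans ?_
  gcongr
  rw [LinearIsometryEquiv.norm_map]
  exact aux_shift' ha hb T G hG h0 h1 hδ

end helpers


/-- **Interpolation inequality for fractional powers.**  Let `A` and `B` be positive
invertible self-adjoint operators on Hilbert spaces `H₁`, `H₂`, encoded by their bounded
inverses `iA = A⁻¹`, `iB = B⁻¹`, which are positive injective; thus `dom A = ran iA`,
`A (iA ξ) = ξ`, and the fractional powers satisfy `A^{-α} = iA^α = cfc (·^α) iA`
(functional calculus), and likewise for `B`.  Let `T : H₂ → H₁` be bounded with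
`T (dom B) ⊆ dom A`, so that `G = A T B⁻¹` (characterized by `iA ∘ G = T ∘ iB`) is bounded.
Then for every `0 ≤ α ≤ 1` the everywhere-defined operator `S = A^α T B^{-α}`
(characterized by `iA^α ∘ S = T ∘ iB^α`) is bounded with
`‖S‖ ≤ ‖A T B⁻¹‖^α ‖T‖^{1-α}`. -/
theorem stmt7 {H₁ H₂ : Type*}
    [NormedAddCommGroup H₁] [InnerProductSpace ℂ H₁] [CompleteSpace H₁]
    [NormedAddCommGroup H₂] [InnerProductSpace ℂ H₂] [CompleteSpace H₂]
    (iA : H₁ →L[ℂ] H₁) (iB : H₂ →L[ℂ] H₂)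
    (hiApos : iA.IsPositive) (hiAinj : Function.Injective iA)
    (hiBpos : iB.IsPositive) (hiBinj : Function.Injective iB)
    (T : H₂ →L[ℂ] H₁)
    (hTdom : ∀ ξ : H₂, ∃ η : H₁, T (iB ξ) = iA η)
    (G : H₂ →L[ℂ] H₁) (hG : iA.comp G = T.comp iB) :
    ∀ α : ℝ, 0 ≤ α → α ≤ 1 →
      ∃ S : H₂ →L[ℂ] H₁,
        (cfc (fun t : ℝ => t ^ α) iA).comp S = T.comp (cfc (fun t : ℝ => t ^ α) iB) ∧
        ‖S‖ ≤ ‖G‖ ^ α * ‖T‖ ^ (1 - α) := by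
  intro α h0 h1
  rcases h0.eq_or_lt with rfl | hpos
  · refine ⟨T, ?_, by simp⟩
    have hsa : IsSelfAdjoint iA := hiApos.isSelfAdjoint
    have hsb : IsSelfAdjoint iB := hiBpos.isSelfAdjoint
    simp only [Real.rpow_zero]
    rw [cfc_const_one ℝ iA, cfc_const_one ℝ iB]
    rfl
  have hsa : IsSelfAdjoint iA := hiApos.isSelfAdjoint
  set M := ‖G‖ ^ α * ‖T‖ ^ (1 - α) with hM
  have hM0 : 0 ≤ M := by positivity
  set P := cfc (fun t : ℝ => t ^ α) iA with hP
  have hPs : P.adjoint = P := (cfc_predicate (fun t : ℝ => t ^ α) iA : IsSelfAdjoint _)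
  have hbound : ∀ x, ‖(T.comp (cfc (fun t : ℝ => t ^ α) iB)).adjoint x‖ ≤ M * ‖P x‖ :=
    aux_adj hiApos hiBpos T G hG hpos h1
  have hinj : P.ker = ⊥ := by
    have hfac : cfc (fun t : ℝ => t ^ (1 - α)) iA * P = iA := by
      rw [hP, ← cfc_mul _ _ iA (Real.continuous_rpow_const (by linarith)).continuousOn
        (Real.continuous_rpow_const h0).continuousOn]
      conv_rhs => rw [← cfc_id' ℝ iA]
      apply cfc_congr
      intro t ht
      have := aux_spec_s7 hiApos ht
      simp only
      rw [← Real.rpow_add' this (by simp)]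
      simp
    rw [Submodule.eq_bot_iff]
    intro x hx
    have hx : P x = 0 := hx
    apply hiAinj
    rw [← hfac]
    simp [hx]
  have hdense : DenseRange P := by
    have : P.rangeᗮ = ⊥ := by rw [ContinuousLinearMap.orthogonal_range, hPs, hinj]
    have h2 := (Submodule.topologicalClosure_eq_top_iff (K := P.range)).2 this
    have h3 := Submodule.dense_iff_topologicalClosure_eq_top.2 h2
    have h4 : ((P.range : Submodule ℂ H₁) : Set H₁) = Set.range P := by
      ext y; simp
    rw [h4] at h3
    exact h3
  set Y := T.comp (cfc (fun t : ℝ => t ^ α) iB) with hY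
  let R : H₁ →L[ℂ] H₂ := (Y.adjoint.toLinearMap).extendOfNorm P.toLinearMap
  have hR : R.comp P = Y.adjoint := by
    ext x
    exact LinearMap.extendOfNorm_eq (f := Y.adjoint.toLinearMap) (e := P.toLinearMap)
      hdense ⟨M, hbound⟩ x
  refine ⟨R.adjoint, ?_, ?_⟩
  · have := congrArg ContinuousLinearMap.adjoint hR
    rw [ContinuousLinearMap.adjoint_comp, hPs, ContinuousLinearMap.adjoint_adjoint] at this
    exact this
  · rw [LinearIsometryEquiv.norm_map]
    exact LinearMap.opNorm_extendOfNorm_le hdense hM0 hbound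
end

section
/- Let D be a self-adjoint operator on a Hilbert space H and μ a bounded invertible operator on H. For 0 < α ≤ 1, setting ⟨D⟩ = (1+D²)^{1/2}, one has ‖⟨D⟩^α μ* (μ⟨D⟩μ*)^{-α}‖ ≤ ‖μ⁻¹‖^α ‖μ‖^{1-α} and ‖(μ⟨D⟩μ*)^α μ^{-1*} ⟨D⟩^{-α}‖ ≤ ‖μ‖^α ‖μ⁻¹‖^{1-α}. -/
set_option linter.unusedSectionVars false

section aux
open scoped NNReal
variable {A : Type*} [CStarAlgebra A] [PartialOrder A] [StarOrderedRing A]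

theorem aux_poly (a : A) (p : Polynomial ℝ) :
    a * Polynomial.aeval (star a * a) p = Polynomial.aeval (a * star a) p * a := by
  induction p using Polynomial.induction_on' with
  | add p q hp hq => simp [mul_add, add_mul, hp, hq]
  | monomial n r =>
    have h : ∀ n : ℕ, a * (star a * a) ^ n = (a * star a) ^ n * a := by
      intro n
      induction n with
      | zero => simp
      | succ n ih => rw [pow_succ, ← mul_assoc, ih, pow_succ]; simp only [mul_assoc]
    simp only [Polynomial.aeval_monomial, ← Algebra.smul_def, mul_smul_comm, smul_mul_assoc, h]

theorem aux_inter (a : A) (f : ℝ → ℝ) (hf : Continuous f) :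
    a * cfc f (star a * a) = cfc f (a * star a) * a := by
  have h1 : IsSelfAdjoint (star a * a) := .star_mul_self a
  have h2 : IsSelfAdjoint (a * star a) := .mul_star_self a
  rw [← sub_eq_zero, ← norm_eq_zero]
  refine le_antisymm (le_of_forall_pos_le_add fun ε hε => ?_) (norm_nonneg _)
  set M : ℝ := max (‖star a * a‖ * ‖(1:A)‖) (‖a * star a‖ * ‖(1:A)‖)
  have hd : 0 < 2 * ‖a‖ + 1 := by positivity
  obtain ⟨p, hp⟩ := exists_polynomial_near_of_continuousOn (-M) M f hf.continuousOn
    (ε / (2 * ‖a‖ + 1)) (by positivity)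
  have key : ∀ b : A, IsSelfAdjoint b → ‖b‖ * ‖(1:A)‖ ≤ M →
      ‖cfc f b - Polynomial.aeval b p‖ ≤ ε / (2 * ‖a‖ + 1) := by
    intro b hb hbM
    rw [← cfc_polynomial p b, ← cfc_sub f p.eval b hf.continuousOn p.continuous.continuousOn]
    refine norm_cfc_le (by positivity) fun x hx => ?_
    have hx' : |x| ≤ M := (spectrum.norm_le_norm_mul_of_mem hx).trans hbM
    rw [Real.norm_eq_abs, abs_sub_comm]
    exact (hp x (abs_le.mp hx')).le
  have k1 := key _ h1 (le_max_left _ _)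
  have k2 := key _ h2 (le_max_right _ _)
  have e : a * cfc f (star a * a) - cfc f (a * star a) * a =
      a * (cfc f (star a * a) - Polynomial.aeval (star a * a) p)
      - (cfc f (a * star a) - Polynomial.aeval (a * star a) p) * a := by
    rw [mul_sub, sub_mul, aux_poly]; abel
  rw [e]
  set d := ε / (2 * ‖a‖ + 1) with hdd
  have hε' : d * (2 * ‖a‖ + 1) = ε := by rw [hdd]; field_simp
  have hd0 : 0 ≤ d := by positivity
  calc _ ≤ ‖a‖ * d + d * ‖a‖ := by
        refine (norm_sub_le _ _).trans (add_le_add ?_ ?_)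
        · exact (norm_mul_le _ _).trans (by gcongr)
        · exact (norm_mul_le _ _).trans (by gcongr)
    _ ≤ 0 + ε := by rw [← hε']; linarith

theorem aux_rpow_inter (a : A) (r : ℝ) (hr : 0 ≤ r) :
    a * (star a * a) ^ r = (a * star a) ^ r * a := by
  rw [CFC.rpow_eq_cfc_real (star_mul_self_nonneg a), CFC.rpow_eq_cfc_real (mul_star_self_nonneg a)]
  exact aux_inter a _ (Real.continuous_rpow_const hr)

theorem aux_rpow_add (a : A) (ha : 0 ≤ a) {x y : ℝ} (hx : 0 ≤ x) (hy : 0 ≤ y) :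
    a ^ x * a ^ y = a ^ (x + y) := by
  simp only [CFC.rpow_def]
  rw [← cfc_mul _ _ a (NNReal.continuous_rpow_const hx).continuousOn
    (NNReal.continuous_rpow_const hy).continuousOn]
  congr 1; ext t
  rw [NNReal.rpow_add_of_nonneg _ hx hy]

theorem aux_rpow_smul (a : A) (ha : 0 ≤ a) {c r : ℝ} (hc : 0 ≤ c) (hr : 0 ≤ r) :
    (c • a) ^ r = c ^ r • a ^ r := by
  rw [CFC.rpow_eq_cfc_real (smul_nonneg hc ha), CFC.rpow_eq_cfc_real ha]
  rw [← cfc_comp_smul c _ a (Real.continuous_rpow_const hr).continuousOn,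
    ← cfc_smul _ _ a (Real.continuous_rpow_const hr).continuousOn]
  refine cfc_congr fun x hx => ?_
  simp only [smul_eq_mul]
  exact Real.mul_rpow hc (spectrum_nonneg_of_nonneg ha hx)

theorem aux_conj (a b : A) (hb : 0 ≤ b) :
    b * (a * star a) * b ≤ ‖a‖ ^ 2 • (b * b) := by
  have h := conjugate_le_conjugate_of_nonneg
    (CStarAlgebra.mul_star_le_algebraMap_norm_sq (a := a)) hb
  simpa [Algebra.algebraMap_eq_smul_one] using h

/-- Base range. -/
theorem aux_base (Q m n : A) (hQ : 0 ≤ Q) (hnm : n * m = 1)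
    (hc : 1 ≤ ‖n‖ * ‖m‖) (s : ℝ) (h1 : 1 ≤ s) (h2 : s ≤ 2) :
    star m * (star n * Q * n) ^ s * m ≤ (‖n‖ ^ s * ‖m‖ ^ (2 - s)) • Q ^ s := by
  set R := CFC.sqrt Q with hR
  have hR0 : 0 ≤ R := CFC.sqrt_nonneg Q
  have hRR : R * R = Q := CFC.sqrt_mul_sqrt_self Q hQ
  have hRs : star R = R := (IsSelfAdjoint.of_nonneg hR0).star_eq
  have hRp : R = Q ^ (1/2 : ℝ) := CFC.sqrt_eq_rpow
  set a := R * n with ha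
  have haP : star n * Q * n = star a * a := by
    rw [ha, star_mul, hRs, ← hRR]; simp only [mul_assoc]
  have ham : a * m = R := by rw [ha, mul_assoc, hnm, mul_one]
  have hma : star m * star a = R := by rw [← star_mul, ham, hRs]
  have hr : 0 ≤ s - 1 := by linarith
  have e1 : (star a * a) ^ s = star a * (a * star a) ^ (s - 1) * a := by
    have e0 := aux_rpow_add _ (star_mul_self_nonneg a) zero_le_one hr
    rw [CFC.rpow_one _ (star_mul_self_nonneg a), add_sub_cancel] at e0
    rw [← e0, mul_assoc (star a), mul_assoc (star a), aux_rpow_inter a _ hr]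
  have e2 : star m * (star a * a) ^ s * m = R * (a * star a) ^ (s - 1) * R := by
    rw [e1]
    calc _ = (star m * star a) * (a * star a) ^ (s - 1) * (a * m) := by simp only [mul_assoc]
      _ = _ := by rw [hma, ham]
  have hle : a * star a ≤ ‖n‖ ^ 2 • Q := by
    have := aux_conj n R hR0
    rw [hRR] at this
    rw [ha, star_mul, hRs]
    simpa only [mul_assoc] using this
  have hle2 := CFC.rpow_le_rpow (p := s - 1) ⟨hr, by linarith⟩ hle
  rw [aux_rpow_smul Q hQ (by positivity) hr] at hle2
  have hle3 := conjugate_le_conjugate_of_nonneg hle2 hR0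
  rw [haP, e2]
  refine hle3.trans ?_
  have e3 : R * (((‖n‖ ^ 2) ^ (s - 1)) • Q ^ (s - 1)) * R = ((‖n‖ ^ 2) ^ (s - 1)) • Q ^ s := by
    rw [mul_smul_comm, smul_mul_assoc, hRp, aux_rpow_add Q hQ (by norm_num) hr,
      aux_rpow_add Q hQ (by linarith) (by norm_num)]
    congr 2; ring
  rw [e3]
  refine smul_le_smul_of_nonneg_right ?_ CFC.rpow_nonneg
  have hn : 0 < ‖n‖ := by
    rcases (norm_nonneg n).eq_or_lt with h | h
    · rw [← h] at hc; norm_num at hc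
    · exact h
  calc (‖n‖ ^ 2) ^ (s - 1) = ‖n‖ ^ (2 * (s - 1)) := by
        rw [Real.rpow_mul hn.le]; norm_num
    _ = ‖n‖ ^ (2 * (s - 1)) * 1 := by ring
    _ ≤ ‖n‖ ^ (2 * (s - 1)) * (‖n‖ * ‖m‖) ^ (2 - s) := by
        gcongr; exact Real.one_le_rpow hc (by linarith)
    _ = ‖n‖ ^ s * ‖m‖ ^ (2 - s) := by
        rw [Real.mul_rpow hn.le (norm_nonneg m), ← mul_assoc, ← Real.rpow_add hn]
        congr 2; ring

theorem aux_step (P Q m n : A) (hP : 0 ≤ P) (hQ : 0 ≤ Q) (s : ℝ) (hs : 0 < s)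
    (h : star m * P ^ s * m ≤ (‖n‖ ^ s * ‖m‖ ^ (2 - s)) • Q ^ s) (hm : 0 < ‖m‖) :
    star m * P ^ (s/2) * m ≤ (‖n‖ ^ (s/2) * ‖m‖ ^ (2 - s/2)) • Q ^ (s/2) := by
  set X := star m * P ^ (s/2) * m with hX
  have hX0 : 0 ≤ X := star_left_conjugate_nonneg CFC.rpow_nonneg m
  have hXX : X * X ≤ ‖m‖ ^ 2 • (star m * P ^ s * m) := by
    have h1 := star_left_conjugate_le_conjugate (aux_conj m (P ^ (s/2)) CFC.rpow_nonneg) m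
    rw [aux_rpow_add P hP (by positivity) (by positivity), add_halves] at h1
    simpa only [hX, mul_assoc, mul_smul_comm, smul_mul_assoc] using h1
  have h2 : X * X ≤ (‖m‖ ^ 2 * (‖n‖ ^ s * ‖m‖ ^ (2 - s))) • Q ^ s := by
    rw [mul_smul]
    exact hXX.trans (smul_le_smul_of_nonneg_left h (by positivity))
  have h3 := CFC.rpow_le_rpow (p := 1/2) ⟨by norm_num, by norm_num⟩ h2
  rw [← CFC.sqrt_eq_rpow, CFC.sqrt_mul_self X hX0,
    aux_rpow_smul _ CFC.rpow_nonneg (by positivity) (by norm_num),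
    CFC.rpow_rpow_of_exponent_nonneg Q s (1/2) hs.le (by norm_num)] at h3
  convert h3 using 2
  · rw [Real.mul_rpow (by positivity) (by positivity), Real.mul_rpow (by positivity) (by positivity),
      ← Real.rpow_mul (norm_nonneg n), ← Real.rpow_mul hm.le, ← Real.rpow_natCast, 
      ← Real.rpow_mul hm.le, mul_left_comm, ← Real.rpow_add hm]
    congr 2 
    · ring
    · push_cast; ring
  · congr 1; ring

theorem aux_all (Q m n : A) (hQ : 0 ≤ Q) (hnm : n * m = 1)
    (hc : 1 ≤ ‖n‖ * ‖m‖) (k : ℕ) : ∀ s : ℝ, 2 ≤ s * 2 ^ (k + 1) → 0 < s → s ≤ 2 → 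
    star m * (star n * Q * n) ^ s * m ≤ (‖n‖ ^ s * ‖m‖ ^ (2 - s)) • Q ^ s := by
  have hm : 0 < ‖m‖ := by
    rcases (norm_nonneg m).eq_or_lt with h | h
    · rw [← h] at hc; norm_num at hc
    · exact h
  induction k with
  | zero => intro s h1 _ h2; exact aux_base Q m n hQ hnm hc s (by norm_num at h1; linarith) h2
  | succ k ih =>
    intro s h1 h0 h2
    rcases le_total 1 s with h | h
    · exact aux_base Q m n hQ hnm hc s h h2
    · have := aux_step (star n * Q * n) Q m n (star_left_conjugate_nonneg hQ n) hQ (2 * s)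
        (by linarith) (ih (2 * s) (by rw [pow_succ] at h1; linarith) (by linarith) (by linarith)) hm
      rwa [mul_div_cancel_left₀ s two_ne_zero] at this

theorem aux_final (Q m n : A) (hQ : 0 ≤ Q) (hnm : n * m = 1)
    (hc : 1 ≤ ‖n‖ * ‖m‖) (s : ℝ) (h0 : 0 < s) (h2 : s ≤ 2) : 
    star m * (star n * Q * n) ^ s * m ≤ (‖n‖ ^ s * ‖m‖ ^ (2 - s)) • Q ^ s := by
  obtain ⟨k, hk⟩ := pow_unbounded_of_one_lt (2 / s) (one_lt_two (α := ℝ))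
  refine aux_all Q m n hQ hnm hc k s ?_ h0 h2
  rw [div_lt_iff₀ h0] at hk
  rw [pow_succ]; linarith
end aux

section aux2
variable {H : Type*} [NormedAddCommGroup H] [InnerProductSpace ℂ H] [CompleteSpace H]
open ContinuousLinearMap

theorem aux_douglas (R T : H →L[ℂ] H) (hR : IsSelfAdjoint R) (hinj : Function.Injective R)
    (c : ℝ) (hc : 0 ≤ c) (h : T * star T ≤ (c ^ 2) • (R * R)) :
    ∃ S : H →L[ℂ] H, R * S = T ∧ ‖S‖ ≤ c := by
  have hb : ∀ x, ‖star T x‖ ≤ c * ‖R x‖ := by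
    intro x
    rw [ContinuousLinearMap.le_def] at h
    have h1 := h.re_inner_nonneg_left x
    have hRR : ∀ x, inner ℂ (R (R x)) x = inner ℂ (R x) (R x) := fun x => by
      conv_rhs => rw [← ContinuousLinearMap.adjoint_inner_left]
      rw [← ContinuousLinearMap.star_eq_adjoint, hR.star_eq]
    have hTT : inner ℂ (T (star T x)) x = inner ℂ (star T x) (star T x) := by
      rw [ContinuousLinearMap.star_eq_adjoint, ContinuousLinearMap.adjoint_inner_right]
    have h2 : ‖star T x‖ ^ 2 ≤ (c * ‖R x‖) ^ 2 := by
      have e : (((c ^ 2) • (R * R) - T * star T : H →L[ℂ] H)) x =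
        ((c ^ 2 : ℝ) : ℂ) • R (R x) - T (star T x) := by
        rw [Complex.coe_smul]; rfl
      rw [e, inner_sub_left, inner_smul_left, hRR, hTT, Complex.conj_ofReal,
        inner_self_eq_norm_sq_to_K, inner_self_eq_norm_sq_to_K] at h1
      have : RCLike.re (((c ^ 2 : ℝ) : ℂ) * ((‖R x‖ : ℂ)) ^ 2 - (‖star T x‖ : ℂ) ^ 2) =
        c ^ 2 * ‖R x‖ ^ 2 - ‖star T x‖ ^ 2 := by
        norm_cast
      have h1' := this ▸ h1
      nlinarith
    exact le_of_sq_le_sq h2 (by positivity)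
  have hd : DenseRange R := by
    have h1 := ContinuousLinearMap.orthogonal_range R
    rw [← ContinuousLinearMap.star_eq_adjoint, hR.star_eq, LinearMap.ker_eq_bot.mpr hinj] at h1
    have h2 := (Submodule.topologicalClosure_eq_top_iff (K := R.range)).mpr h1
    exact Submodule.dense_iff_topologicalClosure_eq_top.mpr h2
  refine ⟨star ((star T).toLinearMap.extendOfNorm R.toLinearMap), ?_, ?_⟩
  · rw [← star_star (R * _), star_mul, star_star, hR.star_eq]
    rw [← star_star T]
    congr 1
    ext x
    rw [star_star]
    exact LinearMap.extendOfNorm_eq hd ⟨c, hb⟩ x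
  · rw [norm_star]
    exact LinearMap.opNorm_extendOfNorm_le hd hc hb

theorem aux_half (Q : H →L[ℂ] H) (hQ : 0 ≤ Q) (hQinj : Function.Injective Q)
    (μ ν : H →L[ℂ] H) (hνμ : ν * μ = 1)
    (α : ℝ) (hα0 : 0 < α) (hα1 : α ≤ 1) :
    ∃ S : H →L[ℂ] H,
      (cfc (fun t : ℝ => t ^ α) Q) * S = adjoint μ * cfc (fun t : ℝ => t ^ α) (adjoint ν * Q * ν) ∧
      ‖S‖ ≤ ‖ν‖ ^ α * ‖μ‖ ^ (1 - α) := by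
  rcases subsingleton_or_nontrivial H with hH | hH
  · exact ⟨0, Subsingleton.elim _ _, by rw [norm_zero]; positivity⟩
  have hP : 0 ≤ adjoint ν * Q * ν := star_left_conjugate_nonneg hQ ν
  have hc : 1 ≤ ‖ν‖ * ‖μ‖ := by
    have := norm_mul_le ν μ
    rwa [hνμ, norm_one] at this
  rw [← CFC.rpow_eq_cfc_real hQ, ← CFC.rpow_eq_cfc_real hP]
  refine aux_douglas _ _ (IsSelfAdjoint.of_nonneg CFC.rpow_nonneg) ?_ _ (by positivity) ?_
  · have e : Q ^ (1 - α) * Q ^ α = Q := by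
      rw [aux_rpow_add Q hQ (by linarith) hα0.le, sub_add_cancel, CFC.rpow_one Q hQ]
    have : Function.Injective ((Q ^ (1 - α) : H →L[ℂ] H) ∘ (Q ^ α : H →L[ℂ] H)) := by
      intro x y hxy
      apply hQinj
      rw [← e]; exact hxy
    exact this.of_comp
  · have := aux_final Q μ ν hQ hνμ hc (2 * α) (by linarith) (by linarith)
    have hs : star ((adjoint ν * Q * ν) ^ α) = (adjoint ν * Q * ν) ^ α :=
      (IsSelfAdjoint.of_nonneg CFC.rpow_nonneg).star_eq
    rw [star_mul, hs, aux_rpow_add Q hQ hα0.le hα0.le, ← two_mul]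
    have e : adjoint μ * (adjoint ν * Q * ν) ^ α * ((adjoint ν * Q * ν) ^ α * star (adjoint μ))
      = star μ * (star ν * Q * ν) ^ (2 * α) * μ := by
      rw [← ContinuousLinearMap.star_eq_adjoint, ← ContinuousLinearMap.star_eq_adjoint, star_star,
        two_mul, ← aux_rpow_add _ (star_left_conjugate_nonneg hQ ν) hα0.le hα0.le]
      simp only [mul_assoc]
    rw [e]
    convert this using 2
    rw [mul_pow, ← Real.rpow_natCast, ← Real.rpow_natCast, ← Real.rpow_mul (norm_nonneg _),
      ← Real.rpow_mul (norm_nonneg _)]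
    congr 2 <;> push_cast <;> ring
end aux2

open ContinuousLinearMap in
/-- Let `D` be a self-adjoint operator on a Hilbert space `H`, encoded by its bounded
transform pair `(F, Q)` with `F = D(1+D²)^{-1/2}`, `Q = ⟨D⟩⁻¹ = (1+D²)^{-1/2}` (`Q`
positive injective, `F` self-adjoint, `FQ = QF`, `F² + Q² = 1`), and let `μ` be a bounded
invertible operator with inverse `ν`.  Then `(μ⟨D⟩μ*)⁻¹ = μ*⁻¹ ⟨D⟩⁻¹ μ⁻¹ = ν* Q ν =: P`,
and for `0 < α ≤ 1` the fractional powers satisfy `⟨D⟩^{-α} = Q^α = cfc (·^α) Q` and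
`(μ⟨D⟩μ*)^{-α} = P^α = cfc (·^α) P`.  The bounded operators
`S = ⟨D⟩^α μ* (μ⟨D⟩μ*)^{-α}` (characterized by `Q^α ∘ S = μ* ∘ P^α`) and
`S₂ = (μ⟨D⟩μ*)^α μ^{-1*} ⟨D⟩^{-α}` (characterized by `P^α ∘ S₂ = ν* ∘ Q^α`) satisfy
`‖S‖ ≤ ‖μ⁻¹‖^α ‖μ‖^{1-α}` and `‖S₂‖ ≤ ‖μ‖^α ‖μ⁻¹‖^{1-α}`. -/
theorem stmt8 {H : Type*} [NormedAddCommGroup H] [InnerProductSpace ℂ H] [CompleteSpace H]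
    (F Q : H →L[ℂ] H) (hQpos : Q.IsPositive) (hQinj : Function.Injective Q)
    (hF : IsSelfAdjoint F) (hFQ : F * Q = Q * F) (hpyth : F * F + Q * Q = 1)
    (μ ν : H →L[ℂ] H) (hμν : μ * ν = 1) (hνμ : ν * μ = 1)
    (α : ℝ) (hα0 : 0 < α) (hα1 : α ≤ 1) :
    (∃ S : H →L[ℂ] H,
      (cfc (fun t : ℝ => t ^ α) Q) * S = adjoint μ * cfc (fun t : ℝ => t ^ α) (adjoint ν * Q * ν) ∧
      ‖S‖ ≤ ‖ν‖ ^ α * ‖μ‖ ^ (1 - α)) ∧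
    (∃ S₂ : H →L[ℂ] H,
      (cfc (fun t : ℝ => t ^ α) (adjoint ν * Q * ν)) * S₂ = adjoint ν * cfc (fun t : ℝ => t ^ α) Q ∧
      ‖S₂‖ ≤ ‖μ‖ ^ α * ‖ν‖ ^ (1 - α)) := by
  have hQ : 0 ≤ Q := (nonneg_iff_isPositive Q).2 hQpos
  refine ⟨aux_half Q hQ hQinj μ ν hνμ α hα0 hα1, ?_⟩
  have hP : 0 ≤ adjoint ν * Q * ν := star_left_conjugate_nonneg hQ ν
  have h1 : adjoint μ * adjoint ν = 1 := by
    have := congrArg star hνμ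
    rwa [star_mul, star_one] at this
  have h2 : adjoint ν * adjoint μ = 1 := by
    have := congrArg star hμν
    rwa [star_mul, star_one] at this
  have e : adjoint μ * (adjoint ν * Q * ν) * μ = Q := by
    calc _ = (adjoint μ * adjoint ν) * Q * (ν * μ) := by simp only [mul_assoc]
      _ = Q := by rw [h1, hνμ, one_mul, mul_one]
  have hPinj : Function.Injective (adjoint ν * Q * ν) := by
    have l1 : Function.LeftInverse μ ν := fun x => congrArg (fun f : H →L[ℂ] H => f x) hμν
    have l2 : Function.LeftInverse (adjoint μ) (adjoint ν) :=
      fun x => congrArg (fun f : H →L[ℂ] H => f x) h1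
    exact (l2.injective.comp hQinj).comp l1.injective
  have := aux_half (adjoint ν * Q * ν) hP hPinj ν μ hμν α hα0 hα1
  rwa [e] at this
end

section
/- Let A be a C*-algebra and ψ a state on A. The compactly supported states (those ψ for which there exists a ∈ A with ψ(a) = ‖a‖ ≠ 0) are weak-* dense in the state space of A: for every state ψ there is a net of compactly supported states ψ_λ with ψ_λ(a) → ψ(a) for all a ∈ A. -/
open scoped ComplexOrder

section helpers
open Filter Topology

variable {A : Type*} [NonUnitalCStarAlgebra A] [PartialOrder A] [StarOrderedRing A]

lemma le_of_sq_le_sq_st {x y : ℝ} (h : x ^ 2 ≤ y ^ 2) (hy : 0 ≤ y) : x ≤ y :=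
  abs_le_of_sq_le_sq' h hy |>.2

lemma st_cs (ψ : A →L[ℂ] ℂ) (hpos : ∀ a : A, 0 ≤ a → 0 ≤ ψ a) (x y : A) :
    ‖ψ (star x * y)‖ ^ 2 ≤ (ψ (star x * x)).re * (ψ (star y * y)).re := by
  let f : A →ₚ[ℂ] ℂ := PositiveLinearMap.mk₀ (ψ : A →ₗ[ℂ] ℂ) hpos
  have h := norm_inner_le_norm (𝕜 := ℂ) (f.toPreGNS x) (f.toPreGNS y)
  have hx := f.preGNS_norm_sq (f.toPreGNS x)
  have hy := f.preGNS_norm_sq (f.toPreGNS y)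
  rw [f.preGNS_inner_def] at h
  have hx' : ‖f.toPreGNS x‖ ^ 2 = (ψ (star x * x)).re := by
    have := congrArg Complex.re hx
    rw [← Complex.ofReal_pow, Complex.ofReal_re] at this
    exact this
  have hy' : ‖f.toPreGNS y‖ ^ 2 = (ψ (star y * y)).re := by
    have := congrArg Complex.re hy
    rw [← Complex.ofReal_pow, Complex.ofReal_re] at this
    exact this
  rw [← hx', ← hy', ← mul_pow]
  exact pow_le_pow_left₀ (norm_nonneg _) h 2

lemma st_star (ψ : A →L[ℂ] ℂ) (hpos : ∀ a : A, 0 ≤ a → 0 ≤ ψ a) (x : A) :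
    ψ (star x) = star (ψ x) :=
  map_star (PositiveLinearMap.mk₀ (ψ : A →ₗ[ℂ] ℂ) hpos) x

lemma st_re_le (ψ : A →L[ℂ] ℂ) (hnorm : ‖ψ‖ = 1) (x : A) : (ψ x).re ≤ ‖x‖ := by
  have := ψ.le_opNorm x
  rw [hnorm, one_mul] at this
  exact (Complex.re_le_norm _).trans this

lemma st_sq_le (ψ : A →L[ℂ] ℂ) (hnorm : ‖ψ‖ = 1) (x : A) : (ψ (star x * x)).re ≤ ‖x‖ ^ 2 := by
  have := st_re_le ψ hnorm (star x * x)
  rwa [CStarRing.norm_star_mul_self, ← sq] at this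

lemma st_exists_e (ψ : A →L[ℂ] ℂ) (hpos : ∀ a : A, 0 ≤ a → 0 ≤ ψ a) (hnorm : ‖ψ‖ = 1)
    (ε : ℝ) (hε : 0 < ε) (hε1 : ε < 1) :
    ∃ e : A, 0 ≤ e ∧ ‖e‖ ≤ 1 ∧ 1 - ε < (ψ (e * e)).re := by
  obtain ⟨x, hx1, hx⟩ := ψ.exists_lt_apply_of_lt_opNorm
    (r := √(1 - ε)) (by rw [hnorm, Real.sqrt_lt' one_pos]; linarith)
  have hl := CStarAlgebra.increasingApproximateUnit A
  have := hl.neBot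
  have h1 : Tendsto (fun e => ‖ψ (x * e)‖) (CStarAlgebra.approximateUnit A) (𝓝 ‖ψ x‖) :=
    ((ψ.continuous.tendsto _).comp (hl.tendsto_mul_left x)).norm
  obtain ⟨e, h1, h2, h3⟩ := ((h1.eventually_const_lt hx).and
    (hl.eventually_nonneg.and hl.eventually_norm)).exists
  refine ⟨e, h2, h3, ?_⟩
  have hc := st_cs ψ hpos (star x) e
  have he : star e = e := (IsSelfAdjoint.of_nonneg h2).star_eq
  have hq := st_sq_le ψ hnorm (star x)
  rw [he] at hc
  rw [norm_star] at hq
  rw [star_star] at hc hq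
  have h0 : 0 ≤ (ψ (e * e)).re := by
    have := hpos _ (star_mul_self_nonneg e)
    rw [he] at this
    exact (Complex.le_def.1 this).1
  have h4 := Real.lt_sq_of_sqrt_lt h1
  have : ‖x‖ ^ 2 ≤ 1 := pow_le_one₀ (norm_nonneg _) hx1.le
  nlinarith

set_option maxHeartbeats 1000000 in
lemma st_exists_h (ψ : A →L[ℂ] ℂ) (hpos : ∀ a : A, 0 ≤ a → 0 ≤ ψ a) (hnorm : ‖ψ‖ = 1)
    (ε : ℝ) (hε : 0 < ε) (hε1 : ε < 1) :
    ∃ h g : A, star h = h ∧ ‖h‖ ≤ 1 ∧ ‖g‖ ≤ 1 ∧ g * h = h ∧ (ψ (h * h)).re ≤ (ψ h).re ∧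
      1 - ε < (ψ (h * h)).re := by
  obtain ⟨e, he0, he1, he⟩ := st_exists_e ψ hpos hnorm (ε / 2) (by linarith) (by linarith)
  set δ := ε / 4 with hδ
  have hδ0 : 0 < δ := by positivity
  have hsa : IsSelfAdjoint e := .of_nonneg he0
  let f : ℝ → ℝ := fun t => max (t - δ) 0
  let k : ℝ → ℝ := fun t => min (t / δ) 1
  have hf : Continuous f := by fun_prop
  have hk : Continuous k := by fun_prop
  have hf0 : f 0 = 0 := by simp [f, hδ0.le]
  have hk0 : k 0 = 0 := by simp [k]
  have hsp : ∀ t ∈ quasispectrum ℝ e, 0 ≤ t ∧ t ≤ 1 := fun t ht =>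
    ⟨quasispectrum_nonneg_of_nonneg e he0 t ht, (le_abs_self t).trans <|
      (NonUnitalIsometricContinuousFunctionalCalculus.norm_quasispectrum_le (𝕜 := ℝ) e ht hsa).trans he1⟩
  have hfb : ∀ t ∈ quasispectrum ℝ e, 0 ≤ f t ∧ f t ≤ 1 := fun t ht =>
    ⟨le_max_right _ _, max_le (by linarith [(hsp t ht).2]) zero_le_one⟩
  have hhsa : star (cfcₙ f e) = cfcₙ f e := (cfcₙ_predicate (R := ℝ) f e).star_eq
  have hh1 : ‖cfcₙ f e‖ ≤ 1 := norm_cfcₙ_le fun t ht => by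
    rw [Real.norm_eq_abs, abs_of_nonneg (hfb t ht).1]; exact (hfb t ht).2
  have hdiff : ‖cfcₙ f e - e‖ ≤ δ := by
    have : cfcₙ f e - e = cfcₙ (fun t => f t - t) e := by
      rw [cfcₙ_sub f (fun t => t) e hf.continuousOn hf0 continuousOn_id rfl, cfcₙ_id' ℝ e]
    rw [this]
    refine norm_cfcₙ_le fun t ht => ?_
    have h0 := (hsp t ht).1
    rw [Real.norm_eq_abs, abs_le]
    simp only [f]
    rcases le_total t δ with h | h
    · rw [max_eq_right (by linarith)]; constructor <;> linarith
    · rw [max_eq_left (by linarith)]; constructor <;> linarith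
  refine ⟨cfcₙ f e, cfcₙ k e, hhsa, hh1, ?_, ?_, ?_, ?_⟩
  · refine norm_cfcₙ_le fun t ht => ?_
    have : 0 ≤ k t := le_min (div_nonneg (hsp t ht).1 hδ0.le) zero_le_one
    rw [Real.norm_eq_abs, abs_of_nonneg this]
    exact min_le_right _ _
  · rw [← cfcₙ_mul k f e hk.continuousOn hk0 hf.continuousOn hf0]
    refine cfcₙ_congr fun t ht => ?_
    simp only [k, f]
    rcases le_total t δ with h | h
    · rw [max_eq_right (by linarith)]; simp
    · rw [min_eq_right ((one_le_div hδ0).2 h), one_mul]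
  · have : cfcₙ f e * cfcₙ f e ≤ cfcₙ f e := by
      rw [← cfcₙ_mul f f e hf.continuousOn hf0 hf.continuousOn hf0]
      refine cfcₙ_mono (hf := (hf.mul hf).continuousOn) (hg := hf.continuousOn) (hf0 := by simp only [hf0, mul_zero]) (hg0 := hf0) fun t ht => ?_
      have := hfb t ht
      nlinarith
    have := hpos _ (sub_nonneg.2 this)
    rw [map_sub] at this
    have := (Complex.le_def.1 this).1
    simp at this
    linarith
  · set h := cfcₙ f e
    have h1 : ‖e * e - h * h‖ ≤ 2 * δ := by
      have : e * e - h * h = (e - h) * e + h * (e - h) := by noncomm_ring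
      rw [this]
      rw [norm_sub_rev] at hdiff
      have h1 := norm_mul_le (e - h) e
      have h2 := norm_mul_le h (e - h)
      have h3 := norm_add_le ((e - h) * e) (h * (e - h))
      nlinarith [norm_nonneg (e - h), norm_nonneg h, norm_nonneg e]
    have h2 := st_re_le ψ hnorm (e * e - h * h)
    rw [map_sub, Complex.sub_re] at h2
    linarith

lemma st_bound (ψ : A →L[ℂ] ℂ) (hpos : ∀ a : A, 0 ≤ a → 0 ≤ ψ a) (hnorm : ‖ψ‖ = 1)
    (h : A) (hsa : star h = h) (hle : (ψ (h * h)).re ≤ (ψ h).re) (a : A) :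
    ‖ψ a - ψ (h * a)‖ ^ 2 ≤ ‖a‖ ^ 2 * (1 - (ψ (h * h)).re) := by
  have hl := CStarAlgebra.increasingApproximateUnit A
  have := hl.neBot
  have t1 : ∀ b, Tendsto (fun u => u * b) (CStarAlgebra.approximateUnit A) (𝓝 b) :=
    hl.tendsto_mul_right
  have t2 : ∀ b, Tendsto (fun u => u * b * u) (CStarAlgebra.approximateUnit A) (𝓝 b) := by
    intro b
    have h1 : Tendsto (fun u => u * (b * u - b)) (CStarAlgebra.approximateUnit A) (𝓝 0) := by
      have := (tendsto_sub_nhds_zero_iff.2 (hl.tendsto_mul_left b)).norm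
      rw [norm_zero] at this
      refine squeeze_zero_norm' ?_ this
      filter_upwards [hl.eventually_norm] with u hu
      exact (norm_mul_le _ _).trans (mul_le_of_le_one_left (norm_nonneg _) hu)
    have := h1.add (t1 b)
    simpa [mul_sub, mul_assoc] using this
  have hre : ∀ b, Tendsto (fun u => (ψ (u * b * u)).re) (CStarAlgebra.approximateUnit A)
      (𝓝 (ψ b).re) := fun b =>
    (Complex.continuous_re.tendsto _).comp ((ψ.continuous.tendsto _).comp (t2 b))
  have hL : Tendsto (fun u => ‖ψ (u * a) - ψ (u * (h * a))‖ ^ 2) (CStarAlgebra.approximateUnit A)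
      (𝓝 (‖ψ a - ψ (h * a)‖ ^ 2)) :=
    ((((ψ.continuous.tendsto _).comp (t1 a)).sub
      ((ψ.continuous.tendsto _).comp (t1 (h * a)))).norm).pow 2
  have hR : Tendsto (fun u => (1 - (ψ (u * h * u)).re - (ψ (u * h * u)).re
      + (ψ (u * (h * h) * u)).re) * ‖a‖ ^ 2) (CStarAlgebra.approximateUnit A)
      (𝓝 ((1 - (ψ h).re - (ψ h).re + (ψ (h * h)).re) * ‖a‖ ^ 2)) :=
    (((tendsto_const_nhds.sub (hre h)).sub (hre h)).add (hre (h * h))).mul_const _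
  have key := le_of_tendsto_of_tendsto hL hR ?_
  · nlinarith [sq_nonneg ‖a‖]
  · filter_upwards [hl.eventually_norm, hl.eventually_star_eq] with u hu hus
    have hc := st_cs ψ hpos (u - h * u) a
    have hq := st_sq_le ψ hnorm a
    have e1 : star (u - h * u) * a = u * a - u * (h * a) := by
      simp [hus, hsa, sub_mul, mul_assoc]
    have e2 : star (u - h * u) * (u - h * u)
        = u * u - u * h * u - u * h * u + u * (h * h) * u := by
      simp only [star_sub, star_mul, hus, hsa]
      noncomm_ring
    have h0 : 0 ≤ (ψ (star (u - h * u) * (u - h * u))).re :=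
      (Complex.le_def.1 (hpos _ (star_mul_self_nonneg (u - h * u)))).1
    rw [e1, map_sub] at hc
    refine hc.trans (mul_le_mul ?_ hq ?_ ?_)
    · rw [e2]
      have := st_sq_le ψ hnorm u
      rw [hus] at this
      have : ‖u‖ ^ 2 ≤ 1 := pow_le_one₀ (norm_nonneg _) hu
      simp only [map_add, map_sub, Complex.add_re, Complex.sub_re]
      linarith
    · exact (Complex.le_def.1 (hpos _ (star_mul_self_nonneg a))).1
    · rw [e2] at h0
      have := st_sq_le ψ hnorm u
      rw [hus] at this
      have : ‖u‖ ^ 2 ≤ 1 := pow_le_one₀ (norm_nonneg _) hu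
      simp only [map_add, map_sub, Complex.add_re, Complex.sub_re] at h0
      linarith

lemma st_approx (ψ : A →L[ℂ] ℂ) (hpos : ∀ a : A, 0 ≤ a → 0 ≤ ψ a) (hnorm : ‖ψ‖ = 1)
    (ε : ℝ) (hε : 0 < ε) (hε1 : ε < 1) :
    ∃ φ : A →L[ℂ] ℂ, ((∀ a : A, 0 ≤ a → 0 ≤ φ a) ∧ ‖φ‖ = 1 ∧
        ∃ a : A, φ a = (‖a‖ : ℂ) ∧ ‖a‖ ≠ 0) ∧
      ∀ a, ‖φ a - ψ a‖ ≤ ‖a‖ * (ε + 2 * √ε) := by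
  obtain ⟨h, g, hsa, hh1, hg1, hgh, hle, hlt⟩ := st_exists_h ψ hpos hnorm ε hε hε1
  have hss : 0 ≤ ψ (h * h) := by
    have := hpos _ (star_mul_self_nonneg h)
    rwa [hsa] at this
  set s := (ψ (h * h)).re with hs
  have hψs : ψ (h * h) = (s : ℂ) := (Complex.eq_re_of_ofReal_le (r := 0) (by simpa using hss))
  have hs0 : 0 < s := by linarith
  have hs1 : s ≤ 1 := by
    have := st_sq_le ψ hnorm h
    rw [hsa] at this
    exact this.trans (pow_le_one₀ (norm_nonneg _) hh1)
  -- the compression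
  let φ : A →L[ℂ] ℂ := ((s⁻¹ : ℝ) : ℂ) •
    (ψ ∘L ((ContinuousLinearMap.mul ℂ A h) ∘L ((ContinuousLinearMap.mul ℂ A).flip h)))
  have hφ : ∀ a, φ a = ((s⁻¹ : ℝ) : ℂ) * ψ (h * (a * h)) := fun a => rfl
  have hnb : ∀ a, ‖ψ (h * (a * h))‖ ≤ s * ‖a‖ := by
    intro a
    have hc := st_cs ψ hpos h (a * h)
    rw [hsa, ← hs] at hc
    have h1 : star (a * h) * (a * h) ≤ ‖a‖ ^ 2 • (h * h) := by
      have := CStarAlgebra.star_left_conjugate_le_norm_smul (a := h) (b := star a * a)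
        (IsSelfAdjoint.star_mul_self a)
      rw [CStarRing.norm_star_mul_self, ← sq, hsa] at this
      simpa [hsa, mul_assoc] using this
    have h2 := hpos _ (sub_nonneg.2 h1)
    rw [map_sub, ← Complex.coe_smul, map_smul, hψs] at h2
    have h3 := (Complex.le_def.1 h2).1
    rw [Complex.sub_re, smul_eq_mul, ← Complex.ofReal_mul, Complex.ofReal_re,
      Complex.zero_re] at h3
    refine le_of_sq_le_sq_st ?_ (by positivity)
    nlinarith
  have hnle : ∀ a, ‖φ a‖ ≤ 1 * ‖a‖ := by
    intro a
    rw [hφ, norm_mul, Complex.norm_real, Real.norm_eq_abs, abs_of_pos (inv_pos.2 hs0), one_mul,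
      inv_mul_le_iff₀ hs0]
    exact hnb a
  have hle1 : ‖φ‖ ≤ 1 := φ.opNorm_le_bound zero_le_one hnle
  have hφg : φ g = 1 := by
    rw [hφ, hgh, hψs, ← Complex.ofReal_mul, inv_mul_cancel₀ hs0.ne', Complex.ofReal_one]
  have hgn : ‖g‖ = 1 := by
    have := hnle g
    rw [hφg, norm_one, one_mul] at this
    exact le_antisymm hg1 this
  refine ⟨φ, ⟨?_, ?_, g, ?_, ?_⟩, ?_⟩
  · intro a ha
    rw [hφ]
    refine mul_nonneg (by exact_mod_cast (inv_pos.2 hs0).le) (hpos _ ?_)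
    have := star_left_conjugate_nonneg ha h
    rwa [hsa, mul_assoc] at this
  · refine le_antisymm hle1 ?_
    have := φ.le_opNorm g
    rwa [hφg, hgn, norm_one, mul_one] at this
  · rw [hφg, hgn, Complex.ofReal_one]
  · rw [hgn]; exact one_ne_zero
  · intro a
    have hb : ∀ b, ‖ψ b - ψ (h * b)‖ ≤ ‖b‖ * √ε := by
      intro b
      have := st_bound ψ hpos hnorm h hsa hle b
      refine le_of_sq_le_sq_st (this.trans ?_) (by positivity)
      rw [mul_pow, Real.sq_sqrt hε.le]
      gcongr
      linarith
    have hb' : ‖ψ (a) - ψ (a * h)‖ ≤ ‖a‖ * √ε := by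
      have := hb (star a)
      have e : h * star a = star (a * h) := by rw [star_mul, hsa]
      rw [e, st_star ψ hpos, st_star ψ hpos, ← star_sub, norm_star, norm_star] at this
      exact this
    have hah : ‖a * h‖ ≤ ‖a‖ := (norm_mul_le _ _).trans (mul_le_of_le_one_right (norm_nonneg _) hh1)
    have hb2 : ‖ψ (a * h) - ψ (h * (a * h))‖ ≤ ‖a‖ * √ε :=
      (hb (a * h)).trans (by gcongr)
    have e : φ a - ψ a = (1 - s : ℝ) * φ a - (ψ a - ψ (a * h))
        - (ψ (a * h) - ψ (h * (a * h))) := by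
      have : ψ (h * (a * h)) = s * φ a := by
        rw [hφ, ← mul_assoc (s : ℂ), ← Complex.ofReal_mul, mul_inv_cancel₀ hs0.ne']; simp
      rw [this]; push_cast; ring
    have h1 : ‖((1 - s : ℝ) : ℂ) * φ a‖ ≤ ε * ‖a‖ := by
      rw [norm_mul, Complex.norm_real, Real.norm_eq_abs, abs_of_nonneg (by linarith)]
      have := hnle a
      rw [one_mul] at this
      exact mul_le_mul (by linarith) this (norm_nonneg _) hε.le
    rw [e]
    refine (norm_sub_le _ _).trans ?_
    have := norm_sub_le (((1 - s : ℝ) : ℂ) * φ a) (ψ a - ψ (a * h))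
    linarith

end helpers

/-- **Weak-* density of compactly supported states.**  Let `A` be a C*-algebra.  A state
on `A` is a positive linear functional of norm one; it is compactly supported if there
exists `a ∈ A` with `ψ(a) = ‖a‖ ≠ 0`.  For every state `ψ` there is a net (a nontrivial
filter on an index type together with a function into states) of compactly supported
states `ψ_λ` with `ψ_λ(a) → ψ(a)` for all `a ∈ A`. -/
theorem stmt14 {A : Type*} [NonUnitalCStarAlgebra A] [PartialOrder A] [StarOrderedRing A]
    (ψ : A →L[ℂ] ℂ)
    (hpos : ∀ a : A, 0 ≤ a → 0 ≤ ψ a)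
    (hnorm : ‖ψ‖ = 1) :
    ∃ (ι : Type) (p : Filter ι) (_ : p.NeBot) (φ : ι → A →L[ℂ] ℂ),
      (∀ i : ι, (∀ a : A, 0 ≤ a → 0 ≤ φ i a) ∧ ‖φ i‖ = 1 ∧
        ∃ a : A, φ i a = (‖a‖ : ℂ) ∧ ‖a‖ ≠ 0) ∧
      ∀ a : A, Filter.Tendsto (fun i => φ i a) p (nhds (ψ a)) := by
  have hlim : Filter.Tendsto (fun n : ℕ => 1 / ((n : ℝ) + 2)) Filter.atTop (nhds 0) := by
    have := (tendsto_one_div_add_atTop_nhds_zero_nat (𝕜 := ℝ)).comp (Filter.tendsto_add_atTop_nat 1)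
    refine this.congr fun n => ?_
    simp only [Function.comp_apply]
    push_cast
    ring
  choose φ h1 h2 using fun n : ℕ => st_approx ψ hpos hnorm (1 / ((n : ℝ) + 2)) (by positivity)
    (by rw [div_lt_one (by positivity)]; linarith [(Nat.cast_nonneg n : (0 : ℝ) ≤ n)])
  refine ⟨ℕ, Filter.atTop, inferInstance, φ, h1, fun a => ?_⟩
  rw [tendsto_iff_norm_sub_tendsto_zero]
  refine squeeze_zero (fun _ => norm_nonneg _) (fun n => h2 n a) ?_
  have h3 := (Real.continuous_sqrt.tendsto 0).comp hlim
  have := (hlim.add (h3.const_mul 2)).const_mul ‖a‖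
  simpa using this
end

section
/- Let A be a C*-algebra with an irreducible representation π on a Hilbert space H, and let K_A denote the Pedersen ideal of A (the minimal dense two-sided ideal). Then π(K_A)H = H; that is, every vector η ∈ H is of the form π(k)ξ for some k ∈ K_A and ξ ∈ H. -/
open scoped InnerProductSpace ComplexStarModule

lemma aux_nondeg {A H : Type*} [NonUnitalCStarAlgebra A]
    [NormedAddCommGroup H] [InnerProductSpace ℂ H] [CompleteSpace H]
    (π : A →⋆ₙₐ[ℂ] (H →L[ℂ] H))
    (hirr : ∀ U : Submodule ℂ H, IsClosed (U : Set H) →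
      (∀ (a : A) (x : H), x ∈ U → π a x ∈ U) → U = ⊥ ∨ U = ⊤)
    (hπnz : ∃ (a : A) (ξ : H), π a ξ ≠ 0) (x : H) (hx : ∀ a, π a x = 0) : x = 0 := by
  let U : Submodule ℂ H := ⨅ a : A, LinearMap.ker (π a : H →ₗ[ℂ] H)
  have hmem : ∀ z, z ∈ U ↔ ∀ a, π a z = 0 := by intro z; simp [U]
  have hc : IsClosed (U : Set H) := by
    have : (U : Set H) = ⋂ a : A, (π a) ⁻¹' {0} := by
      ext z; simp [hmem z]
    rw [this]
    exact isClosed_iInter fun a => isClosed_singleton.preimage (π a).continuous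
  rcases hirr U hc (fun a z hz => by
    rw [hmem] at hz ⊢
    intro b; rw [hz a, map_zero]) with h | h
  · have : x ∈ U := (hmem x).2 hx
    rw [h] at this; simpa using this
  · obtain ⟨a, ξ, h'⟩ := hπnz
    exact absurd ((hmem ξ).1 (h ▸ Submodule.mem_top) a) h'

lemma aux_inner {A H : Type*} [NonUnitalCStarAlgebra A]
    [NormedAddCommGroup H] [InnerProductSpace ℂ H] [CompleteSpace H]
    (π : A →⋆ₙₐ[ℂ] (H →L[ℂ] H)) (a : A) (x y : H) :
    ⟪π (star a) x, y⟫_ℂ = ⟪x, π a y⟫_ℂ := by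
  rw [map_star, ContinuousLinearMap.star_eq_adjoint, ContinuousLinearMap.adjoint_inner_left]

lemma aux_cyclic {A H : Type*} [NonUnitalCStarAlgebra A]
    [NormedAddCommGroup H] [InnerProductSpace ℂ H] [CompleteSpace H]
    (π : A →⋆ₙₐ[ℂ] (H →L[ℂ] H))
    (hirr : ∀ U : Submodule ℂ H, IsClosed (U : Set H) →
      (∀ (a : A) (x : H), x ∈ U → π a x ∈ U) → U = ⊥ ∨ U = ⊤)
    (hπnz : ∃ (a : A) (ξ : H), π a ξ ≠ 0) (x z : H) (hx : x ≠ 0)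
    (hz : ∀ a, ⟪z, π a x⟫_ℂ = 0) : z = 0 := by
  let U : Submodule ℂ H := ⨅ a : A, (ℂ ∙ (π a x))ᗮ
  have hmem : ∀ z, z ∈ U ↔ ∀ a, ⟪z, π a x⟫_ℂ = 0 := by
    intro z; simp [U, Submodule.mem_orthogonal_singleton_iff_inner_left]
  have hc : IsClosed (U : Set H) := by
    have : (U : Set H) = ⋂ a : A, ((ℂ ∙ (π a x))ᗮ : Submodule ℂ H) := by simp [U]
    rw [this]
    exact isClosed_iInter fun a => Submodule.isClosed_orthogonal _
  rcases hirr U hc (fun a z hz => by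
    rw [hmem] at hz ⊢
    intro b
    have := aux_inner π (star a) z (π b x)
    rw [star_star] at this
    rw [this, ← mul_apply_eq_comp, ← map_mul]
    exact hz _) with h | h
  · have : z ∈ U := (hmem z).2 hz
    rw [h] at this; simpa using this
  · exfalso
    apply hx
    apply aux_nondeg π hirr hπnz
    intro a
    have := (hmem (π a x)).1 (h ▸ Submodule.mem_top) a
    exact inner_self_eq_zero.1 this

lemma aux_schur_sa {A H : Type*} [NonUnitalCStarAlgebra A]
    [NormedAddCommGroup H] [InnerProductSpace ℂ H] [CompleteSpace H]
    (π : A →⋆ₙₐ[ℂ] (H →L[ℂ] H))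
    (hirr : ∀ U : Submodule ℂ H, IsClosed (U : Set H) →
      (∀ (a : A) (x : H), x ∈ U → π a x ∈ U) → U = ⊥ ∨ U = ⊤)
    (T : H →L[ℂ] H) (hT : IsSelfAdjoint T) (hcomm : ∀ a, Commute T (π a)) :
    ∃ r : ℝ, T = algebraMap ℝ (H →L[ℂ] H) r := by
  have key : (spectrum ℝ T).Subsingleton := by
    by_contra hns
    rw [Set.not_subsingleton_iff, Set.nontrivial_iff_exists_lt] at hns
    obtain ⟨l, hl, u, hu, hlu⟩ := hns
    let f : ℝ → ℝ := fun t => max (t - (l+u)/2) 0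
    let g : ℝ → ℝ := fun t => max ((l+u)/2 - t) 0
    have hf : Continuous f := by fun_prop
    have hg : Continuous g := by fun_prop
    have hfg : cfc f T * cfc g T = 0 := by
      rw [← cfc_mul f g T hf.continuousOn hg.continuousOn]
      have : (fun x => f x * g x) = fun _ => 0 := by
        funext t
        rcases le_total t ((l+u)/2) with h | h
        · simp [f, max_eq_right (sub_nonpos.2 h)]
        · simp [g, max_eq_right (sub_nonpos.2 h)]
      rw [this]; simp
    have hfn : cfc f T ≠ 0 := by
      intro h
      have := norm_apply_le_norm_cfc f T hu hf.continuousOn hT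
      rw [h, norm_zero, norm_le_zero_iff] at this
      have h2 : u - (l+u)/2 ≤ f u := le_max_left _ _
      linarith
    have hgn : cfc g T ≠ 0 := by
      intro h
      have := norm_apply_le_norm_cfc g T hl hg.continuousOn hT
      rw [h, norm_zero, norm_le_zero_iff] at this
      have h2 : (l+u)/2 - l ≤ g l := le_max_left _ _
      linarith
    rcases hirr (LinearMap.ker ((cfc f T : H →L[ℂ] H) : H →ₗ[ℂ] H)) (cfc f T).isClosed_ker (by
      intro a x hx
      have h1 : Commute (cfc f T) (π a) := (hcomm a).cfc_real f
      have h2 : cfc f T x = 0 := hx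
      show cfc f T (π a x) = 0
      rw [← mul_apply_eq_comp, h1.eq, mul_apply_eq_comp, h2, map_zero])
      with h | h
    · apply hgn
      ext x
      have : cfc g T x ∈ LinearMap.ker ((cfc f T : H →L[ℂ] H) : H →ₗ[ℂ] H) := by
        show cfc f T (cfc g T x) = 0
        rw [← mul_apply_eq_comp, hfg]; rfl
      rw [h] at this
      simpa using this
    · apply hfn
      ext x
      have : x ∈ LinearMap.ker ((cfc f T : H →L[ℂ] H) : H →ₗ[ℂ] H) := h ▸ Submodule.mem_top
      exact this
  rcases key.eq_empty_or_singleton with h | ⟨r, h⟩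
  · refine ⟨0, ?_⟩
    conv_lhs => rw [← cfc_id ℝ T]
    rw [← cfc_const 0 T]
    exact cfc_congr (by rw [h]; intro x hx; simp at hx)
  · refine ⟨r, ?_⟩
    conv_lhs => rw [← cfc_id ℝ T]
    rw [← cfc_const r T]
    exact cfc_congr (by rw [h]; intro x hx; simpa using hx)

lemma aux_schur {A H : Type*} [NonUnitalCStarAlgebra A]
    [NormedAddCommGroup H] [InnerProductSpace ℂ H] [CompleteSpace H]
    (π : A →⋆ₙₐ[ℂ] (H →L[ℂ] H))
    (hirr : ∀ U : Submodule ℂ H, IsClosed (U : Set H) →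
      (∀ (a : A) (x : H), x ∈ U → π a x ∈ U) → U = ⊥ ∨ U = ⊤)
    (T : H →L[ℂ] H) (hcomm : ∀ a, Commute T (π a)) :
    ∃ r : ℂ, ∀ x, T x = r • x := by
  have hs : ∀ a, Commute (star T) (π a) := by
    intro a
    have := (hcomm (star a)).star_star
    rwa [map_star, star_star] at this
  obtain ⟨r, hr⟩ := aux_schur_sa π hirr (ℜ T : H →L[ℂ] H) (ℜ T).2 (by
    intro a; rw [realPart_apply_coe]; exact ((hcomm a).add_left (hs a)).smul_left _)
  obtain ⟨s, hs⟩ := aux_schur_sa π hirr (ℑ T : H →L[ℂ] H) (ℑ T).2 (by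
    intro a; rw [imaginaryPart_apply_coe]
    exact (((hcomm a).sub_left (hs a)).smul_left _).smul_left _)
  refine ⟨r + Complex.I * s, fun x => ?_⟩
  conv_lhs => rw [← realPart_add_I_smul_imaginaryPart T, hr, hs]
  simp [Algebra.algebraMap_eq_smul_one, add_smul, mul_smul]

lemma aux_pair {A H : Type*} [NonUnitalCStarAlgebra A]
    [NormedAddCommGroup H] [InnerProductSpace ℂ H] [CompleteSpace H]
    (π : A →⋆ₙₐ[ℂ] (H →L[ℂ] H))
    (hirr : ∀ U : Submodule ℂ H, IsClosed (U : Set H) →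
      (∀ (a : A) (x : H), x ∈ U → π a x ∈ U) → U = ⊥ ∨ U = ⊤)
    (hπnz : ∃ (a : A) (ξ : H), π a ξ ≠ 0) (x y p q : H) (hx : x ≠ 0) (hq : q ≠ 0)
    (h : ∀ a, ⟪p, π a x⟫_ℂ + ⟪q, π a y⟫_ℂ = 0) : ∃ c : ℂ, y = c • x := by
  let D : A → (WithLp 2 (H × H)) → (WithLp 2 (H × H)) := fun a z => WithLp.toLp 2 (π a z.fst, π a z.snd)
  let w : (WithLp 2 (H × H)) := WithLp.toLp 2 (x, y)
  let M : Submodule ℂ (WithLp 2 (H × H)) := Submodule.span ℂ (Set.range fun a => D a w)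
  let N : Submodule ℂ (WithLp 2 (H × H)) := Mᗮ
  have hD : ∀ a z z', ⟪D (star a) z, z'⟫_ℂ = ⟪z, D a z'⟫_ℂ := by
    intro a z z'
    simp [D, WithLp.prod_inner_apply, aux_inner]
  have hD' : ∀ a z z', ⟪D a z, z'⟫_ℂ = ⟪z, D (star a) z'⟫_ℂ := by
    intro a z z'
    rw [← hD, star_star]
  have hN : ∀ z, z ∈ N ↔ ∀ a, ⟪z, D a w⟫_ℂ = 0 := by
    intro z
    constructor
    · intro hz a
      exact Submodule.inner_left_of_mem_orthogonal (K := M) (Submodule.subset_span ⟨a, rfl⟩) hz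
    · intro hz
      rw [Submodule.mem_orthogonal']
      intro u hu
      induction hu using Submodule.span_induction with
      | mem u hu => obtain ⟨a, rfl⟩ := hu; exact hz a
      | zero => simp
      | add u v _ _ hu hv => rw [inner_add_right, hu, hv, add_zero]
      | smul c u _ hu => rw [inner_smul_right, hu, mul_zero]
  have hDN : ∀ a z, z ∈ N → D a z ∈ N := by
    intro a z hz
    rw [hN] at hz ⊢
    intro b
    rw [hD']
    have := hz (star a * b)
    simpa [D] using this
  have hDN' : ∀ a z, z ∈ Nᗮ → D a z ∈ Nᗮ := by
    intro a z hz
    rw [Submodule.mem_orthogonal'] at hz ⊢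
    intro u hu
    rw [hD']
    exact hz _ (hDN _ _ hu)
  have hDsub : ∀ a z z', D a (z - z') = D a z - D a z' := by
    intro a z z'
    simp only [D]
    rw [← WithLp.toLp_sub]; simp; rfl
  have hP : ∀ a z, N.starProjection (D a z) = D a (N.starProjection z) := by
    intro a z
    refine (Submodule.eq_starProjection_of_mem_orthogonal (hDN _ _ (N.starProjection_apply_mem z)) ?_)
    rw [← hDsub]
    exact hDN' _ _ (N.sub_starProjection_mem_orthogonal z)
  let i1 : H →L[ℂ] (WithLp 2 (H × H)) := (WithLp.prodContinuousLinearEquiv 2 ℂ H H).symm.toContinuousLinearMap ∘L ContinuousLinearMap.inl ℂ H H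
  let i2 : H →L[ℂ] (WithLp 2 (H × H)) := (WithLp.prodContinuousLinearEquiv 2 ℂ H H).symm.toContinuousLinearMap ∘L ContinuousLinearMap.inr ℂ H H
  let p2 : (WithLp 2 (H × H)) →L[ℂ] H := ContinuousLinearMap.snd ℂ H H ∘L (WithLp.prodContinuousLinearEquiv 2 ℂ H H).toContinuousLinearMap
  have e1 : ∀ a z, i1 (π a z) = D a (i1 z) := by intro a z; simp [i1, D]
  have e2 : ∀ a z, i2 (π a z) = D a (i2 z) := by intro a z; simp [i2, D]
  have e3 : ∀ a z, p2 (D a z) = π a (p2 z) := by intro a z; simp [p2, D]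
  have e4 : ∀ u v, WithLp.toLp 2 (u, v) = i1 u + i2 v := by
    intro u v; simp only [i1, i2]; simp [← WithLp.toLp_add]
  obtain ⟨r, hr⟩ := aux_schur π hirr (p2 ∘L N.starProjection ∘L i1) (by
    intro a; ext z; simp [e1, hP, e3])
  obtain ⟨s, hs⟩ := aux_schur π hirr (p2 ∘L N.starProjection ∘L i2) (by
    intro a; ext z; simp [e2, hP, e3])
  have hPuv : ∀ u v, p2 (N.starProjection (WithLp.toLp 2 (u, v))) = r • u + s • v := by
    intro u v
    rw [e4, map_add, map_add, ← hr, ← hs]; rfl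
  have h1 : r • x + s • y = 0 := by
    rw [← hPuv]
    apply aux_nondeg π hirr hπnz
    intro a
    rw [← e3, ← hP]
    have : N.starProjection (D a w) = 0 := by
      rw [Submodule.starProjection_apply_eq_zero_iff]
      exact Submodule.le_orthogonal_orthogonal _ (Submodule.subset_span ⟨a, rfl⟩)
    rw [this, map_zero]
  have h2 : r • p + s • q = q := by
    rw [← hPuv, (Submodule.starProjection_eq_self_iff).2]
    · simp [p2]
    · rw [hN]; intro a
      simpa [D, w, WithLp.prod_inner_apply] using h a
  by_cases hs0 : s = 0
  · subst hs0
    simp only [zero_smul, add_zero] at h1 h2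
    rcases smul_eq_zero.1 h1 with h0 | h0
    · exact absurd (by rw [← h2, h0, zero_smul]) hq
    · exact absurd h0 hx
  · refine ⟨-(s⁻¹ * r), ?_⟩
    have : s • y = -(r • x) := by rw [eq_neg_iff_add_eq_zero, add_comm]; exact h1
    rw [neg_smul, mul_smul, ← smul_neg, ← this, smul_smul, inv_mul_cancel₀ hs0, one_smul]

lemma aux_approx {A H : Type*} [NonUnitalCStarAlgebra A]
    [NormedAddCommGroup H] [InnerProductSpace ℂ H] [CompleteSpace H]
    (π : A →⋆ₙₐ[ℂ] (H →L[ℂ] H))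
    (hirr : ∀ U : Submodule ℂ H, IsClosed (U : Set H) →
      (∀ (a : A) (x : H), x ∈ U → π a x ∈ U) → U = ⊥ ∨ U = ⊤)
    (hπnz : ∃ (a : A) (ξ : H), π a ξ ≠ 0) (x η : H) (hx : ‖x‖ = 1) (hη : ‖η‖ = 1)
    (ε : ℝ) (hε : 0 < ε) :
    ∃ a : A, ‖π a x - η‖ < ε ∧ ‖π (star a) η - x‖ < ε := by
  let R : Set (H × H) := Set.range fun a : A => (π a x, π (star a) η)
  suffices hmem : (η, x) ∈ closure R by
    obtain ⟨_, ⟨a, rfl⟩, ha⟩ := Metric.mem_closure_iff.1 hmem ε hε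
    rw [dist_comm, Prod.dist_eq, max_lt_iff, dist_eq_norm, dist_eq_norm] at ha
    exact ⟨a, ha⟩
  by_contra hnot
  have hsm : ∀ (t : ℝ) (a : A), (π ((t : ℂ) • a) x, π (star ((t : ℂ) • a)) η)
      = t • ((π a x, π (star a) η) : H × H) := by
    intro t a
    simp only [star_smul, map_smul, RCLike.star_def, Complex.conj_ofReal, Prod.smul_mk]
    rfl
  have hconv : Convex ℝ R := by
    rintro _ ⟨a, rfl⟩ _ ⟨b, rfl⟩ s t - - -
    refine ⟨(s : ℂ) • a + (t : ℂ) • b, ?_⟩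
    simp only
    rw [← hsm, ← hsm, Prod.mk_add_mk, star_add, map_add, map_add]
    rfl
  obtain ⟨f, u, hu, hf⟩ := RCLike.geometric_hahn_banach_point_closed (𝕜 := ℂ) hconv.closure
    isClosed_closure hnot
  have hf0 : ∀ a : A, (f (π a x, π (star a) η)).re = 0 := by
    intro a
    by_contra hc
    have := hf (π (((u / (f (π a x, π (star a) η)).re : ℝ) : ℂ) • a) x, _) (subset_closure ⟨_, rfl⟩)
    rw [hsm, ← Complex.coe_smul, map_smul] at this
    simp only [smul_eq_mul, RCLike.re_to_complex, Complex.re_ofReal_mul] at this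
    rw [div_mul_cancel₀ _ hc] at this
    exact lt_irrefl _ this
  have hu0 : (f (η, x)).re < 0 := by
    refine lt_trans hu ?_
    have := hf (π 0 x, _) (subset_closure ⟨0, rfl⟩)
    simpa [Prod.mk_zero_zero] using this
  let f1 : StrongDual ℂ H := f ∘L ContinuousLinearMap.inl ℂ H H
  let f2 : StrongDual ℂ H := f ∘L ContinuousLinearMap.inr ℂ H H
  let z1 := (InnerProductSpace.toDual ℂ H).symm f1
  let z2 := (InnerProductSpace.toDual ℂ H).symm f2
  have hfz : ∀ p q, f (p, q) = ⟪z1, p⟫_ℂ + ⟪z2, q⟫_ℂ := by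
    intro p q
    simp only [z1, z2, InnerProductSpace.toDual_symm_apply, f1, f2]
    simp [← map_add]
  have hre : ∀ a : A, (⟪z1, π a x⟫_ℂ + ⟪η, π a z2⟫_ℂ).re = 0 := by
    intro a
    have := hf0 a
    rw [hfz, Complex.add_re] at this
    rw [Complex.add_re, ← aux_inner π a η, ← inner_conj_symm (π (star a) η), Complex.conj_re]
    exact this
  have hF : ∀ a : A, ⟪z1, π a x⟫_ℂ + ⟪η, π a z2⟫_ℂ = 0 := by
    intro a
    apply Complex.ext (hre a)
    have := hre (Complex.I • a)
    simp only [map_smul, smul_apply, inner_smul_right, ← mul_add] at this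
    simp only [Complex.mul_re, Complex.I_re, Complex.I_im, zero_mul, one_mul, zero_sub, neg_eq_zero] at this
    exact this
  have hx0 : x ≠ 0 := by rintro rfl; simp at hx
  have hη0 : η ≠ 0 := by rintro rfl; simp at hη
  obtain ⟨c, hc⟩ := aux_pair π hirr hπnz x z2 z1 η hx0 hη0 hF
  have hz1 : z1 + (starRingEnd ℂ c) • η = 0 := by
    apply aux_cyclic π hirr hπnz x _ hx0
    intro a
    have := hF a
    rw [hc, map_smul, inner_smul_right] at this
    rw [inner_add_left, inner_smul_left, Complex.conj_conj]
    exact this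
  rw [hfz, eq_neg_of_add_eq_zero_left hz1, hc, inner_neg_left, inner_smul_left, inner_smul_left,
    inner_self_eq_norm_sq_to_K, inner_self_eq_norm_sq_to_K, hx, hη] at hu0
  simp at hu0

lemma aux_cut {A : Type*} [NonUnitalCStarAlgebra A] (a : A) :
    ∃ b : A, ‖b‖ ≤ 2 ∧ b + b * (star a * a) = a ∧ star (b * star a) = b * star a := by
  let := CStarAlgebra.spectralOrder A
  have := CStarAlgebra.spectralOrderedRing A
  set q := star a * a with hq
  have hq0 : 0 ≤ q := star_mul_self_nonneg a
  have hqsa : IsSelfAdjoint q := IsSelfAdjoint.star_mul_self a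
  let h : ℝ → ℝ := fun t => t / (1 + t)
  have hσ : ∀ t ∈ quasispectrum ℝ q, 0 ≤ t := fun t ht => quasispectrum_nonneg_of_nonneg q hq0 t ht
  have hcont : ContinuousOn h (quasispectrum ℝ q) := by
    apply ContinuousOn.div (by fun_prop) (by fun_prop)
    intro t ht; have := hσ t ht; positivity
  set c := cfcₙ h q with hc
  have hcsa : star c = c := (cfcₙ_predicate h q : IsSelfAdjoint c)
  have hcn : ‖c‖ ≤ 1 := by
    apply norm_cfcₙ_le
    intro t ht
    have := hσ t ht
    rw [Real.norm_of_nonneg (by positivity), div_le_one (by positivity)]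
    linarith
  have hcq : c + c * q = q := by
    have h1 : c * q = cfcₙ (fun t => h t * t) q := by
      rw [cfcₙ_mul h (fun t => t) q hcont (by simp [h]) (by fun_prop) rfl, cfcₙ_id' ℝ q]
    rw [h1, hc, ← cfcₙ_add h (fun t => h t * t) q hcont (by simp [h]) (hcont.mul (by fun_prop)) (by simp)]
    conv_rhs => rw [← cfcₙ_id' ℝ q]
    apply cfcₙ_congr
    intro t ht
    have := hσ t ht
    simp only [h]
    field_simp
  have hqc : c + q * c = q := by
    have := congrArg star hcq
    rwa [star_add, star_mul, hcsa, hqsa.star_eq] at this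
  refine ⟨a - a * c, ?_, ?_, ?_⟩
  · have e : star (a - a * c) * (a - a * c) = c - c * c := by
      have e1 : star (a - a * c) * (a - a * c) = (q - q * c) - c * (q - q * c) := by
        rw [star_sub, star_mul, hcsa, hq]; noncomm_ring
      rw [e1, show q - q * c = c by rw [sub_eq_iff_eq_add]; exact hqc.symm]
    have e2 : ‖a - a * c‖ * ‖a - a * c‖ ≤ 2 := by
      rw [← CStarRing.norm_star_mul_self, e]
      calc _ ≤ ‖c‖ + ‖c * c‖ := norm_sub_le _ _
        _ ≤ ‖c‖ + ‖c‖ * ‖c‖ := by gcongr; exact norm_mul_le _ _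
        _ ≤ 1 + 1 * 1 := by gcongr
        _ = 2 := by norm_num
    nlinarith [norm_nonneg (a - a * c)]
  · have : a - a * c + (a - a * c) * q = a - a * (c + c * q) + a * q := by noncomm_ring
    rw [this, hcq]; simp
  · simp only [star_mul, star_sub, star_star, hcsa]; noncomm_ring

lemma aux_bdd {A H : Type*} [NonUnitalCStarAlgebra A]
    [NormedAddCommGroup H] [InnerProductSpace ℂ H] [CompleteSpace H]
    (π : A →⋆ₙₐ[ℂ] (H →L[ℂ] H))
    (hirr : ∀ U : Submodule ℂ H, IsClosed (U : Set H) →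
      (∀ (a : A) (x : H), x ∈ U → π a x ∈ U) → U = ⊥ ∨ U = ⊤)
    (hπnz : ∃ (a : A) (ξ : H), π a ξ ≠ 0) (x η : H) (hx : ‖x‖ = 1) (hη : ‖η‖ = 1) :
    ∃ b : A, ‖b‖ ≤ 4 ∧ ‖η - π b x‖ ≤ 1 / 2 := by
  obtain ⟨a, ha1, ha2⟩ := aux_approx π hirr hπnz x η hx hη (1/8) (by norm_num)
  obtain ⟨b, hb, hba, hsa⟩ := aux_cut a
  set e1 := π a x - η with he1
  set e2 := π (star a) η - x with he2
  have hB : ∀ z, ‖π b z‖ ≤ 2 * ‖z‖ := fun z =>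
    (π b).le_of_opNorm_le ((NonUnitalStarAlgHom.norm_apply_le π b).trans hb) z
  have hBT : ‖π b (π (star a) e1)‖ ≤ ‖e1‖ := by
    set y := π (star b) e1 with hy
    have h1 : π b (π (star a) e1) = π a y := by
      rw [hy, ← mul_apply_eq_comp, ← mul_apply_eq_comp, ← map_mul, ← map_mul, ← hsa]
      simp
    have h2 : y + π (star a) (π a y) = π (star a) e1 := by
      have h3 : star b + star a * a * star b = star a := by
        have := congrArg star hba
        simpa [mul_assoc] using this
      conv_rhs => rw [← h3]
      simp [hy]
    have h4 : ⟪y, y⟫_ℂ + ⟪π a y, π a y⟫_ℂ = ⟪e1, π a y⟫_ℂ := by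
      rw [← aux_inner π a e1, ← h2, inner_add_left, aux_inner π a (π a y)]
    have h5 := congrArg Complex.re h4
    rw [Complex.add_re] at h5
    have h7 : (⟪y, y⟫_ℂ).re = ‖y‖ ^ 2 := inner_self_eq_norm_sq (𝕜 := ℂ) y
    have h8 : (⟪π a y, π a y⟫_ℂ).re = ‖π a y‖ ^ 2 := inner_self_eq_norm_sq (𝕜 := ℂ) _
    rw [h7, h8] at h5
    have h6 : (⟪e1, π a y⟫_ℂ).re ≤ ‖e1‖ * ‖π a y‖ := re_inner_le_norm (𝕜 := ℂ) _ _
    rw [h1]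
    by_contra hlt
    push Not at hlt
    nlinarith [norm_nonneg e1, sq_nonneg ‖y‖]
  have hmain : η - π ((2:ℂ) • b) x = π b e2 + π b (π (star a) e1) - e1 := by
    have h1 : π b x + π b (π (star a) (π a x)) = π a x := by
      conv_rhs => rw [← hba]
      simp
    have h2 : π a x = η + e1 := by rw [he1]; abel
    have h3 : π (star a) η = x + e2 := by rw [he2]; abel
    rw [h2, map_add, h3, map_add, map_add] at h1
    have h4 : η = π b x + (π b x + π b e2 + π b (π (star a) e1)) - e1 := by rw [h1]; abel
    conv_lhs => rw [h4]
    rw [map_smul, smul_apply, two_smul]; abel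
  refine ⟨(2:ℂ) • b, ?_, ?_⟩
  · rw [norm_smul]; norm_num; linarith
  · rw [hmain]
    calc _ ≤ ‖π b e2‖ + ‖π b (π (star a) e1)‖ + ‖e1‖ :=
          (norm_sub_le _ _).trans (by gcongr; exact norm_add_le _ _)
      _ ≤ 1/2 := by linarith [hB e2]

lemma aux_trans {A H : Type*} [NonUnitalCStarAlgebra A]
    [NormedAddCommGroup H] [InnerProductSpace ℂ H] [CompleteSpace H]
    (π : A →⋆ₙₐ[ℂ] (H →L[ℂ] H))
    (hirr : ∀ U : Submodule ℂ H, IsClosed (U : Set H) →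
      (∀ (a : A) (x : H), x ∈ U → π a x ∈ U) → U = ⊥ ∨ U = ⊤)
    (hπnz : ∃ (a : A) (ξ : H), π a ξ ≠ 0) (x η : H) (hx : ‖x‖ = 1) :
    ∃ b : A, π b x = η := by
  have step : ∀ z : H, ∃ b : A, ‖b‖ ≤ 4 * ‖z‖ ∧ ‖z - π b x‖ ≤ 1 / 2 * ‖z‖ := by
    intro z
    by_cases hz : z = 0
    · exact ⟨0, by simp [hz]⟩
    have hz' : ‖z‖ ≠ 0 := norm_ne_zero_iff.2 hz
    have hzc : (‖z‖ : ℂ) ≠ 0 := by exact_mod_cast hz'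
    obtain ⟨b, h1, h2⟩ := aux_bdd π hirr hπnz x ((‖z‖ : ℂ)⁻¹ • z) hx (by
      rw [norm_smul, norm_inv, Complex.norm_real, norm_norm, inv_mul_cancel₀ hz'])
    refine ⟨(‖z‖ : ℂ) • b, ?_, ?_⟩
    · rw [norm_smul, Complex.norm_real, norm_norm, mul_comm]; gcongr
    · have : z - π ((‖z‖ : ℂ) • b) x = (‖z‖ : ℂ) • ((‖z‖ : ℂ)⁻¹ • z - π b x) := by
        rw [smul_sub, smul_smul, mul_inv_cancel₀ hzc, one_smul, map_smul]; rfl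
      rw [this, norm_smul, Complex.norm_real, norm_norm, mul_comm]; gcongr
  choose g hg1 hg2 using step
  let r : ℕ → H := fun n => Nat.rec η (fun _ z => z - π (g z) x) n
  have hr0 : r 0 = η := rfl
  have hrs : ∀ n, r (n+1) = r n - π (g (r n)) x := fun n => rfl
  have hrn : ∀ n, ‖r n‖ ≤ (1/2)^n * ‖η‖ := by
    intro n
    induction n with
    | zero => simp [hr0]
    | succ n ih =>
      rw [hrs, pow_succ']
      calc _ ≤ 1/2 * ‖r n‖ := hg2 _
        _ ≤ 1/2 * ((1/2)^n * ‖η‖) := by gcongr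
        _ = _ := by ring
  have hgeo : Summable fun n : ℕ => ((1/2 : ℝ))^n * ‖η‖ :=
    (summable_geometric_of_lt_one (by norm_num) (by norm_num)).mul_right _
  have hsum : Summable fun n => g (r n) := by
    apply Summable.of_norm_bounded (hgeo.mul_left 4)
    intro n
    exact (hg1 _).trans (by gcongr; exact hrn n)
  have hcont : Continuous fun b : A => π b x := by
    have : Continuous π := AddMonoidHomClass.continuous_of_bound π 1 (by simpa only [one_mul] using NonUnitalStarAlgHom.norm_apply_le π)
    exact this.clm_apply continuous_const
  refine ⟨∑' n, g (r n), ?_⟩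
  have ht1 := (hcont.tendsto _).comp hsum.hasSum.tendsto_sum_nat
  have hpart : ∀ n, π (∑ i ∈ Finset.range n, g (r i)) x = η - r n := by
    intro n
    induction n with
    | zero => simp [hr0]
    | succ n ih =>
      rw [Finset.sum_range_succ, map_add, add_apply, ih, hrs]; abel
  have ht2 : Filter.Tendsto r Filter.atTop (nhds 0) :=
    squeeze_zero_norm hrn hgeo.tendsto_atTop_zero
  have ht3 : Filter.Tendsto (fun n => η - r n) Filter.atTop (nhds (η - 0)) :=
    tendsto_const_nhds.sub ht2
  rw [sub_zero] at ht3
  refine tendsto_nhds_unique ht1 (ht3.congr fun n => ?_)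
  exact (hpart n).symm


/-- **The Pedersen ideal acts transitively in irreducible representations.**  Let `A` be a
C*-algebra with an irreducible representation `π` on a Hilbert space `H` (every closed
`π`-invariant subspace is `⊥` or `⊤`, and `π` is not the zero representation), and let
`K` be the Pedersen ideal of `A`: the minimal dense two-sided ideal (a two-sided ideal
which is dense and contained in every dense two-sided ideal).  Then `π(K)H = H`: every
`η ∈ H` is of the form `π(k)ξ` for some `k ∈ K` and `ξ ∈ H`. -/
theorem stmt15 {A H : Type*} [NonUnitalCStarAlgebra A]
    [NormedAddCommGroup H] [InnerProductSpace ℂ H] [CompleteSpace H]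
    (π : A →⋆ₙₐ[ℂ] (H →L[ℂ] H))
    (hirr : ∀ U : Submodule ℂ H, IsClosed (U : Set H) →
      (∀ (a : A) (x : H), x ∈ U → π a x ∈ U) → U = ⊥ ∨ U = ⊤)
    (hπnz : ∃ (a : A) (ξ : H), π a ξ ≠ 0)
    (K : TwoSidedIdeal A)
    (hKdense : Dense (K : Set A))
    (hKmin : ∀ J : TwoSidedIdeal A, Dense (J : Set A) → K ≤ J) :
    ∀ η : H, ∃ k ∈ K, ∃ ξ : H, π k ξ = η := by
  intro η
  have hcont : Continuous π := AddMonoidHomClass.continuous_of_bound π 1 (by simpa only [one_mul] using NonUnitalStarAlgHom.norm_apply_le π)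
  obtain ⟨a, haK, ξ, hξ⟩ : ∃ a ∈ K, ∃ ξ, π a ξ ≠ 0 := by
    by_contra hno
    push Not at hno
    obtain ⟨a, ξ, h⟩ := hπnz
    apply h
    have hc : Continuous fun b : A => π b ξ := hcont.clm_apply continuous_const
    have := hc.ext_on hKdense (continuous_const (y := (0 : H))) (fun b hb => hno b hb ξ)
    exact congrFun this a
  have hn : ‖π a ξ‖ ≠ 0 := norm_ne_zero_iff.2 hξ
  obtain ⟨b, hb⟩ := aux_trans π hirr hπnz (π a ((‖π a ξ‖ : ℂ)⁻¹ • ξ)) η (by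
    rw [map_smul, norm_smul, norm_inv, Complex.norm_real, norm_norm, inv_mul_cancel₀ hn])
  refine ⟨b * a, K.mul_mem_left b a haK, (‖π a ξ‖ : ℂ)⁻¹ • ξ, ?_⟩
  rw [map_mul, mul_apply_eq_comp]
  exact hb
end

section
/- Let D₀ be a self-adjoint operator on a Hilbert space H and S a bounded operator with S(dom D₀) ⊆ dom D₀ such that [D₀, S]⟨D₀⟩^{-α} extends to a bounded operator for some 0 ≤ α < 1, where ⟨D₀⟩ = (1+D₀²)^{1/2}. Then for every β < 1 - α, the operator [F_{D₀}, S]⟨D₀⟩^β is bounded, where F_{D₀} = D₀⟨D₀⟩⁻¹. -/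
theorem stmt16_ring {R : Type*} [Ring R] (F Q S T J : R) (hFQ : F * Q = Q * F)
    (hpyth : F * F + Q * Q = 1) (hT : S * Q = Q * T) (hcanc : ∀ a b : R, Q * a = Q * b → a = b)
    (hJ1 : J * (1 + Q) = 1) (hJ2 : (1 + Q) * J = 1) (hFJ : F * J = J * F) :
    (S - T) + (F * J) * (S - T) * (F * J) =
      - ((F * J) * (F * T - S * F) + (F * T - S * F) * (F * J)) := by
  set X := S - T with hX
  set K := F * T - S * F with hK
  have hFF : F * F = 1 - Q * Q := eq_sub_of_add_eq hpyth
  have hQX : Q * X = Q * S - S * Q := by rw [hX, mul_sub, hT]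
  have hQK : Q * K = F * S * Q - Q * S * F := by
    rw [hK, mul_sub, ← mul_assoc, ← hFQ, mul_assoc, ← hT]; noncomm_ring
  have h1 : Q * X + X * Q = -(F * K * Q + Q * K * F) := by
    apply hcanc
    have e1 : Q * (Q * X + X * Q) = Q * (Q * X) + (Q * X) * Q := by noncomm_ring
    have e2 : Q * (-(F * K * Q + Q * K * F)) = -(F * (Q * K) * Q + Q * (Q * K) * F) := by
      have : Q * (-(F * K * Q + Q * K * F)) = -((Q * F) * K * Q + Q * (Q * K) * F) := by
        noncomm_ring
      rw [this, ← hFQ]; noncomm_ring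
    rw [e1, e2, hQX, hQK]
    have e3 : F * (F * S * Q - Q * S * F) * Q + Q * (F * S * Q - Q * S * F) * F
        = (F * F) * S * (Q * Q) - (F * Q) * S * (F * Q) + (Q * F) * S * (Q * F)
          - Q * Q * S * (F * F) := by noncomm_ring
    rw [e3, hFQ, hFF]; noncomm_ring
  have ht1 : (1 + Q) * (F * J) = F := by rw [hFJ, ← mul_assoc, hJ2, one_mul]
  have ht2 : (F * J) * (1 + Q) = F := by rw [mul_assoc, hJ1, mul_one]
  set t := F * J with ht
  have hkey : (1 + Q) * (X + t * X * t + (t * K + K * t)) * (1 + Q) = 0 := by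
    have e : (1 + Q) * (X + t * X * t + (t * K + K * t)) * (1 + Q)
      = (1 + Q) * X * (1 + Q) + ((1 + Q) * t) * X * (t * (1 + Q))
        + (((1 + Q) * t) * K * (1 + Q) + (1 + Q) * K * (t * (1 + Q))) := by noncomm_ring
    rw [e, ht1, ht2]
    -- base relation
    have hb : X + Q * X * Q + F * X * F = -(F * K + K * F) := by
      apply hcanc
      have e1 : Q * (X + Q * X * Q + F * X * F)
          = Q * X + Q * (Q * X) * Q + (Q * F) * X * F := by noncomm_ring
      have e2 : Q * (-(F * K + K * F)) = -((Q * F) * K + (Q * K) * F) := by noncomm_ring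
      rw [e1, e2, ← hFQ, mul_assoc F Q X, mul_assoc F Q K, hQX, hQK]
      have e3 : F * (F * S * Q - Q * S * F) + (F * S * Q - Q * S * F) * F
         = (F * F) * S * Q - F * Q * S * F + F * S * (Q * F) - Q * S * (F * F) := by noncomm_ring
      rw [e3, ← hFQ, hFF]
      have e4 : F * (Q * S - S * Q) * F = F * Q * S * F - F * S * (Q * F) := by noncomm_ring
      rw [e4, ← hFQ]
      noncomm_ring
    have e5 : (1 + Q) * X * (1 + Q) + F * X * F + (F * K * (1 + Q) + (1 + Q) * K * F)
      = (X + Q * X * Q + F * X * F) + (Q * X + X * Q)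
        + (F * K + K * F) + (F * K * Q + Q * K * F) := by noncomm_ring
    rw [e5, hb, h1]; abel
  have h0 : X + t * X * t + (t * K + K * t) = 0 := by
    have : J * ((1 + Q) * (X + t * X * t + (t * K + K * t)) * (1 + Q)) * J = 0 := by
      rw [hkey]; simp
    have e : J * ((1 + Q) * (X + t * X * t + (t * K + K * t)) * (1 + Q)) * J
      = (J * (1 + Q)) * (X + t * X * t + (t * K + K * t)) * ((1 + Q) * J) := by
        simp only [mul_assoc]
    rwa [e, hJ1, hJ2, one_mul, mul_one] at this
  exact eq_neg_of_add_eq_zero_left h0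

theorem stmt16_iter {R : Type*} [Ring R] (X K t : R)
    (h : X + t * X * t = - (t * K + K * t)) (N : ℕ) :
    X + K * t = ∑ m ∈ Finset.range N, (t * t) ^ m *
        (t * t * K * (1 - t * t) * t - t * K * (1 - t * t)) * (t * t) ^ m
      + (t * t) ^ N * (X + K * t) * (t * t) ^ N := by
  have h2 : (X + K * t) + t * (X + K * t) * t = - (t * K * (1 - t * t)) := by
    have e : (X + K * t) + t * (X + K * t) * t = (X + t * X * t) + (K * t + t * K * t * t) := by
      noncomm_ring
    rw [e, h]; noncomm_ring
  set P := X + K * t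
  have h3 : P = (t * t * K * (1 - t * t) * t - t * K * (1 - t * t)) + (t * t) * P * (t * t) := by
    have e : t * t * P * (t * t) = t * (P + t * P * t) * t - (P + t * P * t) + P := by noncomm_ring
    rw [e, h2]; noncomm_ring
  induction N with
  | zero => simp
  | succ n ih =>
    rw [Finset.sum_range_succ, add_assoc]
    conv_lhs => rw [ih]
    congr 1
    conv_lhs => rw [h3]
    have e : (t * t) ^ (n + 1) * P * (t * t) ^ (n + 1)
        = (t * t) ^ n * (t * t * P * (t * t)) * (t * t) ^ n := by
      nth_rewrite 2 [pow_succ']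
      rw [pow_succ]
      simp only [mul_assoc]
    rw [e, mul_add, add_mul]

theorem stmt16_scalar (q : ℝ) (h0 : 0 ≤ q) (h1 : q ≤ 1) (p : ℝ) (hp0 : 0 ≤ p) (hp : p ≤ 2) (m : ℕ) :
    q ^ p * ((1 - q) / (1 + q)) ^ m ≤ 1 / ((m : ℝ) + 1) ^ p := by
  have hmq : 1 ≤ 1 + m * q := by nlinarith [mul_nonneg (Nat.cast_nonneg (α := ℝ) m) h0]
  have hb : 1 + m * q ≤ (1 + q) ^ m := one_add_mul_le_pow (by linarith) m
  have ha : (1 - q) / (1 + q) ≤ 1 / ((1 + q) ^ 2) := by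
    rw [div_le_div_iff₀ (by linarith) (by positivity)]
    nlinarith [mul_nonneg h0 h0, mul_nonneg h0 (mul_nonneg h0 h0)]
  have hc : ((1 - q) / (1 + q)) ^ m ≤ 1 / (1 + m * q) ^ p := by
    calc ((1 - q) / (1 + q)) ^ m ≤ (1 / ((1 + q) ^ 2)) ^ m :=
          pow_le_pow_left₀ (div_nonneg (by linarith) (by linarith)) ha m
      _ = 1 / ((1 + q) ^ m) ^ 2 := by rw [div_pow, one_pow, ← pow_mul, ← pow_mul, mul_comm]
      _ ≤ 1 / (1 + m * q) ^ 2 := by gcongr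
      _ ≤ 1 / (1 + m * q) ^ p := by
          apply one_div_le_one_div_of_le (Real.rpow_pos_of_pos (by linarith) _)
          rw [← Real.rpow_natCast]
          exact Real.rpow_le_rpow_of_exponent_le hmq (by exact_mod_cast hp)
  calc q ^ p * ((1 - q) / (1 + q)) ^ m ≤ q ^ p * (1 / (1 + m * q) ^ p) := by gcongr
    _ = (q / (1 + m * q)) ^ p := by rw [Real.div_rpow h0 (by linarith)]; ring
    _ ≤ (1 / ((m : ℝ) + 1)) ^ p := by
        apply Real.rpow_le_rpow (by positivity) _ hp0
        rw [div_le_div_iff₀ (by linarith) (by positivity)]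
        nlinarith
    _ = _ := by rw [Real.div_rpow (by norm_num) (by positivity), Real.one_rpow]

theorem stmt16_T {H : Type*} [NormedAddCommGroup H] [InnerProductSpace ℂ H] [CompleteSpace H]
    (Q S : H →L[ℂ] H) (hQinj : Function.Injective Q)
    (hSdom : ∀ ξ : H, ∃ η : H, S (Q ξ) = Q η) : ∃ T : H →L[ℂ] H, S * Q = Q * T := by
  choose f hf using hSdom
  let g : H →ₗ[ℂ] H :=
    { toFun := f
      map_add' := fun x y => hQinj (by rw [← hf, map_add, map_add, map_add, hf, hf])
      map_smul' := fun c x => hQinj (by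
        rw [← hf, map_smul, map_smul, RingHom.id_apply, map_smul, hf]) }
  refine ⟨ContinuousLinearMap.ofSeqClosedGraph (g := g) ?_, ?_⟩
  · intro u x y hu hy
    apply hQinj
    have h1 : Filter.Tendsto (fun n => Q (g (u n))) Filter.atTop (nhds (Q y)) :=
      (Q.continuous.tendsto y).comp hy
    have h2 : Filter.Tendsto (fun n => Q (g (u n))) Filter.atTop (nhds (S (Q x))) := by
      have : (fun n => Q (g (u n))) = fun n => S (Q (u n)) := by
        ext n; exact (hf (u n)).symm
      rw [this]
      exact ((S.continuous.comp Q.continuous).tendsto x).comp hu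
    rw [tendsto_nhds_unique h1 h2]
    exact hf x
  · ext x
    exact hf x

theorem stmt16_dense {H : Type*} [NormedAddCommGroup H] [InnerProductSpace ℂ H] [CompleteSpace H]
    (Q : H →L[ℂ] H) (hQ : IsSelfAdjoint Q) (hQinj : Function.Injective Q) : DenseRange Q := by
  have h : Q.rangeᗮ = ⊥ := by
    rw [ContinuousLinearMap.orthogonal_range, hQ.adjoint_eq]
    exact LinearMap.ker_eq_bot.mpr hQinj
  have := (Submodule.topologicalClosure_eq_top_iff (K := Q.range)).mpr h
  have h2 := (Submodule.dense_iff_topologicalClosure_eq_top (s := Q.range)).mpr this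
  exact h2

theorem stmt16_spec {H : Type*} [NormedAddCommGroup H] [InnerProductSpace ℂ H] [CompleteSpace H]
    (F Q : H →L[ℂ] H) (hQpos : Q.IsPositive) (hF : IsSelfAdjoint F)
    (hpyth : F * F + Q * Q = 1) : ∀ q ∈ spectrum ℝ Q, 0 ≤ q ∧ q ≤ 1 := by
  have hQ0 : 0 ≤ Q := (ContinuousLinearMap.nonneg_iff_isPositive Q).mpr hQpos
  have hQsa : IsSelfAdjoint Q := hQpos.isSelfAdjoint
  intro q hq
  refine ⟨spectrum_nonneg_of_nonneg hQ0 hq, ?_⟩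
  have hn : ‖Q‖ ≤ 1 := by
    refine ContinuousLinearMap.opNorm_le_bound _ zero_le_one fun z => ?_
    have h1 : inner ℂ (F (F z) + Q (Q z)) z = inner ℂ z z := by
      have : F (F z) + Q (Q z) = z := by
        have := congrArg (fun A : H →L[ℂ] H => A z) hpyth
        simpa using this
      rw [this]
    have hs1 : inner ℂ (F (F z)) z = inner ℂ (F z) (F z) := hF.isSymmetric (F z) z
    have hs2 : inner ℂ (Q (Q z)) z = inner ℂ (Q z) (Q z) := hQsa.isSymmetric (Q z) z
    rw [inner_add_left, hs1, hs2] at h1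
    simp only [ContinuousLinearMap.coe_coe, inner_self_eq_norm_sq_to_K] at h1
    have h2 : ‖F z‖ ^ 2 + ‖Q z‖ ^ 2 = ‖z‖ ^ 2 := by exact_mod_cast h1
    rw [one_mul]
    exact (sq_le_sq₀ (norm_nonneg _) (norm_nonneg _)).mp (by nlinarith [sq_nonneg ‖F z‖])
  by_cases hH : Nontrivial H
  · have := spectrum.norm_le_norm_of_mem hq
    exact (le_abs_self q).trans (this.trans hn)
  · rw [not_nontrivial_iff_subsingleton] at hH
    have : Subsingleton (H →L[ℂ] H) := inferInstance
    simp [spectrum.of_subsingleton] at hq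


/-- **Commutators with the bounded transform.**  Let `D₀` be a self-adjoint operator on a
Hilbert space `H`, encoded by its bounded transform pair `(F, Q)`:
`F = F_{D₀} = D₀(1+D₀²)^{-1/2}`, `Q = ⟨D₀⟩⁻¹ = (1+D₀²)^{-1/2}` (`Q` positive injective,
`F` self-adjoint, `FQ = QF`, `F² + Q² = 1`, `dom D₀ = ran Q`, `D₀(Qξ) = Fξ`,
`⟨D₀⟩^s = (cfc (·^s) Q)⁻¹`).  Let `S` be a bounded operator with `S (dom D₀) ⊆ dom D₀`
such that `[D₀,S]⟨D₀⟩^{-α}` extends to a bounded operator for some `0 ≤ α < 1`; since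
`[D₀,S](Qξ) = Fη - S(Fξ)` where `S(Qξ) = Qη`, and `⟨D₀⟩^α (Qξ) = Q^{1-α} ξ`, this is
hypothesis `hrel`.  Then for every `0 ≤ β < 1 - α`, the operator `[F_{D₀}, S]⟨D₀⟩^β` is
bounded, i.e. `‖[F,S]ζ‖ ≤ C ‖Q^β ζ‖` for all `ζ`.  (The cases `β < 0` are trivial and
omitted.) -/
theorem stmt16 {H : Type*} [NormedAddCommGroup H] [InnerProductSpace ℂ H] [CompleteSpace H]
    (F Q : H →L[ℂ] H) (hQpos : Q.IsPositive) (hQinj : Function.Injective Q)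
    (hF : IsSelfAdjoint F) (hFQ : F * Q = Q * F) (hpyth : F * F + Q * Q = 1)
    (α : ℝ) (hα0 : 0 ≤ α) (hα1 : α < 1)
    (S : H →L[ℂ] H)
    (hSdom : ∀ ξ : H, ∃ η : H, S (Q ξ) = Q η)
    (hrel : ∃ C : ℝ, ∀ (ξ η : H), S (Q ξ) = Q η →
      ‖F η - S (F ξ)‖ ≤ C * ‖cfc (fun t : ℝ => t ^ (1 - α)) Q ξ‖) :
    ∀ β : ℝ, 0 ≤ β → β < 1 - α →
      ∃ C : ℝ, ∀ ζ : H, ‖F (S ζ) - S (F ζ)‖ ≤ C * ‖cfc (fun t : ℝ => t ^ β) Q ζ‖ := by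
  intro β hβ0 hβ1
  have hsp := stmt16_spec F Q hQpos hF hpyth
  have hQsa : IsSelfAdjoint Q := hQpos.isSelfAdjoint
  obtain ⟨T, hT⟩ := stmt16_T Q S hQinj hSdom
  obtain ⟨C₀, hC₀⟩ := hrel
  obtain ⟨C, hCnn, hC⟩ : ∃ C : ℝ, 0 ≤ C ∧ ∀ ξ : H,
      ‖(F * T - S * F) ξ‖ ≤ C * ‖cfc (fun t : ℝ => t ^ (1 - α)) Q ξ‖ := by
    refine ⟨|C₀|, abs_nonneg _, fun ξ => ?_⟩
    have h1 : S (Q ξ) = Q (T ξ) := congrArg (fun A : H →L[ℂ] H => A ξ) hT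
    exact (hC₀ ξ (T ξ) h1).trans (by gcongr; exact le_abs_self _)
  -- functional calculus
  have hne : ∀ q ∈ spectrum ℝ Q, (1 + q) ≠ 0 := fun q hq => by linarith [(hsp q hq).1]
  have hcJ : ContinuousOn (fun q : ℝ => 1 / (1 + q)) (spectrum ℝ Q) :=
    ContinuousOn.div (by fun_prop) (by fun_prop) hne
  have hcr : ContinuousOn (fun q : ℝ => (1 - q) / (1 + q)) (spectrum ℝ Q) :=
    ContinuousOn.div (by fun_prop) (by fun_prop) hne
  have h1Q : cfc (fun q : ℝ => 1 + q) Q = 1 + Q := by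
    rw [cfc_const_add (1 : ℝ) (fun q => q) Q, cfc_id' ℝ Q]; simp
  have h1mQ : cfc (fun q : ℝ => 1 - q) Q = 1 - Q := by
    rw [cfc_sub (fun _ => (1 : ℝ)) (fun q => q) Q, cfc_id' ℝ Q, cfc_const_one ℝ Q]
  set J : H →L[ℂ] H := cfc (fun q : ℝ => 1 / (1 + q)) Q with hJ
  have hJ1 : J * (1 + Q) = 1 := by
    rw [hJ, ← h1Q, ← cfc_mul _ _ Q hcJ (by fun_prop), ← cfc_const_one ℝ Q]
    exact cfc_congr fun q hq => by have := hne q hq; field_simp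
  have hJ2 : (1 + Q) * J = 1 := by
    rw [hJ, ← h1Q, ← cfc_mul _ _ Q (by fun_prop) hcJ, ← cfc_const_one ℝ Q]
    exact cfc_congr fun q hq => by have := hne q hq; field_simp
  have hcomm : ∀ f : ℝ → ℝ, Commute F (cfc f Q) := fun f =>
    ((show Commute Q F from hFQ.symm).cfc_real f).symm
  have hFJ : F * J = J * F := hcomm _
  set t : H →L[ℂ] H := F * J with ht
  have htc : ∀ f : ℝ → ℝ, Commute t (cfc f Q) := fun f =>
    (hcomm f).mul_left (cfc_commute_cfc _ _ Q)
  have htsa : IsSelfAdjoint t := by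
    have hJsa : IsSelfAdjoint J := cfc_predicate _ Q
    rw [IsSelfAdjoint, ht, star_mul, hJsa.star_eq, hF.star_eq]
    exact hFJ.symm
  have hr : t * t = cfc (fun q : ℝ => (1 - q) / (1 + q)) Q := by
    have e : cfc (fun q : ℝ => (1 - q) / (1 + q)) Q = (1 - Q) * J := by
      rw [hJ, ← h1mQ, ← cfc_mul _ _ Q (by fun_prop) hcJ]
      exact cfc_congr fun q hq => by simp [div_eq_mul_inv]
    have e1 : t * t = (F * F) * (J * J) := by
      have hFJ' : J * F = F * J := (hcomm _ : Commute F J).eq.symm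
      calc t * t = F * (J * F) * J := by rw [ht]; simp only [mul_assoc]
        _ = _ := by rw [hFJ']; simp only [mul_assoc]
    have e2 : F * F = (1 - Q) * (1 + Q) := by
      rw [eq_sub_of_add_eq hpyth]; noncomm_ring
    rw [e, e1, e2, mul_assoc, ← mul_assoc (1 + Q), hJ2, one_mul]
  have hrpow : ∀ m : ℕ, (t * t) ^ m = cfc (fun q : ℝ => ((1 - q) / (1 + q)) ^ m) Q := fun m => by
    rw [hr, ← cfc_pow _ m Q hcr]
  have hw : 1 - t * t = cfc (fun q : ℝ => 2 * q / (1 + q)) Q := by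
    rw [hr, ← cfc_const_one ℝ Q, ← cfc_sub _ _ Q (by fun_prop) hcr]
    exact cfc_congr fun q hq => by have := hne q hq; field_simp; ring
  have hrle : ∀ q ∈ spectrum ℝ Q, 0 ≤ (1 - q) / (1 + q) ∧ (1 - q) / (1 + q) ≤ 1 := fun q hq => by
    obtain ⟨h0, h1⟩ := hsp q hq
    refine ⟨div_nonneg (by linarith) (by linarith), ?_⟩
    rw [div_le_one (by linarith)]; linarith
  have hrn : ∀ m : ℕ, ‖(t * t) ^ m‖ ≤ 1 := fun m => by
    rw [hrpow]
    refine norm_cfc_le zero_le_one fun q hq => ?_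
    rw [Real.norm_of_nonneg (pow_nonneg (hrle q hq).1 m)]
    exact pow_le_one₀ (hrle q hq).1 (hrle q hq).2
  have htn : ‖t‖ ≤ 1 := by
    have h1 : ‖t‖ * ‖t‖ ≤ 1 := by
      rw [← CStarRing.norm_star_mul_self, htsa.star_eq]; simpa using hrn 1
    nlinarith [norm_nonneg t]
  have htv : ∀ v, ‖t v‖ ≤ ‖v‖ := fun v =>
    (t.le_opNorm v).trans (mul_le_of_le_one_left (norm_nonneg _) htn)
  have hrv : ∀ m v, ‖((t * t) ^ m) v‖ ≤ ‖v‖ := fun m v =>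
    (((t * t) ^ m).le_opNorm v).trans (mul_le_of_le_one_left (norm_nonneg _) (hrn m))
  -- powers
  set ε := 1 - α - β with hε
  have hε0 : 0 < ε := by rw [hε]; linarith
  have hε1 : ε ≤ 1 := by rw [hε]; linarith
  have hcε : Continuous (fun q : ℝ => q ^ ε) := Real.continuous_rpow_const hε0.le
  have hcβ : Continuous (fun q : ℝ => q ^ β) := Real.continuous_rpow_const hβ0
  set A : H →L[ℂ] H := cfc (fun t : ℝ => t ^ (1 - α)) Q with hA
  set B : H →L[ℂ] H := cfc (fun t : ℝ => t ^ β) Q with hB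
  set E : H →L[ℂ] H := cfc (fun t : ℝ => t ^ ε) Q with hE
  have hAE : A = E * B := by
    rw [hA, hE, hB, ← cfc_mul _ _ Q hcε.continuousOn hcβ.continuousOn]
    refine cfc_congr fun q hq => ?_
    change q ^ (1 - α) = q ^ ε * q ^ β
    rw [← Real.rpow_add_of_nonneg (hsp q hq).1 hε0.le hβ0]
    congr 1; rw [hε]; ring
  have hEn : ‖E‖ ≤ 1 := by
    refine norm_cfc_le zero_le_one fun q hq => ?_
    rw [Real.norm_of_nonneg (Real.rpow_nonneg (hsp q hq).1 _)]
    exact Real.rpow_le_one (hsp q hq).1 (hsp q hq).2 hε0.le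
  have hAv : ∀ v, ‖A v‖ ≤ ‖B v‖ := fun v => by
    rw [hAE]
    exact (E.le_opNorm (B v)).trans (mul_le_of_le_one_left (norm_nonneg _) hEn)
  have hEw : ∀ m : ℕ, ‖E * (1 - t * t) * (t * t) ^ m‖ ≤ 2 * (1 / ((m : ℝ) + 1) ^ (1 + ε)) := by
    intro m
    have hcw : ContinuousOn (fun q : ℝ => 2 * q / (1 + q)) (spectrum ℝ Q) :=
      ContinuousOn.div (by fun_prop) (by fun_prop) hne
    rw [hw, hrpow, hE, ← cfc_mul _ _ Q hcε.continuousOn hcw,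
      ← cfc_mul (fun q : ℝ => q ^ ε * (2 * q / (1 + q))) (fun q : ℝ => ((1 - q) / (1 + q)) ^ m) Q
        (hcε.continuousOn.mul hcw) (hcr.pow m)]
    refine norm_cfc_le (by positivity) fun q hq => ?_
    obtain ⟨h0, h1⟩ := hsp q hq
    have hp := pow_nonneg (hrle q hq).1 m
    have h2 : 0 ≤ 2 * q / (1 + q) := by positivity
    have h3 : 2 * q / (1 + q) ≤ 2 * q := div_le_self (by linarith) (by linarith)
    have h4 : 0 ≤ q ^ ε := Real.rpow_nonneg h0 _
    rw [Real.norm_of_nonneg (by positivity)]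
    calc q ^ ε * (2 * q / (1 + q)) * ((1 - q) / (1 + q)) ^ m
        ≤ q ^ ε * (2 * q) * ((1 - q) / (1 + q)) ^ m := by gcongr
      _ = 2 * (q ^ (1 + ε) * ((1 - q) / (1 + q)) ^ m) := by
          rw [Real.rpow_add_of_nonneg h0 zero_le_one hε0.le, Real.rpow_one]; ring
      _ ≤ _ := by
          gcongr
          exact stmt16_scalar q h0 h1 (1 + ε) (by linarith) (by linarith) m
  have hQm : ∀ m : ℕ, ‖(t * t) ^ m * Q‖ ≤ 1 / ((m : ℝ) + 1) := by
    intro m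
    have : (t * t) ^ m * Q = cfc (fun q : ℝ => ((1 - q) / (1 + q)) ^ m * q) Q := by
      rw [cfc_mul (fun q : ℝ => ((1 - q) / (1 + q)) ^ m) (fun q : ℝ => q) Q (hcr.pow m) (by fun_prop), cfc_id' ℝ Q, hrpow]
    rw [this]
    refine norm_cfc_le (by positivity) fun q hq => ?_
    obtain ⟨h0, h1⟩ := hsp q hq
    rw [Real.norm_of_nonneg (mul_nonneg (pow_nonneg (hrle q hq).1 m) h0)]
    have := stmt16_scalar q h0 h1 1 zero_le_one one_le_two m
    rwa [Real.rpow_one, Real.rpow_one, mul_comm] at this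
  -- algebra
  have hring := stmt16_ring F Q S T J hFQ hpyth hT (fun a b hab => by
    ext x
    exact hQinj (congrArg (fun A : H →L[ℂ] H => A x) hab)) hJ1 hJ2 hFJ
  rw [← ht] at hring
  have hiter := stmt16_iter _ _ t hring
  have hFS : F * S - S * F = F * (S - T) + (F * T - S * F) := by noncomm_ring
  set K : H →L[ℂ] H := F * T - S * F with hK
  set P : H →L[ℂ] H := (S - T) + K * t with hP
  set U : H →L[ℂ] H := t * t * K * (1 - t * t) * t - t * K * (1 - t * t) with hU
  have hKw : ∀ (m : ℕ) v, ‖K ((1 - t * t) (((t * t) ^ m) v))‖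
      ≤ C * (2 * (1 / ((m : ℝ) + 1) ^ (1 + ε))) * ‖B v‖ := by
    intro m v
    refine (hC _).trans ?_
    rw [mul_assoc C]
    refine mul_le_mul_of_nonneg_left ?_ hCnn
    have e : A * ((1 - t * t) * (t * t) ^ m) = E * (1 - t * t) * (t * t) ^ m * B := by
      have c1 : Commute B ((1 - t * t) * (t * t) ^ m) := by
        rw [hw, hrpow]; exact (cfc_commute_cfc _ _ Q).mul_right (cfc_commute_cfc _ _ Q)
      rw [hAE, mul_assoc, c1.eq]; simp only [mul_assoc]
    have e' : A ((1 - t * t) (((t * t) ^ m) v)) = (E * (1 - t * t) * (t * t) ^ m) (B v) :=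
      congrArg (fun A : H →L[ℂ] H => A v) e
    rw [e']
    exact (ContinuousLinearMap.le_opNorm _ _).trans
      (mul_le_mul_of_nonneg_right (hEw m) (norm_nonneg _))
  have hBt : ∀ v, ‖B (t v)‖ ≤ ‖B v‖ := fun v => by
    have : B (t v) = t (B v) := congrArg (fun A : H →L[ℂ] H => A v) (htc _).eq.symm
    rw [this]; exact htv _
  have hUv : ∀ (m : ℕ) v, ‖((t * t) ^ m * U * (t * t) ^ m) v‖
      ≤ (4 * C * ‖B v‖) * (1 / ((m : ℝ) + 1) ^ (1 + ε)) := by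
    intro m v
    refine (hrv m (U (((t * t) ^ m) v))).trans ?_
    have e1 : U (((t * t) ^ m) v) = t (t (K ((1 - t * t) (((t * t) ^ m) (t v)))))
        - t (K ((1 - t * t) (((t * t) ^ m) v))) := by
      have c : t * (t * t) ^ m = (t * t) ^ m * t :=
        ((Commute.refl t).mul_right (Commute.refl t)).pow_right m
      have c' : t (((t * t) ^ m) v) = ((t * t) ^ m) (t v) :=
        congrArg (fun A : H →L[ℂ] H => A v) c
      rw [← c']; rfl
    rw [e1]
    have b1 := (hKw m (t v)).trans (mul_le_mul_of_nonneg_left (hBt v) (by positivity))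
    have b2 := hKw m v
    refine (norm_sub_le _ _).trans ?_
    have := (htv _).trans ((htv _).trans b1)
    have := (htv _).trans b2
    linarith
  have hsum : Summable (fun m : ℕ => 1 / ((m : ℝ) + 1) ^ (1 + ε)) := by
    have := (summable_nat_add_iff 1).mpr
      (Real.summable_one_div_nat_rpow.mpr (show 1 < 1 + ε by linarith))
    simpa using this
  set M := ∑' m : ℕ, 1 / ((m : ℝ) + 1) ^ (1 + ε) with hM
  have hPN : ∀ (N : ℕ) v, ‖P v‖ ≤ 4 * C * ‖B v‖ * M + ‖P‖ * ‖((t * t) ^ N) v‖ := by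
    intro N v
    conv_lhs => rw [hiter N]
    rw [add_apply, sum_apply]
    refine (norm_add_le _ _).trans (add_le_add ?_ ?_)
    · refine (norm_sum_le_of_le _ fun m _ => hUv m v).trans ?_
      rw [← Finset.mul_sum]
      refine mul_le_mul_of_nonneg_left ?_ (by positivity)
      exact hsum.sum_le_tsum _ fun m _ => by positivity
    · exact (hrv N _).trans (P.le_opNorm _)
  have hPQ : ∀ z, ‖P (Q z)‖ ≤ 4 * C * ‖B (Q z)‖ * M := by
    intro z
    have hl : Filter.Tendsto (fun N : ℕ => 4 * C * ‖B (Q z)‖ * M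
        + ‖P‖ * (1 / ((N : ℝ) + 1) * ‖z‖)) Filter.atTop
        (nhds (4 * C * ‖B (Q z)‖ * M + ‖P‖ * (0 * ‖z‖))) :=
      ((tendsto_one_div_add_atTop_nhds_zero_nat.mul_const _).const_mul _).const_add _
    rw [zero_mul, mul_zero, add_zero] at hl
    refine ge_of_tendsto' hl fun N => (hPN N (Q z)).trans ?_
    gcongr
    exact (((t * t) ^ N * Q).le_opNorm z).trans
      (mul_le_mul_of_nonneg_right (hQm N) (norm_nonneg _))
  have hPv : ∀ v, ‖P v‖ ≤ 4 * C * ‖B v‖ * M := by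
    intro v
    refine (stmt16_dense Q hQsa hQinj).induction_on (p := fun v => ‖P v‖ ≤ 4 * C * ‖B v‖ * M)
      v ?_ hPQ
    exact isClosed_le (by fun_prop) (by fun_prop)
  refine ⟨‖F‖ * (4 * C * M + C) + C, fun ζ => ?_⟩
  have e : F (S ζ) - S (F ζ) = F (P ζ - K (t ζ)) + K ζ := by
    have h1 : F (S ζ) - S (F ζ) = F ((S - T) ζ) + K ζ :=
      congrArg (fun A : H →L[ℂ] H => A ζ) hFS
    have h2 : P ζ - K (t ζ) = (S - T) ζ := by rw [hP]; simp
    rw [h1, h2]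
  rw [e]
  have b1 : ‖K ζ‖ ≤ C * ‖B ζ‖ := (hC ζ).trans (mul_le_mul_of_nonneg_left (hAv ζ) hCnn)
  have b2 : ‖K (t ζ)‖ ≤ C * ‖B ζ‖ := (hC (t ζ)).trans
    (mul_le_mul_of_nonneg_left ((hAv (t ζ)).trans (hBt ζ)) hCnn)
  calc ‖F (P ζ - K (t ζ)) + K ζ‖ ≤ ‖F‖ * (‖P ζ‖ + ‖K (t ζ)‖) + ‖K ζ‖ :=
        (norm_add_le _ _).trans (add_le_add ((F.le_opNorm _).trans
          (mul_le_mul_of_nonneg_left (norm_sub_le _ _) (norm_nonneg _))) le_rfl)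
    _ ≤ ‖F‖ * (4 * C * ‖B ζ‖ * M + C * ‖B ζ‖) + C * ‖B ζ‖ := by
        gcongr
        exact hPv ζ
    _ = _ := by ring
end
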